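/- Let p be an odd prime and consider UCS p-groups G of exponent p² that are minimally generated by 4 elements (equivalently |G/Φ(G)| = p⁴, and then necessarily |G| = p⁸). Then: (a) if p = 5 there is no such group; (b) if p ≡ ±1 (mod 5) there is, up to isomorphism, exactly one such group, and its automorphism group induces on G/Φ(G) a linear group of order 20; (c) if p ≡ ±2 (mod 5) there are, up to isomorphism, exactly two such groups, one with induced automorphism group of order 20 on G/Φ(G) and one with induced automorphism group of order 5. -/

import Mathlib

/-- A finite `p`-group is a UCS group if it has exactly three characteristic
subgroups. -/
def IsUCS (p : ℕ) (G : Type*) [Group G] : Prop :=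
  IsPGroup p G ∧ Nat.card {H : Subgroup G // H.Characteristic} = 3

/-- `G` is a non-abelian UCS `p`-group of exponent `p²` minimally generated
by `4` elements. -/
def IsUCS4GenExpP2 (p : ℕ) (G : Type*) [Group G] : Prop :=
  IsUCS p G ∧ (¬ ∀ a b : G, a * b = b * a) ∧
    Monoid.exponent G = p ^ 2 ∧ Nat.card (G ⧸ frattini G) = p ^ 4

/-- The order of the group of automorphisms of `G/Φ(G)` induced by
automorphisms of `G`. -/
noncomputable def inducedAutCard (G : Type*) [Group G] : ℕ :=
  Nat.card {ψ : MulAut (G ⧸ frattini G) //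
    ∃ φ : MulAut G, ∀ g : G, ψ (QuotientGroup.mk g) = QuotientGroup.mk (φ g)}

open Module

section Algebra

variable {K U : Type*} [Field K] [AddCommGroup U] [Module K U]

/-- A semilinear automorphism of the algebra with multiplication `m`. -/
def IsSemiAut (m : U →ₗ[K] U →ₗ[K] U) (T : U ≃+ U) : Prop :=
  (∃ σ : K ≃+* K, ∀ (a : K) (x : U), T (a • x) = σ a • T x) ∧
    ∀ x y, T (m x y) = m (T x) (T y)

theorem IsSemiAut.symm {m : U →ₗ[K] U →ₗ[K] U} {T : U ≃+ U} (h : IsSemiAut m T) :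
    IsSemiAut m T.symm := by
  obtain ⟨⟨σ, hσ⟩, hm⟩ := h
  refine ⟨⟨σ.symm, fun a x => T.injective ?_⟩, fun x y => T.injective ?_⟩
  · simp [hσ]
  · simp [hm]

theorem IsSemiAut.linearIndependent {m : U →ₗ[K] U →ₗ[K] U} {T : U ≃+ U} (h : IsSemiAut m T)
    {n : ℕ} {v : Fin n → U} (hv : LinearIndependent K v) :
    LinearIndependent K (fun i => T (v i)) := by
  obtain ⟨⟨σ, hσ⟩, -⟩ := h
  rw [Fintype.linearIndependent_iff] at hv ⊢
  intro g hg i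
  have h1 : T (∑ i, σ.symm (g i) • v i) = 0 := by
    rw [map_sum, ← hg]
    exact Finset.sum_congr rfl fun i _ => by simp [hσ]
  have h2 := hv _ ((map_eq_zero_iff T T.injective).1 h1) i
  simpa using h2

theorem exists_eq_of_linearIndependent_four (hU : finrank K U = 4) {a b c d : U}
    (h : LinearIndependent K ![a, b, c, d]) (u : U) :
    ∃ s t r w : K, u = s • a + t • b + r • c + w • d := by
  have hB := coe_basisOfLinearIndependentOfCardEqFinrank h (by simp [hU])
  generalize basisOfLinearIndependentOfCardEqFinrank h (by simp [hU]) = B at hB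
  refine ⟨B.repr u 0, B.repr u 1, B.repr u 2, B.repr u 3, ?_⟩
  have := B.sum_repr u
  rw [Fin.sum_univ_four, hB] at this
  exact this.symm

theorem eq_zero_of_linearIndependent_four {a b c d : U}
    (h : LinearIndependent K ![a, b, c, d]) {s t r w : K}
    (e : s • a + t • b + r • c + w • d = 0) : s = 0 ∧ t = 0 ∧ r = 0 ∧ w = 0 := by
  rw [Fintype.linearIndependent_iff] at h
  have := h ![s, t, r, w] (by simpa [Fin.sum_univ_four] using e)
  exact ⟨this 0, this 1, this 2, this 3⟩

theorem linearIndependent_four_iff {a b c d : U} :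
    LinearIndependent K ![a, b, c, d] ↔ ∀ s t r w : K,
      s • a + t • b + r • c + w • d = 0 → s = 0 ∧ t = 0 ∧ r = 0 ∧ w = 0 := by
  refine ⟨fun h s t r w e => eq_zero_of_linearIndependent_four h e, fun h => ?_⟩
  rw [Fintype.linearIndependent_iff]
  intro g hg i
  obtain ⟨h0, h1, h2, h3⟩ := h (g 0) (g 1) (g 2) (g 3) (by simpa [Fin.sum_univ_four] using hg)
  fin_cases i <;> assumption

theorem linearIndependent_three_iff {a b c : U} :
    LinearIndependent K ![a, b, c] ↔ ∀ s t r : K,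
      s • a + t • b + r • c = 0 → s = 0 ∧ t = 0 ∧ r = 0 := by
  rw [Fintype.linearIndependent_iff]
  refine ⟨fun h s t r e => ?_, fun h g hg i => ?_⟩
  · have := h ![s, t, r] (by simpa [Fin.sum_univ_three] using e)
    exact ⟨this 0, this 1, this 2⟩
  · obtain ⟨h0, h1, h2⟩ := h (g 0) (g 1) (g 2) (by simpa [Fin.sum_univ_three] using hg)
    fin_cases i <;> assumption

theorem map_swap_of_alternating {m : U →ₗ[K] U →ₗ[K] U} (halt : ∀ x, m x x = 0) (x y : U) :
    m x y = - m y x := by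
  have h := halt (x + y)
  simp only [map_add, LinearMap.add_apply, halt, zero_add, add_zero] at h
  exact eq_neg_of_add_eq_zero_right h

/-- The algebra is perfect: it is spanned by products. -/
def SpannedByProducts (m : U →ₗ[K] U →ₗ[K] U) : Prop :=
  ∀ W : Submodule K U, (∀ x y, m x y ∈ W) → W = ⊤

theorem SpannedByProducts.linearIndependent {m : U →ₗ[K] U →ₗ[K] U} (hspan : SpannedByProducts m)
    (hU : finrank K U = 4) (halt : ∀ x, m x x = 0) {a b c d : U}
    (h : LinearIndependent K ![a, b, c, d]) {q : Fin 4 → U}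
    (h1 : m a b ∈ Submodule.span K (Set.range q)) (h2 : m a c ∈ Submodule.span K (Set.range q))
    (h3 : m a d ∈ Submodule.span K (Set.range q)) (h4 : m b c ∈ Submodule.span K (Set.range q))
    (h5 : m b d ∈ Submodule.span K (Set.range q)) (h6 : m c d ∈ Submodule.span K (Set.range q)) :
    LinearIndependent K q := by
  refine linearIndependent_of_top_le_span_of_card_eq_finrank (hspan _ fun x y => ?_).ge
    (by simp [hU])
  obtain ⟨s, t, r, w, rfl⟩ := exists_eq_of_linearIndependent_four hU h x
  obtain ⟨s', t', r', w', rfl⟩ := exists_eq_of_linearIndependent_four hU h y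
  have e : m (s • a + t • b + r • c + w • d) (s' • a + t' • b + r' • c + w' • d) =
      (s * t' - t * s') • m a b + (s * r' - r * s') • m a c + (s * w' - w * s') • m a d +
      (t * r' - r * t') • m b c + (t * w' - w * t') • m b d + (r * w' - w * r') • m c d := by
    simp only [map_add, map_smul, LinearMap.add_apply, LinearMap.smul_apply, halt,
      map_swap_of_alternating halt b a, map_swap_of_alternating halt c a,
      map_swap_of_alternating halt c b, map_swap_of_alternating halt d a,
      map_swap_of_alternating halt d b, map_swap_of_alternating halt d c]
    module
  rw [e]
  exact add_mem (add_mem (add_mem (add_mem (add_mem (Submodule.smul_mem _ _ h1)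
    (Submodule.smul_mem _ _ h2)) (Submodule.smul_mem _ _ h3)) (Submodule.smul_mem _ _ h4))
    (Submodule.smul_mem _ _ h5)) (Submodule.smul_mem _ _ h6)

theorem exists_mul_eq_zero_of_plucker {m : U →ₗ[K] U →ₗ[K] U} (halt : ∀ x, m x x = 0)
    {a b c d : U} (h : LinearIndependent K ![a, b, c, d]) {p q r s t u : K} (hp : p ≠ 0)
    (hpf : p * u - q * t + r * s = 0)
    (h0 : p • m a b + q • m a c + r • m a d + s • m b c + t • m b d + u • m c d = 0) :
    ∃ x y, m x y = 0 ∧ LinearIndependent K ![x, y] := by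
  refine ⟨p • b + q • c + r • d, (-p) • a + s • c + t • d, ?_, ?_⟩
  · have e : m (p • b + q • c + r • d) ((-p) • a + s • c + t • d) =
      p • (p • m a b + q • m a c + r • m a d + s • m b c + t • m b d + u • m c d)
        - (p * u - q * t + r * s) • m c d := by
      simp only [map_add, map_smul, LinearMap.add_apply, LinearMap.smul_apply, halt,
        map_swap_of_alternating halt b a, map_swap_of_alternating halt c a,
        map_swap_of_alternating halt d a, map_swap_of_alternating halt d c]
      module
    rw [e, h0, hpf]
    simp
  · rw [LinearIndependent.pair_iff]
    intro α β e
    have := eq_zero_of_linearIndependent_four h (s := -(β * p)) (t := α * p)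
      (r := α * q + β * s) (w := α * r + β * t) (by rw [← e]; module)
    simpa [hp] using And.intro this.2.1 this.1

theorem exists_mul_eq_zero [IsAlgClosed K] {m : U →ₗ[K] U →ₗ[K] U}
    (hU : finrank K U = 4) (halt : ∀ x, m x x = 0) :
    ∃ x y, m x y = 0 ∧ LinearIndependent K ![x, y] := by
  have : FiniteDimensional K U := Module.finite_of_finrank_pos (by omega)
  let B := finBasisOfFinrankEq K U hU
  have hB : LinearIndependent K ![B 0, B 1, B 2, B 3] := by
    convert B.linearIndependent using 1
    funext i; fin_cases i <;> rfl
  generalize B 0 = a at hB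
  generalize B 1 = b at hB
  generalize B 2 = c at hB
  generalize B 3 = d at hB
  let F : (Fin 6 → K) →ₗ[K] U := Fintype.linearCombination K
    ![m a b, m a c, m a d, m b c, m b d, m c d]
  have hF : ∀ v, F v = v 0 • m a b + v 1 • m a c + v 2 • m a d + v 3 • m b c + v 4 • m b d +
      v 5 • m c d := fun v => by
    simp [F, Fintype.linearCombination_apply, Fin.sum_univ_six]
  have hk : 1 < finrank K (LinearMap.ker F) := by
    have h1 := LinearMap.finrank_range_add_finrank_ker F
    have h2 := Submodule.finrank_le (LinearMap.range F)
    simp at h1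
    omega
  have : Nontrivial (LinearMap.ker F) := Module.nontrivial_of_finrank_pos (R := K) (by omega)
  obtain ⟨⟨v, hv⟩, hv0⟩ := exists_ne (0 : LinearMap.ker F)
  obtain ⟨⟨w, hw⟩, hvw⟩ := exists_linearIndependent_pair_of_one_lt_finrank hk hv0
  have hvw' : ∀ s t : K, s • v + t • w = 0 → s = 0 ∧ t = 0 := fun s t h => by
    rw [LinearIndependent.pair_iff] at hvw
    exact hvw s t (Subtype.ext h)
  have key : ∃ z : Fin 6 → K, z ≠ 0 ∧ F z = 0 ∧ z 0 * z 5 - z 1 * z 4 + z 2 * z 3 = 0 := by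
    by_cases hw2 : w 0 * w 5 - w 1 * w 4 + w 2 * w 3 = 0
    · refine ⟨w, fun h => ?_, hw, hw2⟩
      simpa using hvw' 0 1 (by simp [h])
    · obtain ⟨x, hx⟩ := IsAlgClosed.exists_root
        (Polynomial.C (w 0 * w 5 - w 1 * w 4 + w 2 * w 3) * Polynomial.X ^ 2 +
          Polynomial.C (v 0 * w 5 + w 0 * v 5 - v 1 * w 4 - w 1 * v 4 + v 2 * w 3 + w 2 * v 3) *
            Polynomial.X + Polynomial.C (v 0 * v 5 - v 1 * v 4 + v 2 * v 3))
        (by rw [Polynomial.degree_quadratic hw2]; decide)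
      refine ⟨v + x • w, fun h => ?_, ?_, ?_⟩
      · simpa using (hvw' 1 x (by simpa using h)).1
      · rw [map_add, map_smul, hv, hw]; simp
      · simp only [Polynomial.IsRoot, Polynomial.eval_add, Polynomial.eval_mul, Polynomial.eval_C,
          Polynomial.eval_pow, Polynomial.eval_X] at hx
        simp only [Pi.add_apply, Pi.smul_apply, smul_eq_mul]
        linear_combination hx
  obtain ⟨z, hz0, hz, hpf⟩ := key
  rw [hF] at hz
  have sw := map_swap_of_alternating halt
  by_contra hno
  have H0 : z 0 = 0 := by
    by_contra h
    exact hno (exists_mul_eq_zero_of_plucker halt hB h hpf hz)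
  have H1 : z 1 = 0 := by
    by_contra h
    have hB' : LinearIndependent K ![a, c, b, d] := by
      rw [linearIndependent_four_iff] at hB ⊢
      intro s t r w e
      have := hB s r t w (by rw [← e]; abel)
      tauto
    refine hno (exists_mul_eq_zero_of_plucker (p := z 1) (q := z 0) (r := z 2) (s := - z 3)
      (t := z 5) (u := z 4) halt hB' h (by linear_combination -hpf) ?_)
    rw [← hz, sw c b]; module
  have H2 : z 2 = 0 := by
    by_contra h
    have hB' : LinearIndependent K ![a, d, b, c] := by
      rw [linearIndependent_four_iff] at hB ⊢
      intro s t r w e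
      have := hB s r w t (by rw [← e]; abel)
      tauto
    refine hno (exists_mul_eq_zero_of_plucker (p := z 2) (q := z 0) (r := z 1) (s := - z 4)
      (t := - z 5) (u := z 3) halt hB' h (by linear_combination hpf) ?_)
    rw [← hz, sw d b, sw d c]; module
  have H3 : z 3 = 0 := by
    by_contra h
    have hB' : LinearIndependent K ![b, c, a, d] := by
      rw [linearIndependent_four_iff] at hB ⊢
      intro s t r w e
      have := hB r s t w (by rw [← e]; abel)
      tauto
    refine hno (exists_mul_eq_zero_of_plucker (p := z 3) (q := - z 0) (r := z 4) (s := - z 1)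
      (t := z 5) (u := z 2) halt hB' h (by linear_combination hpf) ?_)
    rw [← hz, sw b a, sw c a]; module
  have H4 : z 4 = 0 := by
    by_contra h
    have hB' : LinearIndependent K ![b, d, a, c] := by
      rw [linearIndependent_four_iff] at hB ⊢
      intro s t r w e
      have := hB r s w t (by rw [← e]; abel)
      tauto
    refine hno (exists_mul_eq_zero_of_plucker (p := z 4) (q := - z 0) (r := z 3) (s := - z 2)
      (t := - z 5) (u := z 1) halt hB' h (by linear_combination -hpf) ?_)
    rw [← hz, sw b a, sw d a, sw d c]; module
  have H5 : z 5 = 0 := by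
    by_contra h
    have hB' : LinearIndependent K ![c, d, a, b] := by
      rw [linearIndependent_four_iff] at hB ⊢
      intro s t r w e
      have := hB r w s t (by rw [← e]; abel)
      tauto
    refine hno (exists_mul_eq_zero_of_plucker (p := z 5) (q := - z 1) (r := - z 3) (s := - z 2)
      (t := - z 4) (u := z 0) halt hB' h (by linear_combination hpf) ?_)
    rw [← hz, sw c a, sw c b, sw d a, sw d b]; module
  exact hz0 (by funext i; fin_cases i <;> assumption)

/-- No proper nonzero subspace is stable under all semilinear automorphisms. -/
def SemiIrreducible (m : U →ₗ[K] U →ₗ[K] U) : Prop :=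
  ∀ W : Submodule K U, (∀ T, IsSemiAut m T → ∀ w ∈ W, T w ∈ W) → W = ⊥ ∨ W = ⊤

theorem IsSemiAut.map_span_subset {m : U →ₗ[K] U →ₗ[K] U} {T : U ≃+ U} (h : IsSemiAut m T)
    {S : Set U} {W : Submodule K U} (hS : ∀ s ∈ S, T s ∈ W) {w : U}
    (hw : w ∈ Submodule.span K S) : T w ∈ W := by
  obtain ⟨⟨σ, hσ⟩, -⟩ := h
  induction hw using Submodule.span_induction with
  | mem x hx => exact hS x hx
  | zero => simp
  | add x y _ _ hx hy => rw [map_add]; exact add_mem hx hy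
  | smul a x _ hx => rw [hσ]; exact W.smul_mem _ hx

/-- The span of a stable set of vectors is everything or zero. -/
theorem SemiIrreducible.span_eq_top {m : U →ₗ[K] U →ₗ[K] U} (hirr : SemiIrreducible m)
    {P : U → Prop} (hP : ∀ T, IsSemiAut m T → ∀ u, P u → P (T u)) {u : U} (hu : P u)
    (hu0 : u ≠ 0) : Submodule.span K {u | P u} = ⊤ := by
  refine (hirr _ fun T hT w hw => hT.map_span_subset (fun s hs => ?_) hw).resolve_left fun h => ?_
  · exact Submodule.subset_span (hP T hT s hs)
  · have : u ∈ Submodule.span K {u | P u} := Submodule.subset_span hu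
    rw [h] at this
    exact hu0 (by simpa using this)

theorem SemiIrreducible.spannedByProducts {m : U →ₗ[K] U →ₗ[K] U} (hirr : SemiIrreducible m)
    (hm : m ≠ 0) : SpannedByProducts m := by
  intro W hW
  obtain ⟨x, y, hxy⟩ : ∃ x y, m x y ≠ 0 := by
    by_contra! h
    exact hm (LinearMap.ext fun x => LinearMap.ext fun y => h x y)
  have := hirr.span_eq_top (P := fun z => ∃ x y, z = m x y)
    (fun T hT u ⟨x, y, h⟩ => ⟨T x, T y, by rw [h, hT.2]⟩) ⟨x, y, rfl⟩ hxy
  rw [← top_le_iff, ← this, Submodule.span_le]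
  rintro _ ⟨x, y, rfl⟩
  exact hW x y

theorem exists_linearIndependent_four (hU : finrank K U = 4) {a b c : U}
    (h : LinearIndependent K ![a, b, c]) : ∃ d, LinearIndependent K ![a, b, c, d] := by
  have hlt : Submodule.span K (Set.range ![a, b, c]) ≠ ⊤ := fun h' => by
    have h1 := finrank_range_le_card (R := K) ![a, b, c]
    rw [Set.finrank, h', finrank_top, hU] at h1
    simp at h1
  obtain ⟨d, -, hd⟩ := SetLike.exists_of_lt (lt_top_iff_ne_top.2 hlt)
  refine ⟨d, linearIndependent_four_iff.2 fun s t r w e => ?_⟩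
  have hw : w = 0 := by
    by_contra hw
    refine hd ?_
    have e' : d = (-s / w) • a + (-t / w) • b + (-r / w) • c := by
      have : w • d = (-s) • a + (-t) • b + (-r) • c := by linear_combination (norm := module) e
      rw [← inv_smul_smul₀ hw d, this]
      module
    rw [e']
    exact add_mem (add_mem (Submodule.smul_mem _ _ (Submodule.subset_span ⟨0, rfl⟩))
      (Submodule.smul_mem _ _ (Submodule.subset_span ⟨1, rfl⟩)))
      (Submodule.smul_mem _ _ (Submodule.subset_span ⟨2, rfl⟩))
  subst hw
  have := linearIndependent_three_iff.1 h s t r (by simpa using e)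
  tauto

theorem exists_complement_in_pair {m : U →ₗ[K] U →ₗ[K] U} (halt : ∀ x, m x x = 0) {x y u : U}
    (hxy : m x y = 0) (hu : u ∈ Submodule.span K {x, y}) (hu0 : u ≠ 0) :
    ∃ z ∈ Submodule.span K {x, y}, m u z = 0 ∧
      Submodule.span K {x, y} ≤ Submodule.span K {u, z} := by
  obtain ⟨s, t, rfl⟩ := Submodule.mem_span_pair.1 hu
  by_cases hs : s = 0
  · have ht : t ≠ 0 := by rintro rfl; simp [hs] at hu0
    refine ⟨x, Submodule.subset_span (by simp), by simp [halt, map_swap_of_alternating halt y x, hxy],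
      ?_⟩
    rw [Submodule.span_le]
    rintro z (rfl | rfl)
    · exact Submodule.subset_span (by simp)
    · exact Submodule.mem_span_pair.2 ⟨t⁻¹, 0, by simp [hs, ht]⟩
  · refine ⟨y, Submodule.subset_span (by simp), by simp [halt, hxy], ?_⟩
    rw [Submodule.span_le]
    rintro z (rfl | rfl)
    · refine Submodule.mem_span_pair.2 ⟨s⁻¹, - (s⁻¹ * t), ?_⟩
      rw [smul_add, inv_smul_smul₀ hs]; module
    · exact Submodule.subset_span (by simp)

/-- `v` annihilates a subspace of dimension three. -/
def IsDegenerate (m : U →ₗ[K] U →ₗ[K] U) (v : U) : Prop :=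
  ∃ y z, m v y = 0 ∧ m v z = 0 ∧ LinearIndependent K ![v, y, z]

theorem IsDegenerate.map {m : U →ₗ[K] U →ₗ[K] U} {T : U ≃+ U} (hT : IsSemiAut m T) {v : U}
    (h : IsDegenerate m v) : IsDegenerate m (T v) := by
  obtain ⟨y, z, h1, h2, h3⟩ := h
  refine ⟨T y, T z, by rw [← hT.2, h1, map_zero], by rw [← hT.2, h2, map_zero], ?_⟩
  convert hT.linearIndependent h3 using 1
  funext i; fin_cases i <;> rfl

theorem IsDegenerate.mem_span {m : U →ₗ[K] U →ₗ[K] U} (hU : finrank K U = 4)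
    (halt : ∀ x, m x x = 0) (hspan : SpannedByProducts m) {u v : U}
    (hu : IsDegenerate m u) (hv : IsDegenerate m v) : v ∈ Submodule.span K {u} := by
  obtain ⟨y, z, uy, uz, h3⟩ := hu
  obtain ⟨w, h4⟩ := exists_linearIndependent_four hU h3
  have hq : LinearIndependent K ![m u w, m y z, m y w, m z w] := by
    apply hspan.linearIndependent hU halt h4
    · rw [uy]; exact zero_mem _
    · rw [uz]; exact zero_mem _
    · exact Submodule.subset_span ⟨0, rfl⟩
    · exact Submodule.subset_span ⟨1, rfl⟩
    · exact Submodule.subset_span ⟨2, rfl⟩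
    · exact Submodule.subset_span ⟨3, rfl⟩
  obtain ⟨q, hq0⟩ : ∃ q, ∀ s, ∃ κ : K, m v s = κ • q := by
    obtain ⟨y', z', vy, vz, h3'⟩ := hv
    obtain ⟨w', h4'⟩ := exists_linearIndependent_four hU h3'
    refine ⟨m v w', fun s => ?_⟩
    obtain ⟨a, b, c, d, rfl⟩ := exists_eq_of_linearIndependent_four hU h4' s
    exact ⟨d, by simp [halt, vy, vz]⟩
  obtain ⟨a, b, c, d, rfl⟩ := exists_eq_of_linearIndependent_four hU h4 v
  have sw := map_swap_of_alternating halt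
  obtain ⟨k0, e0⟩ := hq0 u
  obtain ⟨k1, e1⟩ := hq0 y
  obtain ⟨k2, e2⟩ := hq0 z
  obtain ⟨k3, e3⟩ := hq0 w
  simp only [map_add, map_smul, LinearMap.add_apply, LinearMap.smul_apply, halt, sw y u, sw z u,
    sw z y, sw w u, sw w y, sw w z, uy, uz] at e0 e1 e2 e3
  have key := fun s t r w e => eq_zero_of_linearIndependent_four hq (s := s) (t := t) (r := r)
    (w := w) e
  have hd : d = 0 := by
    have k := key (-d * k1) (c * k0) (d * k0) 0
      (by linear_combination (norm := module) k1 • e0 - k0 • e1)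
    by_contra hd
    have hk0 : k0 = 0 := by simpa [hd] using k.2.2.1
    have hz := (key (-d) 0 0 0 (by
        rw [hk0] at e0
        linear_combination (norm := module) e0)).1
    exact hd (by simpa using hz)
  subst hd
  have hc : c = 0 := by
    have k := key (a * k1) (c * k3) (b * k1) (c * k1)
      (by linear_combination (norm := module) k1 • e3 - k3 • e1)
    by_contra hc
    have hk1 : k1 = 0 := by simpa [hc] using k.2.2.2
    exact hc (by
      simpa using (key 0 (-c) 0 0 (by rw [hk1] at e1; linear_combination (norm := module) e1)).2.1)
  subst hc
  have hb : b = 0 := by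
    have k := key (a * k2) (-b * k3) (b * k2) 0
      (by linear_combination (norm := module) k2 • e3 - k3 • e2)
    by_contra hb
    have hk2 : k2 = 0 := by simpa [hb] using k.2.2.1
    exact hb (by
      simpa using (key 0 b 0 0 (by rw [hk2] at e2; linear_combination (norm := module) e2)).2.1)
  subst hb
  simp only [zero_smul, add_zero]
  exact Submodule.smul_mem _ _ (Submodule.mem_span_singleton_self u)

theorem finrank_span_singleton_ne_top (hU : finrank K U = 4) (u : U) :
    Submodule.span K {u} ≠ ⊤ := fun h => by
  have := finrank_span_le_card (R := K) ({u} : Set U)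
  rw [h, finrank_top, hU] at this
  simp at this

theorem span_pair_ne_top (hU : finrank K U = 4) (u v : U) :
    Submodule.span K {u, v} ≠ ⊤ := fun h => by
  have := finrank_range_le_card (R := K) ![u, v]
  rw [Set.finrank, Matrix.range_cons_cons_empty, h, finrank_top, hU] at this
  simp at this

theorem SemiIrreducible.exists_two_planes [IsAlgClosed K] {m : U →ₗ[K] U →ₗ[K] U}
    (hU : finrank K U = 4) (halt : ∀ x, m x x = 0) (hirr : SemiIrreducible m) (hm : m ≠ 0) :
    ∃ T, IsSemiAut m T ∧ ∃ x y, m x y = 0 ∧ LinearIndependent K ![x, y, T x, T y] := by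
  have hspan := hirr.spannedByProducts hm
  obtain ⟨x, y, hxy, hli⟩ := exists_mul_eq_zero hU halt
  have hli' := LinearIndependent.pair_iff.1 hli
  by_contra! H
  have hx0 : x ≠ 0 := fun h => by simpa using hli' 1 0 (by simp [h])
  obtain ⟨T, hT, hTW⟩ : ∃ T, IsSemiAut m T ∧
      ¬ (Submodule.span K {T x, T y} ≤ Submodule.span K {x, y}) := by
    by_contra! h
    have hstab : ∀ T, IsSemiAut m T → ∀ w ∈ Submodule.span K {x, y},
        T w ∈ Submodule.span K {x, y} := fun T hT w hw =>
      hT.map_span_subset (fun s hs => h T hT (Submodule.subset_span (by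
        rcases hs with rfl | rfl <;> simp))) hw
    rcases hirr _ hstab with h1 | h1
    · have : x ∈ Submodule.span K {x, y} := Submodule.subset_span (by simp)
      rw [h1] at this
      exact hx0 (by simpa using this)
    · exact span_pair_ne_top hU _ _ h1
  have hliT : LinearIndependent K ![T x, T y] := by
    convert hT.linearIndependent hli using 1
    funext i; fin_cases i <;> rfl
  have hn := H T hT x y hxy
  obtain ⟨u, hu0, hu1, hu2⟩ : ∃ u, u ≠ 0 ∧ u ∈ Submodule.span K {x, y} ∧
      u ∈ Submodule.span K {T x, T y} := by
    by_contra! h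
    refine hn (linearIndependent_four_iff.2 fun s t r w e => ?_)
    have h1 : s • x + t • y = 0 := by
      by_contra h0
      refine h _ h0 (Submodule.mem_span_pair.2 ⟨s, t, rfl⟩)
        (Submodule.mem_span_pair.2 ⟨-r, -w, ?_⟩)
      linear_combination (norm := module) -e
    have h2 : r • T x + w • T y = 0 := by linear_combination (norm := module) e - h1
    have h3 := hli' _ _ h1
    have h4 := LinearIndependent.pair_iff.1 hliT _ _ h2
    tauto
  obtain ⟨z, hzW, uz, hz⟩ := exists_complement_in_pair halt hxy hu1 hu0
  obtain ⟨z', -, uz', hz'⟩ := exists_complement_in_pair halt (by rw [← hT.2, hxy, map_zero]) hu2 hu0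
  have hdeg : IsDegenerate m u := by
    refine ⟨z, z', uz, uz', linearIndependent_three_iff.2 fun s t r e => ?_⟩
    have hzu : z ∉ Submodule.span K {u} := fun h => by
      have h1 : Submodule.span K {x, y} ≤ Submodule.span K {u} :=
        hz.trans (Submodule.span_le.2 (by
          rintro w (rfl | rfl)
          · exact Submodule.mem_span_singleton_self _
          · exact h))
      obtain ⟨α, hα⟩ := Submodule.mem_span_singleton.1
        (h1 (Submodule.subset_span (by simp) : x ∈ _))
      obtain ⟨β, hβ⟩ := Submodule.mem_span_singleton.1
        (h1 (Submodule.subset_span (by simp) : y ∈ _))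
      have := hli' β (-α) (by rw [← hα, ← hβ]; module)
      have hα0 : α = 0 := by simpa using this.2
      exact hx0 (by rw [← hα, hα0, zero_smul])
    have hz'u : z' ∉ Submodule.span K {u, z} := fun h => by
      refine hTW (hz'.trans (Submodule.span_le.2 ?_))
      have hle : Submodule.span K {u, z} ≤ Submodule.span K {x, y} := by
        rw [Submodule.span_le]
        rintro w (rfl | rfl)
        · exact hu1
        · exact hzW
      rintro w (rfl | rfl)
      · exact hu1
      · exact hle h
    have hr : r = 0 := by
      by_contra hr
      refine hz'u (Submodule.mem_span_pair.2 ⟨-(r⁻¹ * s), -(r⁻¹ * t), ?_⟩)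
      rw [← inv_smul_smul₀ hr z']
      linear_combination (norm := module) -(r⁻¹ • e)
    subst hr
    have ht : t = 0 := by
      by_contra ht
      refine hzu (Submodule.mem_span_singleton.2 ⟨-(t⁻¹ * s), ?_⟩)
      rw [← inv_smul_smul₀ ht z]
      linear_combination (norm := module) -(t⁻¹ • e)
    subst ht
    exact ⟨by simpa [hu0] using e, rfl, rfl⟩
  have htop := hirr.span_eq_top (P := IsDegenerate m) (fun T hT u hu => hu.map hT) hdeg hu0
  refine finrank_span_singleton_ne_top hU u (top_le_iff.1 ?_)
  rw [← htop, Submodule.span_le]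
  exact fun v hv => hdeg.mem_span hU halt hspan hv

/-- Two complementary abelian planes, each given by a basis. -/
structure TwoPlanes (m : U →ₗ[K] U →ₗ[K] U) (x₁ x₂ y₁ y₂ : U) : Prop where
  li : LinearIndependent K ![x₁, x₂, y₁, y₂]
  hx : m x₁ x₂ = 0
  hy : m y₁ y₂ = 0

theorem TwoPlanes.symm {m : U →ₗ[K] U →ₗ[K] U} {x₁ x₂ y₁ y₂ : U}
    (h : TwoPlanes m x₁ x₂ y₁ y₂) : TwoPlanes m y₁ y₂ x₁ x₂ := by
  refine ⟨linearIndependent_four_iff.2 fun s t r w e => ?_, h.hy, h.hx⟩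
  have := linearIndependent_four_iff.1 h.li r w s t (by rw [← e]; abel)
  tauto

theorem span_pair_eq_of_mem {x₁ x₂ u₁ u₂ : U} (h : LinearIndependent K ![u₁, u₂])
    (h₁ : u₁ ∈ Submodule.span K {x₁, x₂}) (h₂ : u₂ ∈ Submodule.span K {x₁, x₂}) :
    Submodule.span K {u₁, u₂} = Submodule.span K {x₁, x₂} := by
  have := FiniteDimensional.span_of_finite K (Set.toFinite {x₁, x₂})
  refine Submodule.eq_of_le_of_finrank_le (Submodule.span_le.2 ?_) ?_
  · rintro z (rfl | rfl) <;> assumption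
  · have e1 := finrank_span_eq_card h
    have e2 := finrank_range_le_card (R := K) ![x₁, x₂]
    rw [Matrix.range_cons_cons_empty] at e1
    rw [Set.finrank, Matrix.range_cons_cons_empty] at e2
    rw [e1]
    simpa using e2

theorem linearIndependent_pair_of_span_le {x y u z : U} (h : LinearIndependent K ![x, y])
    (hle : Submodule.span K {x, y} ≤ Submodule.span K {u, z}) : LinearIndependent K ![u, z] := by
  have := FiniteDimensional.span_of_finite K (Set.toFinite {u, z})
  have e := finrank_span_eq_card h
  rw [Matrix.range_cons_cons_empty] at e
  rw [linearIndependent_iff_card_le_finrank_span, Set.finrank, Matrix.range_cons_cons_empty, ← e]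
  exact Submodule.finrank_mono hle

theorem mul_eq_zero_of_mem_pair {m : U →ₗ[K] U →ₗ[K] U} (halt : ∀ x, m x x = 0) {x₁ x₂ u w : U}
    (hx : m x₁ x₂ = 0) (hu : u ∈ Submodule.span K {x₁, x₂}) (hw : w ∈ Submodule.span K {x₁, x₂}) :
    m u w = 0 := by
  obtain ⟨a, b, rfl⟩ := Submodule.mem_span_pair.1 hu
  obtain ⟨c, d, rfl⟩ := Submodule.mem_span_pair.1 hw
  simp [halt, hx, map_swap_of_alternating halt x₂ x₁]

theorem TwoPlanes.disjoint {m : U →ₗ[K] U →ₗ[K] U} {x₁ x₂ y₁ y₂ u : U}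
    (h : TwoPlanes m x₁ x₂ y₁ y₂) (h₁ : u ∈ Submodule.span K {x₁, x₂})
    (h₂ : u ∈ Submodule.span K {y₁, y₂}) : u = 0 := by
  obtain ⟨a, b, rfl⟩ := Submodule.mem_span_pair.1 h₁
  obtain ⟨c, d, e⟩ := Submodule.mem_span_pair.1 h₂
  obtain ⟨ha, hb, -⟩ := linearIndependent_four_iff.1 h.li a b (-c) (-d)
    (by linear_combination (norm := module) -e)
  simp [ha, hb]

theorem TwoPlanes.change {m : U →ₗ[K] U →ₗ[K] U} (halt : ∀ x, m x x = 0) {x₁ x₂ y₁ y₂ : U}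
    (h : TwoPlanes m x₁ x₂ y₁ y₂) {u₁ u₂ v₁ v₂ : U} (hu : LinearIndependent K ![u₁, u₂])
    (hv : LinearIndependent K ![v₁, v₂]) (hu₁ : u₁ ∈ Submodule.span K {x₁, x₂})
    (hu₂ : u₂ ∈ Submodule.span K {x₁, x₂}) (hv₁ : v₁ ∈ Submodule.span K {y₁, y₂})
    (hv₂ : v₂ ∈ Submodule.span K {y₁, y₂}) : TwoPlanes m u₁ u₂ v₁ v₂ := by
  refine ⟨linearIndependent_four_iff.2 fun s t r w e => ?_,
    mul_eq_zero_of_mem_pair halt h.hx hu₁ hu₂, mul_eq_zero_of_mem_pair halt h.hy hv₁ hv₂⟩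
  have h0 : s • u₁ + t • u₂ = 0 := by
    refine h.disjoint (add_mem (Submodule.smul_mem _ _ hu₁) (Submodule.smul_mem _ _ hu₂)) ?_
    have : s • u₁ + t • u₂ = (-r) • v₁ + (-w) • v₂ := by
      linear_combination (norm := module) e
    rw [this]
    exact add_mem (Submodule.smul_mem _ _ hv₁) (Submodule.smul_mem _ _ hv₂)
  have h1 := LinearIndependent.pair_iff.1 hu _ _ h0
  have h2 := LinearIndependent.pair_iff.1 hv r w (by linear_combination (norm := module) e - h0)
  tauto

theorem TwoPlanes.linearIndependent_left {m : U →ₗ[K] U →ₗ[K] U} {x₁ x₂ y₁ y₂ : U}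
    (h : TwoPlanes m x₁ x₂ y₁ y₂) : LinearIndependent K ![x₁, x₂] := by
  rw [LinearIndependent.pair_iff]
  intro s t e
  have := linearIndependent_four_iff.1 h.li s t 0 0 (by simpa using e)
  tauto

theorem TwoPlanes.products {m : U →ₗ[K] U →ₗ[K] U} (hU : finrank K U = 4)
    (halt : ∀ x, m x x = 0) (hspan : SpannedByProducts m) {x₁ x₂ y₁ y₂ : U}
    (h : TwoPlanes m x₁ x₂ y₁ y₂) {q : Fin 4 → U}
    (h₁₁ : m x₁ y₁ ∈ Submodule.span K (Set.range q))
    (h₁₂ : m x₁ y₂ ∈ Submodule.span K (Set.range q))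
    (h₂₁ : m x₂ y₁ ∈ Submodule.span K (Set.range q))
    (h₂₂ : m x₂ y₂ ∈ Submodule.span K (Set.range q)) : LinearIndependent K q :=
  hspan.linearIndependent hU halt h.li (by rw [h.hx]; exact zero_mem _) h₁₁ h₁₂ h₂₁ h₂₂
    (by rw [h.hy]; exact zero_mem _)

theorem TwoPlanes.products' {m : U →ₗ[K] U →ₗ[K] U} (hU : finrank K U = 4)
    (halt : ∀ x, m x x = 0) (hspan : SpannedByProducts m) {x₁ x₂ y₁ y₂ : U}
    (h : TwoPlanes m x₁ x₂ y₁ y₂) :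
    LinearIndependent K ![m x₁ y₁, m x₁ y₂, m x₂ y₁, m x₂ y₂] :=
  h.products hU halt hspan (Submodule.subset_span ⟨0, rfl⟩) (Submodule.subset_span ⟨1, rfl⟩)
    (Submodule.subset_span ⟨2, rfl⟩) (Submodule.subset_span ⟨3, rfl⟩)

/-- Every abelian plane is one of the two given ones. -/
theorem TwoPlanes.mem_of_mul_eq_zero {m : U →ₗ[K] U →ₗ[K] U} (hU : finrank K U = 4)
    (halt : ∀ x, m x x = 0) (hspan : SpannedByProducts m) {x₁ x₂ y₁ y₂ : U}
    (h : TwoPlanes m x₁ x₂ y₁ y₂) {u w : U} (huw : LinearIndependent K ![u, w])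
    (h0 : m u w = 0) :
    (u ∈ Submodule.span K {x₁, x₂} ∧ w ∈ Submodule.span K {x₁, x₂}) ∨
      (u ∈ Submodule.span K {y₁, y₂} ∧ w ∈ Submodule.span K {y₁, y₂}) := by
  obtain ⟨a, b, c, d, rfl⟩ := exists_eq_of_linearIndependent_four hU h.li u
  obtain ⟨a', b', c', d', rfl⟩ := exists_eq_of_linearIndependent_four hU h.li w
  have sw := map_swap_of_alternating halt
  simp only [map_add, map_smul, LinearMap.add_apply, LinearMap.smul_apply, halt, sw x₂ x₁,
    sw y₁ x₁, sw y₂ x₁, sw y₁ x₂, sw y₂ x₂, sw y₂ y₁, h.hx, h.hy] at h0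
  obtain ⟨p13, p14, p23, p24⟩ := linearIndependent_four_iff.1 (h.products' hU halt hspan)
    (a * c' - c * a') (a * d' - d * a') (b * c' - c * b') (b * d' - d * b')
    (by linear_combination (norm := module) h0)
  by_cases p12 : a * b' - b * a' = 0
  · by_cases p34 : c * d' - d * c' = 0
    · exfalso
      rw [LinearIndependent.pair_iff] at huw
      have z : ∀ s t : K, s • (a • x₁ + b • x₂ + c • y₁ + d • y₂) +
          t • (a' • x₁ + b' • x₂ + c' • y₁ + d' • y₂) = 0 → s = 0 := fun s t e => (huw s t e).1
      have ha : a' = 0 := z a' (-a) (by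
        linear_combination (norm := module) (-p12) • x₂ - p13 • y₁ - p14 • y₂)
      have hb : b' = 0 := z b' (-b) (by
        linear_combination (norm := module) p12 • x₁ - p23 • y₁ - p24 • y₂)
      have hc : c' = 0 := z c' (-c) (by
        linear_combination (norm := module) p13 • x₁ + p23 • x₂ - p34 • y₂)
      have hd : d' = 0 := z d' (-d) (by
        linear_combination (norm := module) p14 • x₁ + p24 • x₂ + p34 • y₁)
      simpa using huw 0 1 (by simp [ha, hb, hc, hd])
    · right
      have ha : a = 0 := (mul_eq_zero.1 (by linear_combination c * p14 - d * p13 :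
        a * (c * d' - d * c') = 0)).resolve_right p34
      have ha' : a' = 0 := (mul_eq_zero.1 (by linear_combination c' * p14 - d' * p13 :
        a' * (c * d' - d * c') = 0)).resolve_right p34
      have hb : b = 0 := (mul_eq_zero.1 (by linear_combination c * p24 - d * p23 :
        b * (c * d' - d * c') = 0)).resolve_right p34
      have hb' : b' = 0 := (mul_eq_zero.1 (by linear_combination c' * p24 - d' * p23 :
        b' * (c * d' - d * c') = 0)).resolve_right p34
      exact ⟨Submodule.mem_span_pair.2 ⟨c, d, by simp [ha, hb]⟩,
        Submodule.mem_span_pair.2 ⟨c', d', by simp [ha', hb']⟩⟩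
  · left
    have hc : c = 0 := (mul_eq_zero.1 (by linear_combination b * p13 - a * p23 :
      c * (a * b' - b * a') = 0)).resolve_right p12
    have hc' : c' = 0 := (mul_eq_zero.1 (by linear_combination b' * p13 - a' * p23 :
      c' * (a * b' - b * a') = 0)).resolve_right p12
    have hd : d = 0 := (mul_eq_zero.1 (by linear_combination b * p14 - a * p24 :
      d * (a * b' - b * a') = 0)).resolve_right p12
    have hd' : d' = 0 := (mul_eq_zero.1 (by linear_combination b' * p14 - a' * p24 :
      d' * (a * b' - b * a') = 0)).resolve_right p12
    exact ⟨Submodule.mem_span_pair.2 ⟨a, b, by simp [hc, hd]⟩,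
      Submodule.mem_span_pair.2 ⟨a', b', by simp [hc', hd']⟩⟩

/-- `u` lies in an abelian plane, into which it multiplies some vector from outside. -/
def IsSpecial (m : U →ₗ[K] U →ₗ[K] U) (u : U) : Prop :=
  ∃ y z, m u y = 0 ∧ LinearIndependent K ![u, y, z] ∧ m u z ∈ Submodule.span K {u, y}

theorem IsSpecial.map {m : U →ₗ[K] U →ₗ[K] U} {T : U ≃+ U} (hT : IsSemiAut m T) {v : U}
    (h : IsSpecial m v) : IsSpecial m (T v) := by
  obtain ⟨y, z, h1, h2, h3⟩ := h
  refine ⟨T y, T z, by rw [← hT.2, h1, map_zero], ?_, ?_⟩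
  · convert hT.linearIndependent h2 using 1
    funext i; fin_cases i <;> rfl
  · rw [← hT.2]
    refine hT.map_span_subset (fun s hs => Submodule.subset_span ?_) h3
    rcases hs with rfl | rfl <;> simp

theorem IsSpecial.ne_zero {m : U →ₗ[K] U →ₗ[K] U} {v : U} (h : IsSpecial m v) : v ≠ 0 := by
  obtain ⟨y, z, -, h2, -⟩ := h
  exact h2.ne_zero 0

theorem linearIndependent_pair_of_three {u y z : U} (h : LinearIndependent K ![u, y, z]) :
    LinearIndependent K ![u, y] := by
  rw [LinearIndependent.pair_iff]
  intro s t e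
  have := linearIndependent_three_iff.1 h s t 0 (by simpa using e)
  tauto

theorem TwoPlanes.isSpecial {m : U →ₗ[K] U →ₗ[K] U} (halt : ∀ x, m x x = 0) {x₁ x₂ y₁ y₂ : U}
    (h : TwoPlanes m x₁ x₂ y₁ y₂) {u v : U} (hu : u ∈ Submodule.span K {x₁, x₂}) (hu0 : u ≠ 0)
    (hv : v ∈ Submodule.span K {y₁, y₂}) (hv0 : v ≠ 0) (huv : m u v ∈ Submodule.span K {x₁, x₂}) :
    IsSpecial m u := by
  obtain ⟨z, hz, uz, hle⟩ := exists_complement_in_pair halt h.hx hu hu0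
  refine ⟨z, v, uz, linearIndependent_three_iff.2 fun s t r e => ?_, hle huv⟩
  have h0 : r • v = 0 := by
    refine h.disjoint ?_ (Submodule.smul_mem _ _ hv)
    have : r • v = (-s) • u + (-t) • z := by linear_combination (norm := module) e
    rw [this]
    exact add_mem (Submodule.smul_mem _ _ hu) (Submodule.smul_mem _ _ hz)
  have hr : r = 0 := by simpa [hv0] using h0
  subst hr
  have hli := linearIndependent_pair_of_span_le h.linearIndependent_left hle
  have := LinearIndependent.pair_iff.1 hli s t (by simpa using e)
  tauto

theorem TwoPlanes.of_isSpecial {m : U →ₗ[K] U →ₗ[K] U} (hU : finrank K U = 4)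
    (halt : ∀ x, m x x = 0) (hspan : SpannedByProducts m) {x₁ x₂ y₁ y₂ : U}
    (h : TwoPlanes m x₁ x₂ y₁ y₂) {u : U} (hu : IsSpecial m u) :
    (u ∈ Submodule.span K {x₁, x₂} ∧
      ∃ v ∈ Submodule.span K {y₁, y₂}, v ≠ 0 ∧ m u v ∈ Submodule.span K {x₁, x₂}) ∨
    (u ∈ Submodule.span K {y₁, y₂} ∧
      ∃ v ∈ Submodule.span K {x₁, x₂}, v ≠ 0 ∧ m u v ∈ Submodule.span K {y₁, y₂}) := by
  have main : ∀ {x₁ x₂ y₁ y₂ u y z : U}, TwoPlanes m x₁ x₂ y₁ y₂ → LinearIndependent K ![u, y, z] →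
      m u z ∈ Submodule.span K {u, y} → u ∈ Submodule.span K {x₁, x₂} →
      y ∈ Submodule.span K {x₁, x₂} → ∃ v ∈ Submodule.span K {y₁, y₂}, v ≠ 0 ∧
        m u v ∈ Submodule.span K {x₁, x₂} := by
    intro x₁ x₂ y₁ y₂ u y z h hli huz hu hy
    have hpl := span_pair_eq_of_mem (linearIndependent_pair_of_three hli) hu hy
    obtain ⟨a, b, c, d, e⟩ := exists_eq_of_linearIndependent_four hU h.li z
    have hab : a • x₁ + b • x₂ ∈ Submodule.span K {x₁, x₂} := Submodule.mem_span_pair.2 ⟨a, b, rfl⟩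
    refine ⟨c • y₁ + d • y₂, Submodule.mem_span_pair.2 ⟨c, d, rfl⟩, fun h0 => ?_, ?_⟩
    · have hz : z ∈ Submodule.span K {u, y} := by
        rw [hpl, e, add_assoc, h0, add_zero]
        exact hab
      obtain ⟨s, t, hst⟩ := Submodule.mem_span_pair.1 hz
      simpa using (linearIndependent_three_iff.1 hli s t (-1) (by rw [hst]; module)).2.2
    · have : m u (c • y₁ + d • y₂) = m u z := by
        rw [e, add_assoc, map_add (m u) (a • x₁ + b • x₂),
          mul_eq_zero_of_mem_pair halt h.hx hu hab, zero_add]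
      rw [this, ← hpl]
      exact huz
  obtain ⟨y, z, uy, hli, huz⟩ := hu
  rcases h.mem_of_mul_eq_zero hU halt hspan (linearIndependent_pair_of_three hli) uy with
    ⟨h1, h2⟩ | ⟨h1, h2⟩
  · exact Or.inl ⟨h1, main h hli huz h1 h2⟩
  · exact Or.inr ⟨h1, main h.symm hli huz h1 h2⟩

theorem trace_eq_of_linearIndependent_four (hU : finrank K U = 4) {a b c d : U}
    (h : LinearIndependent K ![a, b, c, d]) (f : U →ₗ[K] U)
    {a₁ a₂ a₃ a₄ b₁ b₂ b₃ b₄ c₁ c₂ c₃ c₄ d₁ d₂ d₃ d₄ : K}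
    (ha : f a = a₁ • a + a₂ • b + a₃ • c + a₄ • d) (hb : f b = b₁ • a + b₂ • b + b₃ • c + b₄ • d)
    (hc : f c = c₁ • a + c₂ • b + c₃ • c + c₄ • d) (hd : f d = d₁ • a + d₂ • b + d₃ • c + d₄ • d) :
    LinearMap.trace K U f = a₁ + b₂ + c₃ + d₄ := by
  have hB := coe_basisOfLinearIndependentOfCardEqFinrank h (by simp [hU])
  generalize basisOfLinearIndependentOfCardEqFinrank h (by simp [hU]) = B at hB
  have e : ∀ (x : Fin 4 → K) i, B.repr (x 0 • a + x 1 • b + x 2 • c + x 3 • d) i = x i := by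
    intro x i
    have : x 0 • a + x 1 • b + x 2 • c + x 3 • d = ∑ j, x j • B j := by
      rw [Fin.sum_univ_four, hB]; rfl
    rw [this, B.repr_sum_self]
  rw [LinearMap.trace_eq_matrix_trace K B, Matrix.trace, Fin.sum_univ_four]
  simp only [Matrix.diag_apply, LinearMap.toMatrix_apply, hB]
  have ea := e ![a₁, a₂, a₃, a₄] 0
  have eb := e ![b₁, b₂, b₃, b₄] 1
  have ec := e ![c₁, c₂, c₃, c₄] 2
  have ed := e ![d₁, d₂, d₃, d₄] 3
  simp at ea eb ec ed
  simp [ha, hb, hc, hd, ea, eb, ec, ed]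

theorem exists_quadratic_form_eq_zero [IsAlgClosed K] (a b c : K) :
    ∃ s t : K, ¬ (s = 0 ∧ t = 0) ∧ a * s ^ 2 + b * s * t + c * t ^ 2 = 0 := by
  by_cases hc : c = 0
  · exact ⟨0, 1, by simp, by simp [hc]⟩
  · obtain ⟨t, ht⟩ := IsAlgClosed.exists_root
      (Polynomial.C c * Polynomial.X ^ 2 + Polynomial.C b * Polynomial.X + Polynomial.C a)
      (by rw [Polynomial.degree_quadratic hc]; simp)
    refine ⟨1, t, by simp, ?_⟩
    simp only [Polynomial.IsRoot.def, Polynomial.eval_add, Polynomial.eval_mul, Polynomial.eval_C,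
      Polynomial.eval_pow, Polynomial.eval_X] at ht
    linear_combination ht

theorem exists_ker_of_det_eq_zero {a b c d : K} (h : a * d - b * c = 0) :
    ∃ s t : K, ¬ (s = 0 ∧ t = 0) ∧ a * s + b * t = 0 ∧ c * s + d * t = 0 := by
  obtain ⟨v, hv, hv0⟩ := Matrix.exists_mulVec_eq_zero_iff.2
    (show Matrix.det !![a, b; c, d] = 0 by rw [Matrix.det_fin_two_of]; exact h)
  refine ⟨v 0, v 1, fun h => hv ?_, ?_, ?_⟩
  · funext i; fin_cases i <;> simp [h]
  · simpa [Matrix.mulVec, dotProduct, Fin.sum_univ_two] using congrFun hv0 0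
  · simpa [Matrix.mulVec, dotProduct, Fin.sum_univ_two] using congrFun hv0 1

theorem TwoPlanes.exists_special [IsAlgClosed K] {m : U →ₗ[K] U →ₗ[K] U} (hU : finrank K U = 4)
    {x₁ x₂ y₁ y₂ : U} (h : TwoPlanes m x₁ x₂ y₁ y₂) :
    ∃ u ∈ Submodule.span K {x₁, x₂}, u ≠ 0 ∧ ∃ v ∈ Submodule.span K {y₁, y₂}, v ≠ 0 ∧
      m u v ∈ Submodule.span K {x₁, x₂} := by
  obtain ⟨a₁, a₂, a₃, a₄, ha⟩ := exists_eq_of_linearIndependent_four hU h.li (m x₁ y₁)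
  obtain ⟨b₁, b₂, b₃, b₄, hb⟩ := exists_eq_of_linearIndependent_four hU h.li (m x₁ y₂)
  obtain ⟨c₁, c₂, c₃, c₄, hc⟩ := exists_eq_of_linearIndependent_four hU h.li (m x₂ y₁)
  obtain ⟨d₁, d₂, d₃, d₄, hd⟩ := exists_eq_of_linearIndependent_four hU h.li (m x₂ y₂)
  obtain ⟨s, t, hst, h0⟩ := exists_quadratic_form_eq_zero (a₃ * b₄ - b₃ * a₄)
    (a₃ * d₄ + c₃ * b₄ - b₃ * c₄ - d₃ * a₄) (c₃ * d₄ - d₃ * c₄)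
  obtain ⟨q, r, hqr, e₁, e₂⟩ := exists_ker_of_det_eq_zero
    (a := s * a₃ + t * c₃) (b := s * b₃ + t * d₃) (c := s * a₄ + t * c₄) (d := s * b₄ + t * d₄)
    (by linear_combination h0)
  refine ⟨s • x₁ + t • x₂, Submodule.mem_span_pair.2 ⟨s, t, rfl⟩, fun e => hst ?_,
    q • y₁ + r • y₂, Submodule.mem_span_pair.2 ⟨q, r, rfl⟩, fun e => hqr ?_, ?_⟩
  · exact LinearIndependent.pair_iff.1 h.linearIndependent_left s t e
  · exact LinearIndependent.pair_iff.1 h.symm.linearIndependent_left q r e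
  · refine Submodule.mem_span_pair.2 ⟨s * q * a₁ + s * r * b₁ + t * q * c₁ + t * r * d₁,
      s * q * a₂ + s * r * b₂ + t * q * c₂ + t * r * d₂, ?_⟩
    simp only [map_add, map_smul, LinearMap.add_apply, LinearMap.smul_apply, ha, hb, hc, hd]
    linear_combination (norm := module) (-e₁) • y₁ - e₂ • y₂

theorem linearIndependent_pair_of_notMem {u v : U} (hu : u ≠ 0)
    (hv : v ∉ Submodule.span K {u}) : LinearIndependent K ![u, v] := by
  rw [LinearIndependent.pair_iff' hu]
  exact fun a e => hv (Submodule.mem_span_singleton.2 ⟨a, e⟩)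

theorem IsSemiAut.mem_span_pair {m : U →ₗ[K] U →ₗ[K] U} {T : U ≃+ U} (hT : IsSemiAut m T)
    {x y w : U} (hw : w ∈ Submodule.span K {x, y}) : T w ∈ Submodule.span K {T x, T y} :=
  hT.map_span_subset (by rintro s (rfl | rfl) <;> exact Submodule.subset_span (by simp)) hw

theorem IsSemiAut.mem_span_singleton {m : U →ₗ[K] U →ₗ[K] U} {T : U ≃+ U} (hT : IsSemiAut m T)
    {x w : U} (hw : w ∈ Submodule.span K {x}) : T w ∈ Submodule.span K {T x} :=
  hT.map_span_subset (by rintro s rfl; exact Submodule.subset_span rfl) hw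

theorem SemiIrreducible.exists_special_pair [IsAlgClosed K] {m : U →ₗ[K] U →ₗ[K] U}
    (hU : finrank K U = 4) (halt : ∀ x, m x x = 0) (hirr : SemiIrreducible m) (hm : m ≠ 0) :
    ∃ T, IsSemiAut m T ∧ ∃ x₁ x₂, TwoPlanes m x₁ x₂ (T x₁) (T x₂) ∧
      ∃ u₁ ∈ Submodule.span K {x₁, x₂}, ∃ u₂ ∈ Submodule.span K {x₁, x₂},
        LinearIndependent K ![u₁, u₂] ∧ IsSpecial m u₁ ∧ IsSpecial m u₂ := by
  have hspan := hirr.spannedByProducts hm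
  obtain ⟨T, hT, x₁, x₂, hx, hli⟩ := hirr.exists_two_planes hU halt hm
  have h : TwoPlanes m x₁ x₂ (T x₁) (T x₂) := ⟨hli, hx, by rw [← hT.2, hx, map_zero]⟩
  obtain ⟨u, hu, hu0, v, hv, hv0, huv⟩ := h.exists_special hU
  have hus := h.isSpecial halt hu hu0 hv hv0 huv
  refine ⟨T, hT, x₁, x₂, h, u, hu, ?_⟩
  by_contra! H
  have key : ∀ w ∈ Submodule.span K {x₁, x₂}, IsSpecial m w → w ∈ Submodule.span K {u} :=
    fun w hw hws => by_contra fun hn => H w hw (linearIndependent_pair_of_notMem hu0 hn) hus hws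
  refine span_pair_ne_top hU u (T u) (top_unique ?_)
  rw [← hirr.span_eq_top (P := IsSpecial m) (fun T hT u hu => hu.map hT) hus hu0]
  refine Submodule.span_le.2 fun w hw => ?_
  rcases h.of_isSpecial hU halt hspan hw with ⟨h1, -⟩ | ⟨h1, -⟩
  · exact Submodule.span_mono (by simp) (key w h1 hw)
  · have h2 := key _ (by simpa using hT.symm.mem_span_pair h1) (IsSpecial.map hT.symm hw)
    have h3 := hT.mem_span_singleton h2
    rw [T.apply_symm_apply] at h3
    exact Submodule.span_mono (by simp) h3

/-- Two complementary abelian planes with bases adapted to the special vectors. -/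
structure IsFrame (m : U →ₗ[K] U →ₗ[K] U) (u₁ u₂ v₁ v₂ : U) : Prop extends
    TwoPlanes m u₁ u₂ v₁ v₂ where
  h₁₁ : m u₁ v₁ ∈ Submodule.span K {u₁, u₂}
  h₂₂ : m u₂ v₂ ∈ Submodule.span K {u₁, u₂}

theorem IsFrame.coeffs {m : U →ₗ[K] U →ₗ[K] U} (hU : finrank K U = 4) (halt : ∀ x, m x x = 0)
    (hspan : SpannedByProducts m) (htr : ∀ x, LinearMap.trace K U (m x) = 0) {u₁ u₂ v₁ v₂ : U}
    (h : IsFrame m u₁ u₂ v₁ v₂) :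
    ∃ p₁ p₂ q₁ q₂ r₁ r₂ s₁ s₂ α β : K, p₁ * q₂ - p₂ * q₁ ≠ 0 ∧ α ≠ 0 ∧ β ≠ 0 ∧
      m u₁ v₁ = p₁ • u₁ + p₂ • u₂ ∧ m u₂ v₂ = q₁ • u₁ + q₂ • u₂ ∧
      m u₁ v₂ = r₁ • u₁ + r₂ • u₂ + α • v₁ ∧ m u₂ v₁ = s₁ • u₁ + s₂ • u₂ + β • v₂ := by
  obtain ⟨p₁, p₂, hp⟩ := Submodule.mem_span_pair.1 h.h₁₁
  obtain ⟨q₁, q₂, hq⟩ := Submodule.mem_span_pair.1 h.h₂₂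
  obtain ⟨r₁, r₂, α, r₄, hr⟩ := exists_eq_of_linearIndependent_four hU h.li (m u₁ v₂)
  obtain ⟨s₁, s₂, s₃, β, hs⟩ := exists_eq_of_linearIndependent_four hU h.li (m u₂ v₁)
  have hr₄ : r₄ = 0 := by
    have := trace_eq_of_linearIndependent_four hU h.li (m u₁)
      (a₁ := 0) (a₂ := 0) (a₃ := 0) (a₄ := 0) (b₁ := 0) (b₂ := 0) (b₃ := 0) (b₄ := 0)
      (c₁ := p₁) (c₂ := p₂) (c₃ := 0) (c₄ := 0)
      (by simp [halt]) (by simp [h.hx]) (by simp [← hp]) hr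
    simpa [htr] using this.symm
  have hs₃ : s₃ = 0 := by
    have := trace_eq_of_linearIndependent_four hU h.li (m u₂)
      (a₁ := 0) (a₂ := 0) (a₃ := 0) (a₄ := 0) (b₁ := 0) (b₂ := 0) (b₃ := 0) (b₄ := 0)
      (d₁ := q₁) (d₂ := q₂) (d₃ := 0) (d₄ := 0)
      (by simp [map_swap_of_alternating halt u₂ u₁, h.hx]) (by simp [halt]) hs (by simp [← hq])
    simpa [htr] using this.symm
  subst hr₄ hs₃
  have hli := linearIndependent_four_iff.1 (h.products' hU halt hspan)
  have hpq : p₁ * q₂ - p₂ * q₁ ≠ 0 := by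
    intro e
    obtain ⟨s, t, hst, e₁, e₂⟩ := exists_ker_of_det_eq_zero
      (a := p₁) (b := q₁) (c := p₂) (d := q₂) (by linear_combination e)
    have := hli s 0 0 t (by
      rw [← hp, ← hq]; linear_combination (norm := module) e₁ • u₁ + e₂ • u₂)
    tauto
  have aux : ∀ a b c d x y : K, a * d - b * c ≠ 0 → ∃ s t : K,
      s * a + t * c = x ∧ s * b + t * d = y := fun a b c d x y hne =>
    ⟨(x * d - y * c) * (a * d - b * c)⁻¹, (y * a - x * b) * (a * d - b * c)⁻¹,
      by linear_combination x * inv_mul_cancel₀ hne, by linear_combination y * inv_mul_cancel₀ hne⟩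
  refine ⟨p₁, p₂, q₁, q₂, r₁, r₂, s₁, s₂, α, β, hpq, ?_, ?_, hp.symm, hq.symm, by simp [hr],
    by simp [hs]⟩
  · rintro rfl
    obtain ⟨s, t, e₁, e₂⟩ := aux p₁ p₂ q₁ q₂ r₁ r₂ hpq
    simpa using hli s (-1) 0 t (by
      rw [← hp, ← hq, hr]; linear_combination (norm := module) e₁ • u₁ + e₂ • u₂)
  · rintro rfl
    obtain ⟨s, t, e₁, e₂⟩ := aux p₁ p₂ q₁ q₂ s₁ s₂ hpq
    simpa using hli s 0 (-1) t (by
      rw [← hp, ← hq, hs]; linear_combination (norm := module) e₁ • u₁ + e₂ • u₂)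

/-- An element of the first plane is special only if it is a multiple of a frame vector. -/
theorem IsFrame.special {m : U →ₗ[K] U →ₗ[K] U} (hU : finrank K U = 4) (halt : ∀ x, m x x = 0)
    (hspan : SpannedByProducts m) (htr : ∀ x, LinearMap.trace K U (m x) = 0) {u₁ u₂ v₁ v₂ : U}
    (h : IsFrame m u₁ u₂ v₁ v₂) {u v : U} (hu : u ∈ Submodule.span K {u₁, u₂}) (hu0 : u ≠ 0)
    (hv : v ∈ Submodule.span K {v₁, v₂}) (hv0 : v ≠ 0) (huv : m u v ∈ Submodule.span K {u₁, u₂}) :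
    (u ∈ Submodule.span K {u₁} ∧ v ∈ Submodule.span K {v₁}) ∨
      (u ∈ Submodule.span K {u₂} ∧ v ∈ Submodule.span K {v₂}) := by
  obtain ⟨p₁, p₂, q₁, q₂, r₁, r₂, s₁, s₂, α, β, -, hα, hβ, hp, hq, hr, hs⟩ :=
    h.coeffs hU halt hspan htr
  obtain ⟨a, b, rfl⟩ := Submodule.mem_span_pair.1 hu
  obtain ⟨c, d, rfl⟩ := Submodule.mem_span_pair.1 hv
  obtain ⟨e, f, hef⟩ := Submodule.mem_span_pair.1 huv
  simp only [map_add, map_smul, LinearMap.add_apply, LinearMap.smul_apply, hp, hq, hr, hs] at hef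
  obtain ⟨-, -, h3, h4⟩ := linearIndependent_four_iff.1 h.li
    (a * c * p₁ + b * d * q₁ + a * d * r₁ + b * c * s₁ - e)
    (a * c * p₂ + b * d * q₂ + a * d * r₂ + b * c * s₂ - f) (a * d * α) (b * c * β)
    (by linear_combination (norm := module) -hef)
  have had : a = 0 ∨ d = 0 := by simpa [hα] using h3
  have hbc : b = 0 ∨ c = 0 := by simpa [hβ] using h4
  rcases had with rfl | rfl
  · rcases hbc with rfl | rfl
    · simp at hu0
    · exact Or.inr ⟨Submodule.mem_span_singleton.2 ⟨b, by simp⟩,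
        Submodule.mem_span_singleton.2 ⟨d, by simp⟩⟩
  · rcases hbc with rfl | rfl
    · exact Or.inl ⟨Submodule.mem_span_singleton.2 ⟨a, by simp⟩,
        Submodule.mem_span_singleton.2 ⟨c, by simp⟩⟩
    · simp at hv0

theorem SemiIrreducible.exists_frame [IsAlgClosed K] {m : U →ₗ[K] U →ₗ[K] U}
    (hU : finrank K U = 4) (halt : ∀ x, m x x = 0) (hirr : SemiIrreducible m) (hm : m ≠ 0)
    (htr : ∀ x, LinearMap.trace K U (m x) = 0) :
    ∃ T, IsSemiAut m T ∧ ∃ u₁ u₂ v₁ v₂, IsFrame m u₁ u₂ v₁ v₂ ∧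
      Submodule.span K {T u₁, T u₂} = Submodule.span K {v₁, v₂} := by
  have hspan := hirr.spannedByProducts hm
  obtain ⟨T, hT, x₁, x₂, h, u₁, hu₁, u₂, hu₂, hli, hs₁, hs₂⟩ := hirr.exists_special_pair hU halt hm
  have hTli : LinearIndependent K ![T u₁, T u₂] := by
    convert hT.linearIndependent hli using 1
    funext i; fin_cases i <;> rfl
  have hf := h.change halt hli hTli hu₁ hu₂ (hT.mem_span_pair hu₁) (hT.mem_span_pair hu₂)
  have get : ∀ u ∈ Submodule.span K {u₁, u₂}, IsSpecial m u →
      ∃ v ∈ Submodule.span K {T u₁, T u₂}, v ≠ 0 ∧ m u v ∈ Submodule.span K {u₁, u₂} := by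
    intro u hu hus
    rcases hf.of_isSpecial hU halt hspan hus with ⟨-, h2⟩ | ⟨h1, -⟩
    · exact h2
    · exact absurd (hf.disjoint hu h1) hus.ne_zero
  obtain ⟨v₁, hv₁, hv₁0, h₁⟩ := get u₁ (Submodule.subset_span (by simp)) hs₁
  obtain ⟨v₂, hv₂, hv₂0, h₂⟩ := get u₂ (Submodule.subset_span (by simp)) hs₂
  have hvli : LinearIndependent K ![v₁, v₂] := by
    refine linearIndependent_pair_of_notMem hv₁0 fun hv => ?_
    obtain ⟨c, rfl⟩ := Submodule.mem_span_singleton.1 hv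
    have hc : c ≠ 0 := by rintro rfl; simp at hv₂0
    have h₂' : m u₂ v₁ ∈ Submodule.span K {u₁, u₂} := by
      simpa [hc] using Submodule.smul_mem _ c⁻¹ h₂
    obtain ⟨w, hw, -, hle⟩ := exists_complement_in_pair halt hf.hy hv₁ hv₁0
    have hvw := linearIndependent_pair_of_span_le hTli hle
    have hg : TwoPlanes m u₁ u₂ v₁ w := hf.change halt hli hvw (Submodule.subset_span (by simp))
      (Submodule.subset_span (by simp)) hv₁ hw
    obtain ⟨p₁, p₂, hp⟩ := Submodule.mem_span_pair.1 h₁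
    obtain ⟨q₁, q₂, hq⟩ := Submodule.mem_span_pair.1 h₂'
    obtain ⟨r₁, r₂, r₃, r₄, hr⟩ := exists_eq_of_linearIndependent_four hU hg.li (m u₁ w)
    obtain ⟨s₁, s₂, s₃, s₄, hs⟩ := exists_eq_of_linearIndependent_four hU hg.li (m u₂ w)
    have hr₄ : r₄ = 0 := by
      have := trace_eq_of_linearIndependent_four hU hg.li (m u₁)
        (a₁ := 0) (a₂ := 0) (a₃ := 0) (a₄ := 0) (b₁ := 0) (b₂ := 0) (b₃ := 0) (b₄ := 0)
        (c₁ := p₁) (c₂ := p₂) (c₃ := 0) (c₄ := 0)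
        (by simp [halt]) (by simp [hf.hx]) (by simp [← hp]) hr
      simpa [htr] using this.symm
    have hs₄ : s₄ = 0 := by
      have := trace_eq_of_linearIndependent_four hU hg.li (m u₂)
        (a₁ := 0) (a₂ := 0) (a₃ := 0) (a₄ := 0) (b₁ := 0) (b₂ := 0) (b₃ := 0) (b₄ := 0)
        (c₁ := q₁) (c₂ := q₂) (c₃ := 0) (c₄ := 0)
        (by simp [map_swap_of_alternating halt u₂ u₁, hf.hx]) (by simp [halt]) (by simp [← hq]) hs
      simpa [htr] using this.symm
    have mem : ∀ a b c : K,
        a • u₁ + b • u₂ + c • v₁ ∈ Submodule.span K (Set.range ![u₁, u₂, v₁, 0]) :=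
      fun a b c => add_mem (add_mem (Submodule.smul_mem _ _ (Submodule.subset_span ⟨0, rfl⟩))
        (Submodule.smul_mem _ _ (Submodule.subset_span ⟨1, rfl⟩)))
        (Submodule.smul_mem _ _ (Submodule.subset_span ⟨2, rfl⟩))
    have := hg.products hU halt hspan (q := ![u₁, u₂, v₁, 0])
      (by simpa [← hp] using mem p₁ p₂ 0) (by simpa [hr, hr₄] using mem r₁ r₂ r₃)
      (by simpa [← hq] using mem q₁ q₂ 0) (by simpa [hs, hs₄] using mem s₁ s₂ s₃)
    exact this.ne_zero 3 rfl
  exact ⟨T, hT, u₁, u₂, v₁, v₂, ⟨hf.change halt hli hvli (Submodule.subset_span (by simp))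
    (Submodule.subset_span (by simp)) hv₁ hv₂, h₁, h₂⟩, (span_pair_eq_of_mem hvli hv₁ hv₂).symm⟩

theorem IsSemiAut.of_linearEquiv {m : U →ₗ[K] U →ₗ[K] U} {g : U ≃ₗ[K] U}
    (hg : ∀ x y, g (m x y) = m (g x) (g y)) : IsSemiAut m g.toAddEquiv :=
  ⟨⟨RingEquiv.refl K, fun a x => g.map_smul a x⟩, hg⟩

theorem IsFrame.mem_span_of_isSpecial {m : U →ₗ[K] U →ₗ[K] U} (hU : finrank K U = 4)
    (halt : ∀ x, m x x = 0) (hspan : SpannedByProducts m)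
    (htr : ∀ x, LinearMap.trace K U (m x) = 0) {u₁ u₂ v₁ v₂ : U} (h : IsFrame m u₁ u₂ v₁ v₂)
    {T : U ≃+ U} (hT : IsSemiAut m T)
    (hTv : Submodule.span K {T u₁, T u₂} = Submodule.span K {v₁, v₂}) {w : U}
    (hw : IsSpecial m w) : ∃ k, w ∈ Submodule.span K {![u₁, u₂, T u₁, T u₂] k} := by
  have main : ∀ w ∈ Submodule.span K {u₁, u₂}, IsSpecial m w →
      w ∈ Submodule.span K {u₁} ∨ w ∈ Submodule.span K {u₂} := by
    intro w hw hws
    rcases h.of_isSpecial hU halt hspan hws with ⟨-, v, hv, hv0, hwv⟩ | ⟨h1, -⟩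
    · rcases h.special hU halt hspan htr hw hws.ne_zero hv hv0 hwv with ⟨h1, -⟩ | ⟨h1, -⟩
      · exact Or.inl h1
      · exact Or.inr h1
    · exact absurd (h.disjoint hw h1) hws.ne_zero
  rcases h.of_isSpecial hU halt hspan hw with ⟨h1, -⟩ | ⟨h1, -⟩
  · rcases main w h1 hw with h2 | h2
    · exact ⟨0, h2⟩
    · exact ⟨1, h2⟩
  · rw [← hTv] at h1
    rcases main _ (by simpa using hT.symm.mem_span_pair h1) (IsSpecial.map hT.symm hw) with h2 | h2
    · exact ⟨2, by simpa using hT.mem_span_singleton h2⟩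
    · exact ⟨3, by simpa using hT.mem_span_singleton h2⟩

theorem eq_zero_of_mem_span_singletons {u v w : U} (h : LinearIndependent K ![u, v])
    (hu : w ∈ Submodule.span K {u}) (hv : w ∈ Submodule.span K {v}) : w = 0 := by
  obtain ⟨a, rfl⟩ := Submodule.mem_span_singleton.1 hu
  obtain ⟨b, e⟩ := Submodule.mem_span_singleton.1 hv
  have := (LinearIndependent.pair_iff.1 h a (-b) (by rw [neg_smul, e, add_neg_cancel])).1
  rw [this, zero_smul]

theorem IsFrame.diagonal {m : U →ₗ[K] U →ₗ[K] U} (hU : finrank K U = 4)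
    (halt : ∀ x, m x x = 0) (hspan : SpannedByProducts m)
    (htr : ∀ x, LinearMap.trace K U (m x) = 0) {u₁ u₂ v₁ v₂ : U} (h : IsFrame m u₁ u₂ v₁ v₂)
    {g : U ≃ₗ[K] U} (hg : ∀ x y, g (m x y) = m (g x) (g y))
    (hu : g u₁ ∈ Submodule.span K {u₁}) :
    g u₁ ∈ Submodule.span K {u₁} ∧ g u₂ ∈ Submodule.span K {u₂} ∧
      g v₁ ∈ Submodule.span K {v₁} ∧ g v₂ ∈ Submodule.span K {v₂} := by
  have hs := IsSemiAut.of_linearEquiv hg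
  have hli : LinearIndependent K ![g u₁, g u₂, g v₁, g v₂] := by
    convert hs.linearIndependent h.li using 1
    funext i; fin_cases i <;> rfl
  have hf : TwoPlanes m (g u₁) (g u₂) (g v₁) (g v₂) :=
    ⟨hli, by rw [← hg, h.hx, map_zero], by rw [← hg, h.hy, map_zero]⟩
  have hu0 : g u₁ ≠ 0 := hli.ne_zero 0
  obtain ⟨hu₁, hu₂⟩ : g u₁ ∈ Submodule.span K {u₁, u₂} ∧ g u₂ ∈ Submodule.span K {u₁, u₂} := by
    refine (h.mem_of_mul_eq_zero hU halt hspan hf.linearIndependent_left hf.hx).resolve_right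
      fun h' => hu0 (h.disjoint (Submodule.span_mono (by simp) hu) h'.1)
  obtain ⟨hv₁, hv₂⟩ : g v₁ ∈ Submodule.span K {v₁, v₂} ∧ g v₂ ∈ Submodule.span K {v₁, v₂} := by
    refine (h.mem_of_mul_eq_zero hU halt hspan hf.symm.linearIndependent_left hf.hy).resolve_left
      fun h' => hli.ne_zero 2 (hf.disjoint ?_ (Submodule.subset_span (by simp)))
    rw [span_pair_eq_of_mem hf.linearIndependent_left hu₁ hu₂]
    exact h'.1
  have hmem : ∀ x ∈ Submodule.span K {u₁, u₂}, g x ∈ Submodule.span K {u₁, u₂} := by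
    intro x hx
    rw [← span_pair_eq_of_mem hf.linearIndependent_left hu₁ hu₂]
    exact hs.mem_span_pair hx
  have h₁ := h.special hU halt hspan htr hu₁ hu0 hv₁ (hli.ne_zero 2) (by
    rw [← hg]; exact hmem _ h.h₁₁)
  have h₂ := h.special hU halt hspan htr hu₂ (hli.ne_zero 1) hv₂ (hli.ne_zero 3) (by
    rw [← hg]; exact hmem _ h.h₂₂)
  have h₁' := h₁.resolve_right fun h' =>
    hu0 (eq_zero_of_mem_span_singletons h.linearIndependent_left hu h'.1)
  have h₂' := h₂.resolve_left fun h' => hli.ne_zero 1 <| by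
    obtain ⟨a, ha⟩ := Submodule.mem_span_singleton.1 hu
    have ha0 : a ≠ 0 := by rintro rfl; exact hu0 (by rw [← ha, zero_smul])
    refine eq_zero_of_mem_span_singletons hf.linearIndependent_left ?_
      (Submodule.subset_span rfl)
    rw [← ha, Submodule.span_singleton_smul_eq (IsUnit.mk0 a ha0)]
    exact h'.1
  exact ⟨hu, h₂'.1, h₁'.2, h₂'.2⟩

theorem IsFrame.weights {m : U →ₗ[K] U →ₗ[K] U} (hU : finrank K U = 4)
    (halt : ∀ x, m x x = 0) (hspan : SpannedByProducts m)
    (htr : ∀ x, LinearMap.trace K U (m x) = 0) {u₁ u₂ v₁ v₂ : U} (h : IsFrame m u₁ u₂ v₁ v₂)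
    {g : U ≃ₗ[K] U} (hg : ∀ x y, g (m x y) = m (g x) (g y)) (hg1 : g ≠ LinearEquiv.refl K U)
    (hu : g u₁ ∈ Submodule.span K {u₁}) :
    ∃ c : K, c ^ 5 = 1 ∧ c ≠ 1 ∧ g v₁ = c • v₁ ∧ g u₁ = c ^ 2 • u₁ ∧ g u₂ = c ^ 3 • u₂ ∧
      g v₂ = c ^ 4 • v₂ ∧ ∃ p q α β : K, p ≠ 0 ∧ q ≠ 0 ∧ α ≠ 0 ∧ β ≠ 0 ∧
        m u₁ v₁ = p • u₂ ∧ m u₂ v₂ = q • u₁ ∧ m u₁ v₂ = α • v₁ ∧ m u₂ v₁ = β • v₂ := by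
  obtain ⟨h₁, h₂, h₃, h₄⟩ := h.diagonal hU halt hspan htr hg hu
  obtain ⟨p₁, p₂, q₁, q₂, r₁, r₂, s₁, s₂, α, β, hpq, hα, hβ, hp, hq, hr, hs⟩ :=
    h.coeffs hU halt hspan htr
  obtain ⟨a, ha⟩ := Submodule.mem_span_singleton.1 h₁
  obtain ⟨b, hb⟩ := Submodule.mem_span_singleton.1 h₂
  obtain ⟨c, hc⟩ := Submodule.mem_span_singleton.1 h₃
  obtain ⟨d, hd⟩ := Submodule.mem_span_singleton.1 h₄
  have nz : ∀ {k : Fin 4} {x : K}, x • ![u₁, u₂, v₁, v₂] k = g (![u₁, u₂, v₁, v₂] k) → x ≠ 0 := by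
    rintro k x hx rfl
    rw [zero_smul, eq_comm, LinearEquiv.map_eq_zero_iff] at hx
    exact h.li.ne_zero k hx
  have ha0 : a ≠ 0 := nz (k := 0) ha
  have hb0 : b ≠ 0 := nz (k := 1) hb
  have hc0 : c ≠ 0 := nz (k := 2) hc
  have hd0 : d ≠ 0 := nz (k := 3) hd
  have hli := linearIndependent_four_iff.1 h.li
  have ep := hg u₁ v₁
  have eq := hg u₂ v₂
  have er := hg u₁ v₂
  have es := hg u₂ v₁
  simp only [← ha, ← hb, ← hc, ← hd, hp, hq, hr, hs, map_add, map_smul, LinearMap.smul_apply]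
    at ep eq er es
  obtain ⟨ep₁, ep₂, -, -⟩ := hli (p₁ * (a * c - a)) (p₂ * (a * c - b)) 0 0
    (by linear_combination (norm := module) -ep)
  obtain ⟨eq₁, eq₂, -, -⟩ := hli (q₁ * (b * d - a)) (q₂ * (b * d - b)) 0 0
    (by linear_combination (norm := module) -eq)
  obtain ⟨er₁, er₂, er₃, -⟩ := hli (r₁ * (a * d - a)) (r₂ * (a * d - b)) (α * (a * d - c)) 0
    (by linear_combination (norm := module) -er)
  obtain ⟨es₁, es₂, -, es₄⟩ := hli (s₁ * (b * c - a)) (s₂ * (b * c - b)) 0 (β * (b * c - d))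
    (by linear_combination (norm := module) -es)
  have had : a * d = c := sub_eq_zero.1 ((mul_eq_zero.1 er₃).resolve_left hα)
  have hbc : b * c = d := sub_eq_zero.1 ((mul_eq_zero.1 es₄).resolve_left hβ)
  have not_all : ¬ (a = 1 ∧ b = 1 ∧ c = 1 ∧ d = 1) := by
    rintro ⟨rfl, rfl, rfl, rfl⟩
    refine hg1 (LinearEquiv.ext fun u => ?_)
    obtain ⟨s, t, r, w, rfl⟩ := exists_eq_of_linearIndependent_four hU h.li u
    simp [← ha, ← hb, ← hc, ← hd]
  have c_of : a * c - a = 0 → c = 1 := fun e => mul_left_cancel₀ ha0 (by linear_combination e)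
  have d_of : b * d - b = 0 → d = 1 := fun e => mul_left_cancel₀ hb0 (by linear_combination e)
  have hp₁q₂ : p₁ = 0 ∨ q₂ = 0 := by
    by_contra! hne
    have c1 := c_of ((mul_eq_zero.1 ep₁).resolve_left hne.1)
    have d1 := d_of ((mul_eq_zero.1 eq₂).resolve_left hne.2)
    subst c1 d1
    exact not_all ⟨by simpa using had, by simpa using hbc, rfl, rfl⟩
  have hp₂ : p₂ ≠ 0 := by rintro rfl; rcases hp₁q₂ with rfl | rfl <;> simp at hpq
  have hq₁ : q₁ ≠ 0 := by rintro rfl; rcases hp₁q₂ with rfl | rfl <;> simp at hpq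
  have hac : a * c = b := sub_eq_zero.1 ((mul_eq_zero.1 ep₂).resolve_left hp₂)
  have hbd : b * d = a := sub_eq_zero.1 ((mul_eq_zero.1 eq₁).resolve_left hq₁)
  have hcd : c * d = 1 := mul_left_cancel₀ ha0 (by linear_combination hbd + d * hac)
  have ea : a = c ^ 2 := by linear_combination c * had - a * hcd
  have eb : b = c ^ 3 := by rw [← hac, ea]; ring
  have ed : d = c ^ 4 := by rw [← hbc, eb]; ring
  have hc5 : c ^ 5 = 1 := by rw [← hcd, ed]; ring
  have hc1 : c ≠ 1 := by
    rintro rfl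
    exact not_all ⟨by simp [ea], by simp [eb], rfl, by simp [ed]⟩
  have hd1 : d ≠ 1 := fun e => hc1 (by simpa [e] using hcd)
  have hc2 : c ^ 2 ≠ 1 := fun e => hc1 (by linear_combination hc5 - (c ^ 3 + c) * e)
  subst ea eb ed
  have p10 : p₁ = 0 := (mul_eq_zero.1 ep₁).resolve_right fun e => hc1 (c_of e)
  have q20 : q₂ = 0 := (mul_eq_zero.1 eq₂).resolve_right fun e => hd1 (d_of e)
  have r10 : r₁ = 0 := (mul_eq_zero.1 er₁).resolve_right fun e =>
    hd1 (mul_left_cancel₀ ha0 (by linear_combination e))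
  have r20 : r₂ = 0 := (mul_eq_zero.1 er₂).resolve_right fun e =>
    hc2 (mul_left_cancel₀ hc0 (by linear_combination had - e))
  have s10 : s₁ = 0 := (mul_eq_zero.1 es₁).resolve_right fun e =>
    hc2 (mul_left_cancel₀ ha0 (by linear_combination e))
  have s20 : s₂ = 0 := (mul_eq_zero.1 es₂).resolve_right fun e =>
    hc1 (mul_left_cancel₀ hb0 (by linear_combination e))
  exact ⟨c, hc5, hc1, hc.symm, ha.symm, hb.symm, hd.symm, p₂, q₁, α, β, hp₂, hq₁, hα, hβ,
    by simp [hp, p10], by simp [hq, q20], by simp [hr, r10, r20], by simp [hs, s10, s20]⟩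

/-- The standard `ZMod 5`-indexed product, for which `a ↦ x (k * a)` and multiplication by a
character are automorphisms. -/
def stdMul (x y : ZMod 5 → K) : ZMod 5 → K :=
  fun a => x (2 * a) * y (4 * a) - x (4 * a) * y (2 * a)

/-- `E` identifies `m` with the standard product on functions vanishing at `0`. -/
structure IsStandard (m : U →ₗ[K] U →ₗ[K] U) (E : U →ₗ[K] (ZMod 5 → K)) : Prop where
  inj : Function.Injective E
  zero : ∀ u, E u 0 = 0
  mul : ∀ u v, E (m u v) = stdMul (E u) (E v)

theorem IsFrame.exists_isStandard [IsAlgClosed K] {m : U →ₗ[K] U →ₗ[K] U} (hU : finrank K U = 4)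
    (halt : ∀ x, m x x = 0) {u₁ u₂ v₁ v₂ : U} (h : IsFrame m u₁ u₂ v₁ v₂) {g : U ≃ₗ[K] U} {c : K}
    (hv₁ : g v₁ = c • v₁) (hu₁ : g u₁ = c ^ 2 • u₁) (hu₂ : g u₂ = c ^ 3 • u₂)
    (hv₂ : g v₂ = c ^ 4 • v₂) {p q α β : K} (hp0 : p ≠ 0) (hq0 : q ≠ 0) (hα : α ≠ 0) (hβ : β ≠ 0)
    (hp : m u₁ v₁ = p • u₂) (hq : m u₂ v₂ = q • u₁) (hr : m u₁ v₂ = α • v₁)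
    (hs : m u₂ v₁ = β • v₂) : ∃ E, IsStandard m E ∧ ∀ u a, E (g u) a = c ^ a.val * E u a := by
  obtain ⟨s, hs5⟩ := IsAlgClosed.exists_pow_nat_eq (-α / (p ^ 3 * β * q ^ 2)) (n := 5) (by simp)
  have hs0 : s ≠ 0 := by
    rintro rfl
    have : -α / (p ^ 3 * β * q ^ 2) ≠ 0 := div_ne_zero (neg_ne_zero.2 hα) (by positivity)
    exact this (by rw [← hs5]; simp)
  rw [eq_div_iff (by positivity)] at hs5
  obtain ⟨t, ht⟩ : ∃ t, t * (s ^ 3 * p ^ 2 * β * q) = -1 :=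
    ⟨-1 / (s ^ 3 * p ^ 2 * β * q), div_mul_cancel₀ _ (by positivity)⟩
  have ht0 : t ≠ 0 := by rintro rfl; simp at ht
  obtain ⟨u, hu⟩ : ∃ u, u = -(s * t * p) := ⟨_, rfl⟩
  obtain ⟨w, hw⟩ : ∃ w, w = u * s * β := ⟨_, rfl⟩
  have hu0 : u ≠ 0 := by rw [hu]; exact neg_ne_zero.2 (by positivity)
  have hw0 : w ≠ 0 := by rw [hw]; positivity
  have e₁ : t * w * α = s := by
    refine mul_left_cancel₀ (show s ^ 5 * p ^ 3 * β * q ^ 2 ≠ 0 by positivity) ?_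
    rw [hw, hu]
    linear_combination (-α * s * (t * (s ^ 3 * p ^ 2 * β * q) - 1)) * ht - s * hs5
  have e₂ : -(w * u * q) = t := by
    rw [hw, hu]
    linear_combination (-t) * ht
  have sw := map_swap_of_alternating halt
  have hli : LinearIndependent K ![s • v₁, t • u₁, u • u₂, w • v₂] := by
    refine linearIndependent_four_iff.2 fun a b c d e => ?_
    have := linearIndependent_four_iff.1 h.li (b * t) (c * u) (a * s) (d * w)
      (by rw [← e]; module)
    simpa [hs0, ht0, hu0, hw0, and_comm, and_left_comm, and_assoc] using this
  have hB := coe_basisOfLinearIndependentOfCardEqFinrank hli (by simp [hU])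
  generalize basisOfLinearIndependentOfCardEqFinrank hli (by simp [hU]) = B at hB
  let E : U →ₗ[K] (ZMod 5 → K) := LinearMap.pi
    (show ZMod 5 → (U →ₗ[K] K) from ![0, B.coord 0, B.coord 1, B.coord 2, B.coord 3])
  have hE : ∀ x : Fin 4 → K, E (x 0 • s • v₁ + x 1 • t • u₁ + x 2 • u • u₂ + x 3 • w • v₂) =
      (show ZMod 5 → K from ![0, x 0, x 1, x 2, x 3]) := by
    intro x
    have : x 0 • s • v₁ + x 1 • t • u₁ + x 2 • u • u₂ + x 3 • w • v₂ = ∑ j, x j • B j := by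
      rw [Fin.sum_univ_four, hB]; rfl
    rw [this]
    have e : ∀ i, B.coord i (∑ j, x j • B j) = x i := fun i => by
      rw [Basis.coord_apply, B.repr_sum_self]
    funext a
    change Fin 5 at a
    fin_cases a
    · rfl
    · exact e 0
    · exact e 1
    · exact e 2
    · exact e 3
  have ex : ∀ y, ∃ x : Fin 4 → K,
      y = x 0 • s • v₁ + x 1 • t • u₁ + x 2 • u • u₂ + x 3 • w • v₂ := fun y => by
    obtain ⟨a, b, c, d, e⟩ := exists_eq_of_linearIndependent_four hU hli y
    exact ⟨![a, b, c, d], e⟩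
  refine ⟨E, ⟨(injective_iff_map_eq_zero E).2 fun y hy => ?_, fun y => rfl, fun y z => ?_⟩,
    fun y a => ?_⟩
  · obtain ⟨x, rfl⟩ := ex y
    rw [hE] at hy
    have h0 : x 0 = 0 := congrFun hy 1
    have h1 : x 1 = 0 := congrFun hy 2
    have h2 : x 2 = 0 := congrFun hy 3
    have h3 : x 3 = 0 := congrFun hy 4
    simp [h0, h1, h2, h3]
  · obtain ⟨x, rfl⟩ := ex y
    obtain ⟨z, rfl⟩ := ex z
    have key := hE ![x 1 * z 3 - x 3 * z 1, x 3 * z 2 - x 2 * z 3, x 0 * z 1 - x 1 * z 0,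
      x 2 * z 0 - x 0 * z 2]
    rw [hE, hE]
    have hprod : m (x 0 • s • v₁ + x 1 • t • u₁ + x 2 • u • u₂ + x 3 • w • v₂)
        (z 0 • s • v₁ + z 1 • t • u₁ + z 2 • u • u₂ + z 3 • w • v₂) =
        (x 1 * z 3 - x 3 * z 1) • s • v₁ + (x 3 * z 2 - x 2 * z 3) • t • u₁ +
        (x 0 * z 1 - x 1 * z 0) • u • u₂ + (x 2 * z 0 - x 0 * z 2) • w • v₂ := by
      simp only [map_add, map_smul, LinearMap.add_apply, LinearMap.smul_apply, halt, sw v₁ u₁,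
        sw v₁ u₂, sw v₂ u₁, sw v₂ u₂, sw u₂ u₁, sw v₂ v₁, hp, hq, hr, hs, h.hx, h.hy]
      linear_combination (norm := module) ((x 1 * z 3 - x 3 * z 1) * e₁) • v₁ +
        ((x 3 * z 2 - x 2 * z 3) * e₂) • u₁ - ((x 0 * z 1 - x 1 * z 0) * hu) • u₂ -
        ((x 2 * z 0 - x 0 * z 2) * hw) • v₂
    rw [hprod]
    refine key.trans ?_
    funext a
    change Fin 5 at a
    fin_cases a
    · exact (by simp : (0 : K) = 0 * 0 - 0 * 0)
    · rfl
    · rfl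
    · rfl
    · rfl
  · obtain ⟨x, rfl⟩ := ex y
    have key := hE ![c * x 0, c ^ 2 * x 1, c ^ 3 * x 2, c ^ 4 * x 3]
    have hgy : g (x 0 • s • v₁ + x 1 • t • u₁ + x 2 • u • u₂ + x 3 • w • v₂) =
        (c * x 0) • s • v₁ + (c ^ 2 * x 1) • t • u₁ + (c ^ 3 * x 2) • u • u₂ +
        (c ^ 4 * x 3) • w • v₂ := by
      simp only [map_add, map_smul, hv₁, hu₁, hu₂, hv₂]
      module
    rw [hgy, hE]
    refine (congrFun key a).trans ?_
    change Fin 5 at a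
    fin_cases a
    · exact (by simp : (0 : K) = c ^ 0 * 0)
    · exact (by simp : c * x 0 = c ^ 1 * x 0)
    · rfl
    · rfl
    · rfl

/-- An irreducible trace-free algebra of dimension four with at least five automorphisms is the
standard one. -/
theorem SemiIrreducible.exists_isStandard [IsAlgClosed K] {m : U →ₗ[K] U →ₗ[K] U}
    (hU : finrank K U = 4) (halt : ∀ x, m x x = 0) (hirr : SemiIrreducible m) (hm : m ≠ 0)
    (htr : ∀ x, LinearMap.trace K U (m x) = 0) {ι : Type*} [Finite ι] (hι : 5 ≤ Nat.card ι)
    {s : ι → U ≃ₗ[K] U} (hinj : Function.Injective s)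
    (hs : ∀ i x y, s i (m x y) = m (s i x) (s i y)) :
    ∃ i j, ∃ c : K, c ^ 5 = 1 ∧ c ≠ 1 ∧ ∃ E, IsStandard m E ∧
      ∀ u a, E ((s i).trans (s j).symm u) a = c ^ a.val * E u a := by
  have hspan := hirr.spannedByProducts hm
  obtain ⟨T, hT, u₁, u₂, v₁, v₂, h, hTv⟩ := hirr.exists_frame hU halt hm htr
  have hus : IsSpecial m u₁ := h.isSpecial halt (Submodule.subset_span (by simp)) (h.li.ne_zero 0)
    (v := v₁) (Submodule.subset_span (by simp)) (h.li.ne_zero 2) h.h₁₁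
  have hk : ∀ i, ∃ k, s i u₁ ∈ Submodule.span K {![u₁, u₂, T u₁, T u₂] k} := fun i =>
    h.mem_span_of_isSpecial hU halt hspan htr hT hTv
      (IsSpecial.map (IsSemiAut.of_linearEquiv (hs i)) hus)
  choose k hk using hk
  obtain ⟨i, j, e, hij⟩ : ∃ i j, k i = k j ∧ i ≠ j := by
    by_contra! hk'
    have := Nat.card_le_card_of_injective k hk'
    rw [Nat.card_fin] at this
    omega
  have hg : ∀ x y, (s i).trans (s j).symm (m x y) =
      m ((s i).trans (s j).symm x) ((s i).trans (s j).symm y) := by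
    intro x y
    apply (s j).injective
    simp [hs]
  have hg1 : (s i).trans (s j).symm ≠ LinearEquiv.refl K U := by
    intro h1
    refine hij (hinj (LinearEquiv.ext fun x => ?_))
    have := congrArg (s j) (LinearEquiv.congr_fun h1 x)
    simpa using this
  have hu : (s i).trans (s j).symm u₁ ∈ Submodule.span K {u₁} := by
    have h1 := hk i
    have h2 := hk j
    rw [e] at h1
    obtain ⟨a, ha⟩ := Submodule.mem_span_singleton.1 h1
    obtain ⟨b, hb⟩ := Submodule.mem_span_singleton.1 h2
    have hb0 : b ≠ 0 := by
      rintro rfl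
      rw [zero_smul, eq_comm, LinearEquiv.map_eq_zero_iff] at hb
      exact h.li.ne_zero 0 hb
    refine Submodule.mem_span_singleton.2 ⟨a * b⁻¹, (s j).injective ?_⟩
    simp [← ha, ← hb, smul_smul, hb0]
  obtain ⟨c, hc5, hc1, hv₁, hu₁, hu₂, hv₂, p, q, α, β, hp0, hq0, hα, hβ, hp, hq, hr, hs⟩ :=
    h.weights hU halt hspan htr hg hg1 hu
  obtain ⟨E, hE⟩ := h.exists_isStandard hU halt hv₁ hu₁ hu₂ hv₂ hp0 hq0 hα hβ hp hq hr hs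
  exact ⟨i, j, c, hc5, hc1, E, hE⟩

end Algebra

section Descent

variable {p : ℕ} [Fact p.Prime]

/-- The automorphism group of an algebra. -/
def algAut {F V : Type*} [Field F] [AddCommGroup V] [Module F V] (f : V →ₗ[F] V →ₗ[F] V) :
    Subgroup (V ≃ₗ[F] V) where
  carrier := {g | ∀ x y, g (f x y) = f (g x) (g y)}
  mul_mem' := fun {g h} hg hh x y => by
    change g (h (f x y)) = _
    rw [hh, hg]
    rfl
  one_mem' := fun x y => rfl
  inv_mem' := fun {g} hg x y => by
    apply g.injective
    rw [hg]
    change g (g.symm _) = f (g (g.symm _)) (g (g.symm _))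
    simp

/-- No proper nonzero subspace is invariant under all automorphisms. -/
def AutIrreducible {F V : Type*} [Field F] [AddCommGroup V] [Module F V]
    (f : V →ₗ[F] V →ₗ[F] V) : Prop :=
  ∀ W : Submodule F V, (∀ g ∈ algAut f, ∀ w ∈ W, g w ∈ W) → W = ⊥ ∨ W = ⊤

theorem AutIrreducible.trace_eq_zero {F V : Type*} [Field F] [AddCommGroup V] [Module F V]
    [FiniteDimensional F V] (hV : 1 < finrank F V) {f : V →ₗ[F] V →ₗ[F] V}
    (hirr : AutIrreducible f) (x : V) : LinearMap.trace F V (f x) = 0 := by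
  have key : (LinearMap.trace F V ∘ₗ f).ker = ⊤ := by
    refine (hirr _ fun g hg w hw => ?_).resolve_left fun h => ?_
    · rw [LinearMap.mem_ker, LinearMap.comp_apply] at hw ⊢
      rw [← hw, ← LinearMap.trace_conj' (f w) g]
      congr 1
      ext y
      simp only [LinearEquiv.conj_apply, LinearMap.comp_apply, LinearEquiv.coe_coe]
      rw [show g (f w (g.symm y)) = f (g w) (g (g.symm y)) from hg w _, g.apply_symm_apply]
    · have := LinearMap.finrank_le_finrank_of_injective (LinearMap.ker_eq_bot.1 h)
      rw [finrank_self] at this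
      omega
  have : x ∈ (LinearMap.trace F V ∘ₗ f).ker := by rw [key]; trivial
  exact this

theorem AutIrreducible.finrank_lt_card {F V : Type*} [Field F] [Finite F] [AddCommGroup V]
    [Module F V] [FiniteDimensional F V] (hV : 1 < finrank F V) {f : V →ₗ[F] V →ₗ[F] V}
    (hirr : AutIrreducible f) : finrank F V < Nat.card (algAut f) := by
  have : Finite V := Module.finite_of_finite F
  have : Finite (V ≃ₗ[F] V) := DFunLike.finite _
  have := Fintype.ofFinite (algAut f)
  have hnt : Nontrivial V := Module.nontrivial_of_finrank_pos (R := F) (by omega)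
  obtain ⟨v, hv⟩ := exists_ne (0 : V)
  have htop : Submodule.span F (Set.range fun g : algAut f => g.1 v) = ⊤ := by
    refine (hirr _ fun g hg w hw => ?_).resolve_left fun h => hv ?_
    · have : Submodule.span F (Set.range fun g : algAut f => g.1 v) ≤
          (Submodule.span F (Set.range fun g : algAut f => g.1 v)).comap g.toLinearMap := by
        refine Submodule.span_le.2 ?_
        rintro _ ⟨k, rfl⟩
        exact Submodule.subset_span ⟨⟨g, hg⟩ * k, rfl⟩
      exact this hw
    · have : v ∈ Submodule.span F (Set.range fun g : algAut f => g.1 v) :=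
        Submodule.subset_span ⟨1, rfl⟩
      rw [h] at this
      simpa using this
  have hle : finrank F V ≤ Nat.card (algAut f) := by
    have := finrank_range_le_card (R := F) (fun g : algAut f => g.1 v)
    rwa [Set.finrank, htop, finrank_top, ← Nat.card_eq_fintype_card] at this
  refine lt_of_le_of_ne hle fun he => ?_
  have hli : LinearIndependent F (fun g : algAut f => g.1 v) :=
    linearIndependent_of_top_le_span_of_card_eq_finrank htop.ge
      (by rw [← Nat.card_eq_fintype_card, he])
  have hs0 : ∑ g : algAut f, g.1 v ≠ 0 := fun h0 => by
    have := Fintype.linearIndependent_iff.1 hli (fun _ => 1) (by simpa using h0) 1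
    exact one_ne_zero this
  have hinv : ∀ g ∈ algAut f, g (∑ k : algAut f, k.1 v) = ∑ k : algAut f, k.1 v := by
    intro g hg
    rw [map_sum]
    exact Fintype.sum_equiv (Equiv.mulLeft ⟨g, hg⟩) _ _ fun k => rfl
  rcases hirr (Submodule.span F {∑ g : algAut f, g.1 v}) (fun g hg w hw => by
    obtain ⟨a, rfl⟩ := Submodule.mem_span_singleton.1 hw
    rw [map_smul, hinv g hg]
    exact Submodule.smul_mem _ _ (Submodule.mem_span_singleton_self _)) with h | h
  · rw [Submodule.span_singleton_eq_bot] at h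
    exact hs0 h
  · have := finrank_span_singleton (K := F) hs0
    rw [h, finrank_top] at this
    omega

variable (K : Type*) [Field K] [Algebra (ZMod p) K]

/-- The inclusion of the rational vectors. -/
def ratVec : (Fin 4 → ZMod p) →ₗ[ZMod p] (Fin 4 → K) :=
  (Algebra.linearMap (ZMod p) K).compLeft (Fin 4)

variable {K}

theorem ratVec_apply (v : Fin 4 → ZMod p) (i : Fin 4) :
    ratVec K v i = algebraMap (ZMod p) K (v i) := rfl

theorem ratVec_injective : Function.Injective (ratVec K (p := p)) := fun v w h => by
  funext i
  exact (algebraMap (ZMod p) K).injective (congrFun h i)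

theorem ratVec_single (i : Fin 4) : ratVec K (p := p) (Pi.single i 1) = Pi.single i 1 := by
  funext j
  rw [ratVec_apply]
  by_cases h : j = i
  · subst h; simp
  · simp [h]

section Module

variable {M : Type*} [AddCommGroup M] [Module K M] [Module (ZMod p) M] [IsScalarTower (ZMod p) K M]

/-- The `K`-linear extension of a linear map on rational vectors. -/
noncomputable def ratExtend (L : (Fin 4 → ZMod p) →ₗ[ZMod p] M) : (Fin 4 → K) →ₗ[K] M :=
  (Pi.basisFun K (Fin 4)).constr K fun i => L (Pi.single i 1)

omit [Algebra (ZMod p) K] [IsScalarTower (ZMod p) K M] in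
theorem ratExtend_apply (L : (Fin 4 → ZMod p) →ₗ[ZMod p] M) (x : Fin 4 → K) :
    ratExtend L x = ∑ i, x i • L (Pi.single i 1) := by
  rw [ratExtend, Basis.constr_apply_fintype]
  rfl

theorem linearMap_rat_eq_sum (L : (Fin 4 → ZMod p) →ₗ[ZMod p] M) (v : Fin 4 → ZMod p) :
    L v = ∑ i, v i • L (Pi.single i 1) := by
  conv_lhs => rw [← (Pi.basisFun (ZMod p) (Fin 4)).sum_repr v, map_sum]
  simp

theorem ratExtend_ratVec (L : (Fin 4 → ZMod p) →ₗ[ZMod p] M) (v : Fin 4 → ZMod p) :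
    ratExtend L (ratVec K v) = L v := by
  rw [ratExtend_apply, linearMap_rat_eq_sum L v]
  refine Finset.sum_congr rfl fun i _ => ?_
  rw [ratVec_apply, algebraMap_smul]

omit [Module (ZMod p) M] [IsScalarTower (ZMod p) K M] in
theorem linearMap_ext_rat {A B : (Fin 4 → K) →ₗ[K] M}
    (h : ∀ v : Fin 4 → ZMod p, A (ratVec K v) = B (ratVec K v)) : A = B := by
  refine (Pi.basisFun K (Fin 4)).ext fun i => ?_
  rw [Pi.basisFun_apply, ← ratVec_single (p := p)]
  exact h _

end Module

/-- The `K`-linear extension of an algebra. -/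
noncomputable def ratMul (f : (Fin 4 → ZMod p) →ₗ[ZMod p] (Fin 4 → ZMod p) →ₗ[ZMod p]
    (Fin 4 → ZMod p)) : (Fin 4 → K) →ₗ[K] (Fin 4 → K) →ₗ[K] (Fin 4 → K) :=
  (Pi.basisFun K (Fin 4)).constr K fun i => ratExtend (ratVec K ∘ₗ f (Pi.single i 1))

variable {f : (Fin 4 → ZMod p) →ₗ[ZMod p] (Fin 4 → ZMod p) →ₗ[ZMod p] (Fin 4 → ZMod p)}

theorem ratMul_apply (x y : Fin 4 → K) : ratMul f x y =
    ∑ i, ∑ j, (x i * y j) • ratVec K (f (Pi.single i 1) (Pi.single j 1)) := by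
  rw [ratMul, Basis.constr_apply_fintype, LinearMap.sum_apply]
  refine Finset.sum_congr rfl fun i _ => ?_
  rw [LinearMap.smul_apply, ratExtend_apply, Finset.smul_sum]
  exact Finset.sum_congr rfl fun j _ => by rw [smul_smul]; rfl

theorem ratMul_ratVec (v w : Fin 4 → ZMod p) :
    ratMul f (ratVec K v) (ratVec K w) = ratVec K (f v w) := by
  rw [ratMul, Basis.constr_apply_fintype, LinearMap.sum_apply,
    linearMap_rat_eq_sum f v, LinearMap.sum_apply, map_sum]
  refine Finset.sum_congr rfl fun i _ => ?_
  rw [LinearMap.smul_apply, ratExtend_ratVec, LinearMap.smul_apply, map_smul]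
  exact algebraMap_smul K (v i) _

theorem ratMul_eq {M : Type*} [AddCommGroup M] [Module K M] [Module (ZMod p) M]
    [IsScalarTower (ZMod p) K M] {E : (Fin 4 → K) →ₗ[K] M}
    {B : (Fin 4 → K) →ₗ[K] (Fin 4 → K) →ₗ[K] M}
    (h : ∀ v w, E (ratVec K (f v w)) = B (ratVec K v) (ratVec K w)) (x y : Fin 4 → K) :
    E (ratMul f x y) = B x y := by
  have h1 : (ratMul f).compr₂ E = B := by
    refine linearMap_ext_rat (p := p) fun v => linearMap_ext_rat (p := p) fun w => ?_
    rw [LinearMap.compr₂_apply, ratMul_ratVec, h]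
  rw [← h1, LinearMap.compr₂_apply]

theorem ratMul_self (halt : ∀ x, f x x = 0) (x : Fin 4 → K) : ratMul f x x = 0 := by
  have h1 : ratMul f = -(ratMul f (K := K)).flip := by
    refine linearMap_ext_rat (p := p) fun v => linearMap_ext_rat (p := p) fun w => ?_
    rw [LinearMap.neg_apply, LinearMap.neg_apply, LinearMap.flip_apply, ratMul_ratVec,
      ratMul_ratVec, map_swap_of_alternating halt, map_neg]
  rw [ratMul_apply]
  have hsw := map_swap_of_alternating halt
  simp only [Fin.sum_univ_four, halt, hsw (Pi.single 1 1) (Pi.single 0 1),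
    hsw (Pi.single 2 1) (Pi.single 0 1), hsw (Pi.single 3 1) (Pi.single 0 1),
    hsw (Pi.single 2 1) (Pi.single 1 1), hsw (Pi.single 3 1) (Pi.single 1 1),
    hsw (Pi.single 3 1) (Pi.single 2 1), map_neg, map_zero]
  module

theorem ratMul_ne_zero (hf : f ≠ 0) : ratMul f (K := K) ≠ 0 := by
  intro h
  refine hf (LinearMap.ext fun v => LinearMap.ext fun w => ratVec_injective (K := K) ?_)
  rw [← ratMul_ratVec, h]
  simp

theorem trace_ratMul (h : ∀ x, LinearMap.trace (ZMod p) _ (f x) = 0) (x : Fin 4 → K) :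
    LinearMap.trace K _ (ratMul f x) = 0 := by
  have h1 : LinearMap.trace K (Fin 4 → K) ∘ₗ ratMul f = 0 := by
    refine linearMap_ext_rat (p := p) fun v => ?_
    rw [LinearMap.comp_apply, LinearMap.trace_eq_matrix_trace K (Pi.basisFun K (Fin 4)),
      LinearMap.zero_apply, ← map_zero (algebraMap (ZMod p) K), ← h v,
      LinearMap.trace_eq_matrix_trace (ZMod p) (Pi.basisFun (ZMod p) (Fin 4)),
      Matrix.trace, Matrix.trace, map_sum]
    refine Finset.sum_congr rfl fun i _ => ?_
    rw [Matrix.diag_apply, Matrix.diag_apply, LinearMap.toMatrix_apply, LinearMap.toMatrix_apply,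
      Pi.basisFun_apply, Pi.basisFun_apply, ← ratVec_single (p := p), ratMul_ratVec]
    rfl
  exact LinearMap.congr_fun h1 x

/-- The `K`-linear extension of an automorphism. -/
noncomputable def ratEquiv (g : (Fin 4 → ZMod p) ≃ₗ[ZMod p] (Fin 4 → ZMod p)) :
    (Fin 4 → K) ≃ₗ[K] (Fin 4 → K) :=
  LinearEquiv.ofLinearMap (ratExtend (ratVec K ∘ₗ g.toLinearMap))
    (ratExtend (ratVec K ∘ₗ g.symm.toLinearMap))
    (linearMap_ext_rat (p := p) fun v => by simp [ratExtend_ratVec])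
    (linearMap_ext_rat (p := p) fun v => by simp [ratExtend_ratVec])

theorem ratEquiv_ratVec (g : (Fin 4 → ZMod p) ≃ₗ[ZMod p] (Fin 4 → ZMod p))
    (v : Fin 4 → ZMod p) : ratEquiv g (ratVec K v) = ratVec K (g v) :=
  ratExtend_ratVec _ v

theorem ratEquiv_injective : Function.Injective (ratEquiv (K := K) (p := p)) := fun g h e => by
  ext1 v
  apply ratVec_injective (K := K)
  rw [← ratEquiv_ratVec, e, ratEquiv_ratVec]

theorem ratEquiv_mul {g : (Fin 4 → ZMod p) ≃ₗ[ZMod p] (Fin 4 → ZMod p)} (hg : g ∈ algAut f)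
    (x y : Fin 4 → K) : ratEquiv g (ratMul f x y) = ratMul f (ratEquiv g x) (ratEquiv g y) := by
  have h := ratMul_eq (f := f) (E := (ratEquiv (K := K) g).toLinearMap)
    (B := (ratMul f).compl₁₂ (ratEquiv g).toLinearMap (ratEquiv g).toLinearMap)
    (fun v w => by
      simp only [LinearMap.compl₁₂_apply, LinearEquiv.coe_coe, ratEquiv_ratVec, ratMul_ratVec]
      exact congrArg _ (hg v w)) x y
  simpa only [LinearMap.compl₁₂_apply, LinearEquiv.coe_coe] using h

section Frobenius

variable [IsAlgClosed K] [CharP K p]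

variable (K p) in
/-- The coordinatewise Frobenius map. -/
noncomputable def frobVec : (Fin 4 → K) ≃+ (Fin 4 → K) :=
  AddEquiv.piCongrRight fun _ => (frobeniusEquiv K p).toAddEquiv

omit [Algebra (ZMod p) K] in
theorem frobVec_apply (x : Fin 4 → K) (i : Fin 4) : frobVec p K x i = x i ^ p := rfl

omit [IsAlgClosed K] [CharP K p] in
theorem algebraMap_pow_char (a : ZMod p) :
    algebraMap (ZMod p) K a ^ p = algebraMap (ZMod p) K a := by
  rw [← map_pow, ZMod.pow_card]

theorem frobVec_ratVec (v : Fin 4 → ZMod p) : frobVec p K (ratVec K v) = ratVec K v := by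
  funext i
  rw [frobVec_apply, ratVec_apply, algebraMap_pow_char]

omit [IsAlgClosed K] in
theorem exists_algebraMap_eq {a : K} (ha : a ^ p = a) :
    ∃ b : ZMod p, algebraMap (ZMod p) K b = a := by
  obtain ⟨n, hn⟩ := (mem_bot_iff_intCast p K).1
    ((Subfield.mem_bot_iff_pow_eq_self (F := K) (p := p)).2 ha)
  exact ⟨n, by simpa using hn⟩

omit [Algebra (ZMod p) K] in
theorem frobVec_smul (a : K) (x : Fin 4 → K) : frobVec p K (a • x) = a ^ p • frobVec p K x := by
  funext i
  simp [frobVec_apply, mul_pow]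

theorem isSemiAut_frobVec : IsSemiAut (ratMul f) (frobVec p K) := by
  refine ⟨⟨frobeniusEquiv K p, fun a x => frobVec_smul a x⟩, fun x y => ?_⟩
  rw [ratMul_apply, ratMul_apply, map_sum]
  refine Finset.sum_congr rfl fun i _ => ?_
  rw [map_sum]
  refine Finset.sum_congr rfl fun j _ => ?_
  rw [frobVec_smul, frobVec_ratVec, mul_pow, frobVec_apply, frobVec_apply]

/-- A nonzero Frobenius-stable subspace contains a nonzero rational vector. -/
theorem exists_ratVec_mem {W : Submodule K (Fin 4 → K)} (hW : ∀ w ∈ W, frobVec p K w ∈ W)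
    (hW0 : W ≠ ⊥) : ∃ v : Fin 4 → ZMod p, v ≠ 0 ∧ ratVec K v ∈ W := by
  classical
  obtain ⟨w₀, hw₀, hw₀0⟩ := Submodule.exists_mem_ne_zero_of_ne_bot hW0
  have hne : {w : Fin 4 → K | w ∈ W ∧ w ≠ 0}.Nonempty := ⟨w₀, hw₀, hw₀0⟩
  obtain ⟨w, ⟨hw, hw0⟩, hmin⟩ := (InvImage.wf (fun w : Fin 4 → K =>
    (Finset.univ.filter fun i => w i ≠ 0).card) Nat.lt_wfRel.wf).has_min _ hne
  obtain ⟨i, hi⟩ := Function.ne_iff.1 hw0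
  have hi : w i ≠ 0 := hi
  have hx : frobVec p K ((w i)⁻¹ • w) - (w i)⁻¹ • w = 0 := by
    by_contra hne0
    refine hmin _ ⟨W.sub_mem (hW _ (W.smul_mem _ hw)) (W.smul_mem _ hw), hne0⟩
      (Finset.card_lt_card ?_)
    refine ⟨fun j => ?_, fun hsub => ?_⟩
    · simp only [Finset.mem_filter, Finset.mem_univ, true_and]
      intro hj hj0
      exact hj (by simp [frobVec_apply, hj0, (Fact.out : p.Prime).ne_zero])
    · have := hsub (Finset.mem_filter.2 ⟨Finset.mem_univ i, hi⟩)
      rw [Finset.mem_filter] at this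
      exact this.2 (by simp [frobVec_apply, hi])
  have hrat : ∀ j, ∃ b : ZMod p, algebraMap (ZMod p) K b = (w i)⁻¹ * w j := fun j => by
    refine exists_algebraMap_eq ?_
    have := congrFun hx j
    simpa [sub_eq_zero, frobVec_apply] using this
  choose v hv using hrat
  have hvw : ratVec K v = (w i)⁻¹ • w := funext hv
  refine ⟨v, ?_, by rw [hvw]; exact W.smul_mem _ hw⟩
  rintro rfl
  have := congrFun hvw i
  simp [hi] at this

theorem AutIrreducible.semiIrreducible (hirr : AutIrreducible f) :
    SemiIrreducible (ratMul f (K := K)) := by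
  intro W hW
  rw [or_iff_not_imp_left]
  intro hW0
  obtain ⟨v, hv0, hv⟩ := exists_ratVec_mem (hW _ isSemiAut_frobVec) hW0
  have htop : (W.restrictScalars (ZMod p)).comap (ratVec K) = ⊤ := by
    refine (hirr _ fun g hg w hw => ?_).resolve_left fun h => hv0 ?_
    · have := hW _ (IsSemiAut.of_linearEquiv (ratEquiv_mul hg)) _ hw
      change ratEquiv g (ratVec K w) ∈ W at this
      rwa [ratEquiv_ratVec] at this
    · have : v ∈ (W.restrictScalars (ZMod p)).comap (ratVec K) := hv
      rwa [h] at this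
  rw [eq_top_iff, ← (Pi.basisFun K (Fin 4)).span_eq, Submodule.span_le]
  rintro _ ⟨i, rfl⟩
  rw [Pi.basisFun_apply, ← ratVec_single (p := p)]
  have : Pi.single i 1 ∈ (W.restrictScalars (ZMod p)).comap (ratVec K) := by rw [htop]; trivial
  exact this

end Frobenius

end Descent

section Standard

variable {K U : Type*} [Field K] [AddCommGroup U] [Module K U]

instance fact_prime_five : Fact (Nat.Prime 5) := ⟨by norm_num⟩

theorem stdMul_self (x : ZMod 5 → K) : stdMul x x = 0 := by
  funext a
  simp only [stdMul, Pi.zero_apply]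
  ring

theorem stdMul_comp_mul (x y : ZMod 5 → K) (k : ZMod 5) :
    stdMul (fun a => x (k * a)) (fun a => y (k * a)) = fun a => stdMul x y (k * a) := by
  funext a
  simp only [stdMul, mul_left_comm k]

theorem stdMul_twist (z : AddChar (ZMod 5) K) (x y : ZMod 5 → K) (j : ZMod 5) :
    stdMul (fun a => z (j * a) * x a) (fun a => z (j * a) * y a) =
      fun a => z (j * a) * stdMul x y a := by
  funext a
  have h : z (j * a) = z (j * (2 * a)) * z (j * (4 * a)) := by
    rw [← AddChar.map_add_eq_mul]
    congr 1
    have : ∀ j a : ZMod 5, j * a = j * (2 * a) + j * (4 * a) := by decide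
    exact this j a
  simp only [stdMul]
  rw [h]
  ring

theorem zmod_five_ne :
    (0 : ZMod 5) ≠ 1 ∧ (0 : ZMod 5) ≠ 2 ∧ (0 : ZMod 5) ≠ 3 ∧ (0 : ZMod 5) ≠ 4 ∧
    (1 : ZMod 5) ≠ 2 ∧ (1 : ZMod 5) ≠ 3 ∧ (1 : ZMod 5) ≠ 4 ∧ (2 : ZMod 5) ≠ 1 ∧
    (2 : ZMod 5) ≠ 3 ∧ (2 : ZMod 5) ≠ 4 ∧ (3 : ZMod 5) ≠ 1 ∧ (3 : ZMod 5) ≠ 2 ∧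
    (3 : ZMod 5) ≠ 4 ∧ (4 : ZMod 5) ≠ 1 ∧ (4 : ZMod 5) ≠ 2 ∧ (4 : ZMod 5) ≠ 3 := by
  decide

theorem zmod_five_cases (a : ZMod 5) : a = 0 ∨ a = 1 ∨ a = 2 ∨ a = 3 ∨ a = 4 := by
  revert a; decide

variable {m : U →ₗ[K] U →ₗ[K] U} {E : U →ₗ[K] (ZMod 5 → K)}

theorem IsStandard.self (hE : IsStandard m E) (x : U) : m x x = 0 :=
  hE.inj (by rw [hE.mul, stdMul_self, map_zero])

theorem exists_eq_of_injective (hU : finrank K U = 4) (hinj : Function.Injective E)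
    (h0 : ∀ u, E u 0 = 0) {x : ZMod 5 → K} (hx : x 0 = 0) : ∃ u, E u = x := by
  have hfd : FiniteDimensional K U := FiniteDimensional.of_finrank_pos (by omega)
  let P : (ZMod 5 → K) →ₗ[K] K := LinearMap.proj 0
  have hrank : finrank K (LinearMap.ker P) = 4 := by
    have h1 := P.finrank_range_add_finrank_ker
    rw [LinearMap.range_eq_top.2 (LinearMap.proj_surjective 0), finrank_top, finrank_self,
      finrank_fintype_fun_eq_card, ZMod.card] at h1
    omega
  have hinj : Function.Injective (E.codRestrict (LinearMap.ker P) h0) := fun u v h =>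
    hinj (congrArg Subtype.val h)
  obtain ⟨u, hu⟩ := (LinearMap.injective_iff_surjective_of_finrank_eq_finrank
    (hU.trans hrank.symm)).1 hinj ⟨x, hx⟩
  exact ⟨u, congrArg Subtype.val hu⟩

theorem IsStandard.surj (hU : finrank K U = 4) (hE : IsStandard m E) {x : ZMod 5 → K}
    (hx : x 0 = 0) : ∃ u, E u = x :=
  exists_eq_of_injective hU hE.inj hE.zero hx

theorem IsStandard.exists_lift (hU : finrank K U = 4) (hE : IsStandard m E)
    (Θ : (ZMod 5 → K) →ₗ[K] (ZMod 5 → K)) (hΘ : Function.Injective Θ)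
    (h0 : ∀ x, x 0 = 0 → Θ x 0 = 0) : ∃ R : U ≃ₗ[K] U, ∀ u, E (R u) = Θ (E u) := by
  have hfd : FiniteDimensional K U := FiniteDimensional.of_finrank_pos (by omega)
  have hr : ∀ u, (Θ ∘ₗ E) u ∈ LinearMap.range E := fun u => hE.surj hU (h0 _ (hE.zero u))
  let R : U →ₗ[K] U := (LinearEquiv.ofInjective E hE.inj).symm.toLinearMap ∘ₗ
    (Θ ∘ₗ E).codRestrict (LinearMap.range E) hr
  have hR : ∀ u, E (R u) = Θ (E u) := fun u => by
    have := (LinearEquiv.ofInjective E hE.inj).apply_symm_apply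
      ((Θ ∘ₗ E).codRestrict (LinearMap.range E) hr u)
    exact congrArg Subtype.val this
  have hinj : Function.Injective R := fun u v h => hE.inj (hΘ (by rw [← hR, ← hR, h]))
  exact ⟨LinearEquiv.ofInjectiveEndo R hinj, hR⟩

theorem IsStandard.exists_relabel (hU : finrank K U = 4) (hE : IsStandard m E) {k : ZMod 5}
    (hk : k ≠ 0) : ∃ R : U ≃ₗ[K] U, (∀ u a, E (R u) a = E u (k * a)) ∧
      ∀ x y, R (m x y) = m (R x) (R y) := by
  obtain ⟨R, hR⟩ := hE.exists_lift hU (LinearMap.funLeft K K (fun a => k * a))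
    (LinearMap.funLeft_injective_of_surjective K K _
      (fun a => ⟨k⁻¹ * a, mul_inv_cancel_left₀ hk a⟩)) (fun x hx => by
        simp [LinearMap.funLeft_apply, hx])
  have hR' : ∀ u, E (R u) = fun a => E u (k * a) := hR
  refine ⟨R, fun u a => by rw [hR'], fun x y => hE.inj ?_⟩
  rw [hR', hE.mul, hE.mul, hR', hR', stdMul_comp_mul]

theorem IsStandard.eq_sum (hE : IsStandard m E) {e : ZMod 5 → U}
    (he : ∀ a, a ≠ 0 → E (e a) = Pi.single a 1) (u : U) :
    u = E u 2 • e 2 + E u 3 • e 3 + E u 1 • e 1 + E u 4 • e 4 := by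
  apply hE.inj
  rw [map_add, map_add, map_add, map_smul, map_smul, map_smul, map_smul, he 1 (by decide),
    he 2 (by decide), he 3 (by decide), he 4 (by decide)]
  funext a
  have h0 := hE.zero u
  rcases zmod_five_cases a with rfl | rfl | rfl | rfl | rfl <;>
    simp [h0, zmod_five_ne]

theorem linearIndependent_of_eq_single {e : ZMod 5 → U}
    (he : ∀ a, a ≠ 0 → E (e a) = Pi.single a 1) : LinearIndependent K ![e 2, e 3, e 1, e 4] := by
  refine linearIndependent_four_iff.2 fun s t r w h => ?_
  have h2 := congrArg E h
  rw [map_add, map_add, map_add, map_smul, map_smul, map_smul, map_smul, he 1 (by decide),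
    he 2 (by decide), he 3 (by decide), he 4 (by decide), map_zero] at h2
  refine ⟨?_, ?_, ?_, ?_⟩
  · have := congrFun h2 2
    simpa [Pi.single_apply, zmod_five_ne] using this
  · have := congrFun h2 3
    simpa [Pi.single_apply, zmod_five_ne] using this
  · have := congrFun h2 1
    simpa [Pi.single_apply, zmod_five_ne] using this
  · have := congrFun h2 4
    simpa [Pi.single_apply, zmod_five_ne] using this

theorem IsStandard.exists_basis (hU : finrank K U = 4) (hE : IsStandard m E) :
    ∃ e : ZMod 5 → U, ∀ a, a ≠ 0 → E (e a) = Pi.single a 1 := by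
  have : ∀ a : ZMod 5, ∃ u, a ≠ 0 → E u = Pi.single a 1 := fun a => by
    by_cases ha : a = 0
    · exact ⟨0, fun h => absurd ha h⟩
    · obtain ⟨u, hu⟩ := hE.surj hU (x := Pi.single a 1) (by simp [Ne.symm ha])
      exact ⟨u, fun _ => hu⟩
  choose e he using this
  exact ⟨e, he⟩

theorem stdMul_single_single {a b c : ZMod 5} (h : ∀ d, (2 * d = a ∧ 4 * d = b) ↔ d = c)
    (h' : ∀ d, ¬ (4 * d = a ∧ 2 * d = b)) :
    stdMul (Pi.single a (1 : K)) (Pi.single b 1) = Pi.single c 1 := by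
  funext d
  have h1 := h d
  have h2 := h' d
  simp only [stdMul, Pi.single_apply]
  by_cases hd : d = c
  · obtain ⟨ha, hb⟩ := h1.2 hd
    rw [if_pos ha, if_pos hb, if_pos hd]
    by_cases h4 : 4 * d = a
    · rw [if_neg (fun h => h2 ⟨h4, h⟩)]; ring
    · rw [if_neg h4]; ring
  · rw [if_neg hd]
    have e1 : (if 2 * d = a then (1 : K) else 0) * (if 4 * d = b then 1 else 0) = 0 := by
      by_cases ha : 2 * d = a
      · rw [if_neg (fun hb => hd (h1.1 ⟨ha, hb⟩)), mul_zero]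
      · rw [if_neg ha, zero_mul]
    have e2 : (if 4 * d = a then (1 : K) else 0) * (if 2 * d = b then 1 else 0) = 0 := by
      by_cases ha : 4 * d = a
      · rw [if_neg (fun hb => h2 ⟨ha, hb⟩), mul_zero]
      · rw [if_neg ha, zero_mul]
    rw [e1, e2, sub_zero]

theorem stdMul_single_neg (a : ZMod 5) :
    stdMul (Pi.single a (1 : K)) (Pi.single (-a) 1) = 0 := by
  funext d
  simp only [stdMul, Pi.single_apply, Pi.zero_apply]
  by_cases hd : d = 0
  · subst hd; simp
  · have e : ∀ a d : ZMod 5, d ≠ 0 → ¬ (2 * d = a ∧ 4 * d = -a) ∧ ¬ (4 * d = a ∧ 2 * d = -a) := by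
      decide
    obtain ⟨e1, e2⟩ := e a d hd
    by_cases ha : 2 * d = a
    · rw [if_pos ha, if_neg (fun h => e1 ⟨ha, h⟩)]
      by_cases hb : 4 * d = a
      · rw [if_neg (fun h => e2 ⟨hb, h⟩)]; simp
      · rw [if_neg hb]; simp
    · rw [if_neg ha]
      by_cases hb : 4 * d = a
      · rw [if_neg (fun h => e2 ⟨hb, h⟩)]; simp
      · rw [if_neg hb]; simp

/-- The multiplication table of a standard algebra. -/
theorem IsStandard.table (hE : IsStandard m E) {e : ZMod 5 → U}
    (he : ∀ a, a ≠ 0 → E (e a) = Pi.single a 1) :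
    m (e 2) (e 4) = e 1 ∧ m (e 4) (e 3) = e 2 ∧ m (e 1) (e 2) = e 3 ∧ m (e 3) (e 1) = e 4 ∧
      m (e 2) (e 3) = 0 ∧ m (e 1) (e 4) = 0 := by
  refine ⟨?_, ?_, ?_, ?_, ?_, ?_⟩ <;> apply hE.inj <;> rw [hE.mul]
  · rw [he 2 (by decide), he 4 (by decide), he 1 (by decide)]
    exact stdMul_single_single (by decide) (by decide)
  · rw [he 4 (by decide), he 3 (by decide), he 2 (by decide)]
    exact stdMul_single_single (by decide) (by decide)
  · rw [he 1 (by decide), he 2 (by decide), he 3 (by decide)]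
    exact stdMul_single_single (by decide) (by decide)
  · rw [he 3 (by decide), he 1 (by decide), he 4 (by decide)]
    exact stdMul_single_single (by decide) (by decide)
  · rw [he 2 (by decide), he 3 (by decide), map_zero]
    exact stdMul_single_neg 2
  · rw [he 1 (by decide), he 4 (by decide), map_zero]
    exact stdMul_single_neg 1

theorem IsStandard.isFrame (hE : IsStandard m E) {e : ZMod 5 → U}
    (he : ∀ a, a ≠ 0 → E (e a) = Pi.single a 1) : IsFrame m (e 2) (e 3) (e 1) (e 4) := by
  obtain ⟨h24, h43, h12, h31, h23, h14⟩ := hE.table he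
  have hsw := map_swap_of_alternating hE.self
  refine ⟨⟨linearIndependent_of_eq_single he, h23, h14⟩, ?_, ?_⟩
  · rw [hsw, h12]
    exact Submodule.neg_mem _ (Submodule.subset_span (by simp))
  · rw [hsw, h43]
    exact Submodule.neg_mem _ (Submodule.subset_span (by simp))

theorem IsStandard.spannedByProducts (hU : finrank K U = 4) (hE : IsStandard m E) :
    SpannedByProducts m := by
  intro W hW
  obtain ⟨e, he⟩ := hE.exists_basis hU
  obtain ⟨h24, h43, h12, h31, -, -⟩ := hE.table he
  rw [eq_top_iff]
  intro u _
  rw [hE.eq_sum he u]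
  refine add_mem (add_mem (add_mem ?_ ?_) ?_) ?_ <;> refine W.smul_mem _ ?_
  · rw [← h43]; exact hW _ _
  · rw [← h12]; exact hW _ _
  · rw [← h24]; exact hW _ _
  · rw [← h31]; exact hW _ _

theorem IsStandard.trace_eq_zero (hU : finrank K U = 4) (hE : IsStandard m E) (x : U) :
    LinearMap.trace K U (m x) = 0 := by
  obtain ⟨e, he⟩ := hE.exists_basis hU
  have key : ∀ a, a ≠ 0 → E (m x (e a)) a = 0 := fun a ha => by
    have h1 : ∀ a : ZMod 5, a ≠ 0 → 4 * a ≠ a ∧ 2 * a ≠ a := by decide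
    rw [hE.mul, he a ha]
    simp [stdMul, (h1 a ha).1, (h1 a ha).2]
  rw [trace_eq_of_linearIndependent_four hU (linearIndependent_of_eq_single he)
    (m x) (hE.eq_sum he _)
    (hE.eq_sum he _) (hE.eq_sum he _) (hE.eq_sum he _), key 2 (by decide), key 3 (by decide),
    key 1 (by decide), key 4 (by decide)]
  ring

theorem exists_addChar_eq_pow (z : AddChar (ZMod 5) K) (hz : z 1 ≠ 1) {c : K} (hc : c ^ 5 = 1) :
    ∃ j : ZMod 5, ∀ a : ZMod 5, c ^ a.val = z (j * a) := by
  have hz5 : z 1 ^ 5 = 1 := by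
    rw [← AddChar.map_nsmul_eq_pow, show (5 • (1 : ZMod 5)) = 0 by decide, AddChar.map_zero_eq_one]
  have hprim : IsPrimitiveRoot (z 1) 5 := by
    have h := IsPrimitiveRoot.orderOf (z 1)
    rwa [orderOf_eq_prime hz5 hz] at h
  obtain ⟨i, -, hi⟩ := hprim.eq_pow_of_pow_eq_one hc
  refine ⟨i, fun a => ?_⟩
  rw [← hi, ← pow_mul, ← AddChar.map_nsmul_eq_pow]
  congr 1
  simp

/-- Automorphisms of the standard algebra are monomial. -/
theorem IsStandard.exists_of_aut (hU : finrank K U = 4) (hE : IsStandard m E)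
    (z : AddChar (ZMod 5) K) (hz : z 1 ≠ 1) {g : U ≃ₗ[K] U}
    (hg : ∀ x y, g (m x y) = m (g x) (g y)) :
    ∃ j k : ZMod 5, k ≠ 0 ∧ ∀ u a, E (g u) a = z (j * a) * E u (k * a) := by
  obtain ⟨e, he⟩ := hE.exists_basis hU
  have hF := hE.isFrame he
  obtain ⟨T, hT, hTm⟩ := hE.exists_relabel hU (k := 2) (by decide)
  have hRe : ∀ {R : U ≃ₗ[K] U} {k : ZMod 5} (_ : ∀ u a, E (R u) a = E u (k * a)) {b c : ZMod 5}
      (_ : b ≠ 0) (_ : c ≠ 0) (_ : k ≠ 0), k * c = b → R (e b) = e c := by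
    intro R k hR b c hb hc hk hcb
    apply hE.inj
    funext a
    rw [hR, he b hb, he c hc, Pi.single_apply, Pi.single_apply]
    refine if_congr ?_ rfl rfl
    rw [← hcb, mul_right_inj' hk]
  have hT2 : T (e 2) = e 1 := hRe hT (by decide) (by decide) (by decide) (by decide)
  have hT3 : T (e 3) = e 4 := hRe hT (by decide) (by decide) (by decide) (by decide)
  have hsp : IsSpecial m (e 2) := hF.toTwoPlanes.isSpecial hE.self
    (Submodule.subset_span (by simp)) (hF.li.ne_zero 0) (Submodule.subset_span (by simp))
    (hF.li.ne_zero 2) hF.h₁₁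
  have hgsp := hsp.map (IsSemiAut.of_linearEquiv hg)
  obtain ⟨i, hi⟩ := hF.mem_span_of_isSpecial hU hE.self (hE.spannedByProducts hU)
    (hE.trace_eq_zero hU) (IsSemiAut.of_linearEquiv hTm)
    (by change Submodule.span K {T (e 2), T (e 3)} = _; rw [hT2, hT3]) hgsp
  have hline : ∃ b, b ≠ 0 ∧ g (e 2) ∈ Submodule.span K {e b} := by
    change g (e 2) ∈ Submodule.span K {![e 2, e 3, T (e 2), T (e 3)] i} at hi
    rw [hT2, hT3] at hi
    fin_cases i
    exacts [⟨2, by decide, hi⟩, ⟨3, by decide, hi⟩, ⟨1, by decide, hi⟩, ⟨4, by decide, hi⟩]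
  obtain ⟨b, hb, hgb⟩ := hline
  have h3 : ∀ b : ZMod 5, b ≠ 0 → 3 * b ≠ 0 ∧ 3 * b * 2 = b := by decide
  obtain ⟨R, hR, hRm⟩ := hE.exists_relabel hU (h3 b hb).1
  have hRb : R (e b) = e 2 := hRe hR hb (by decide) (h3 b hb).1 (h3 b hb).2
  have hg' : ∀ x y, (g.trans R) (m x y) = m ((g.trans R) x) ((g.trans R) y) := fun x y => by
    simp only [LinearEquiv.trans_apply, hg, hRm]
  have hg2 : (g.trans R) (e 2) ∈ Submodule.span K {e 2} := by
    have := (IsSemiAut.of_linearEquiv hRm).mem_span_singleton hgb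
    change R (g (e 2)) ∈ Submodule.span K {R (e b)} at this
    rwa [hRb] at this
  have hdiag : ∃ c : K, c ^ 5 = 1 ∧ ∀ u a, E ((g.trans R) u) a = c ^ a.val * E u a := by
    by_cases h1 : g.trans R = LinearEquiv.refl K U
    · exact ⟨1, one_pow _, fun u a => by rw [h1]; simp⟩
    · obtain ⟨c, hc, -, hv1, hu1, hu2, hv2, -⟩ := hF.weights hU hE.self (hE.spannedByProducts hU)
        (hE.trace_eq_zero hU) hg' h1 hg2
      refine ⟨c, hc, fun u a => ?_⟩
      conv_lhs => rw [hE.eq_sum he u]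
      simp only [map_add, map_smul, hv1, hu1, hu2, hv2, he 1 (by decide), he 2 (by decide),
        he 3 (by decide), he 4 (by decide)]
      have h0 := hE.zero u
      have v1 : (1 : ZMod 5).val = 1 := rfl
      have v2 : (2 : ZMod 5).val = 2 := rfl
      have v3 : (3 : ZMod 5).val = 3 := rfl
      have v4 : (4 : ZMod 5).val = 4 := rfl
      rcases zmod_five_cases a with rfl | rfl | rfl | rfl | rfl <;>
        simp [h0, v1, v2, v3, v4, zmod_five_ne, mul_comm]
  obtain ⟨c, hc, hcu⟩ := hdiag
  obtain ⟨j, hj⟩ := exists_addChar_eq_pow z hz hc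
  have hk : (3 * b)⁻¹ ≠ 0 := inv_ne_zero (h3 b hb).1
  refine ⟨j * (3 * b)⁻¹, (3 * b)⁻¹, hk, fun u a => ?_⟩
  have := hcu u ((3 * b)⁻¹ * a)
  rw [LinearEquiv.trans_apply, hR, mul_inv_cancel_left₀ (h3 b hb).1, hj] at this
  rw [this, mul_assoc]

end Standard

section Models

variable {p : ℕ} [Fact p.Prime] {K : Type*} [Field K] [IsAlgClosed K] [CharP K p]
  [Algebra (ZMod p) K]

variable (p) in
/-- The fixed points of a twisted Frobenius map on functions vanishing at `0`. -/
def IsTwisted (z : AddChar (ZMod 5) K) (l : ZMod 5) (x : ZMod 5 → K) : Prop :=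
  x 0 = 0 ∧ ∀ a, x (p * a) = z (l * a) * x a ^ p

/-- `X` identifies the rational vectors with a rational form of the functions vanishing at `0`. -/
structure IsCoord (z : AddChar (ZMod 5) K) (l : ZMod 5)
    (X : (Fin 4 → ZMod p) →ₗ[ZMod p] (ZMod 5 → K)) : Prop where
  li : LinearIndependent K (fun i => X (Pi.single i 1))
  twisted : ∀ v, IsTwisted p z l (X v)

/-- `X` identifies `f` with a rational form of the standard algebra. -/
structure IsModel (z : AddChar (ZMod 5) K) (l : ZMod 5)
    (f : (Fin 4 → ZMod p) →ₗ[ZMod p] (Fin 4 → ZMod p) →ₗ[ZMod p] (Fin 4 → ZMod p))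
    (X : (Fin 4 → ZMod p) →ₗ[ZMod p] (ZMod 5 → K)) : Prop extends IsCoord z l X where
  mul : ∀ u v, X (f u v) = stdMul (X u) (X v)

variable {z : AddChar (ZMod 5) K} {l : ZMod 5}
  {f f' : (Fin 4 → ZMod p) →ₗ[ZMod p] (Fin 4 → ZMod p) →ₗ[ZMod p] (Fin 4 → ZMod p)}
  {X X' : (Fin 4 → ZMod p) →ₗ[ZMod p] (ZMod 5 → K)}

omit [IsAlgClosed K] in
theorem finrank_fin_four : finrank K (Fin 4 → K) = 4 := by simp

omit [IsAlgClosed K] in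
theorem addChar_ne_zero (z : AddChar (ZMod 5) K) (a : ZMod 5) : z a ≠ 0 :=
  (z.val_isUnit a).ne_zero

omit [IsAlgClosed K] in
theorem addChar_injective (hz : z 1 ≠ 1) : Function.Injective z := by
  intro a b h
  by_contra hne
  apply hz
  have h1 : z (a - b) = 1 := by rw [AddChar.map_sub_eq_div, h, div_self (addChar_ne_zero z b)]
  have h2 : (1 : ZMod 5) = ((a - b)⁻¹).val • (a - b) := by
    rw [nsmul_eq_mul, ZMod.natCast_val, ZMod.cast_id, inv_mul_cancel₀ (sub_ne_zero.2 hne)]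
  rw [h2, AddChar.map_nsmul_eq_pow, h1, one_pow]

omit [Fact (Nat.Prime p)] [IsAlgClosed K] [CharP K p] [Algebra (ZMod p) K] in
theorem addChar_pow_char (a : ZMod 5) : z a ^ p = z (p * a) := by
  rw [← AddChar.map_nsmul_eq_pow, nsmul_eq_mul]

omit [IsAlgClosed K] [Algebra (ZMod p) K] in
theorem IsTwisted.stdMul {x y : ZMod 5 → K} (hx : IsTwisted p z l x) (hy : IsTwisted p z l y) :
    IsTwisted p z l (stdMul x y) := by
  refine ⟨by simp [_root_.stdMul, hx.1], fun a => ?_⟩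
  have h : z (l * a) = z (l * (2 * a)) * z (l * (4 * a)) := by
    rw [← AddChar.map_add_eq_mul]
    congr 1
    have : ∀ l a : ZMod 5, l * a = l * (2 * a) + l * (4 * a) := by decide
    exact this l a
  simp only [_root_.stdMul, mul_left_comm _ (p : ZMod 5), hx.2, hy.2, h]
  rw [sub_pow_char, mul_pow, mul_pow]
  ring

namespace IsCoord

omit [IsAlgClosed K] [CharP K p] in
theorem ratExtend_zero (h : IsCoord z l X) (u : Fin 4 → K) : ratExtend X u 0 = 0 := by
  rw [ratExtend_apply, Finset.sum_apply]
  exact Finset.sum_eq_zero fun i _ => by rw [Pi.smul_apply, (h.twisted _).1, smul_zero]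

omit [IsAlgClosed K] [CharP K p] in
theorem ratExtend_injective (h : IsCoord z l X) :
    Function.Injective (ratExtend (K := K) X) := by
  rw [← LinearMap.ker_eq_bot, LinearMap.ker_eq_bot']
  intro u hu
  rw [ratExtend_apply] at hu
  exact funext (Fintype.linearIndependent_iff.1 h.li u hu)

omit [IsAlgClosed K] [CharP K p] in
theorem injective (h : IsCoord z l X) : Function.Injective X := fun v w e => by
  apply ratVec_injective (K := K)
  apply h.ratExtend_injective
  rw [ratExtend_ratVec, ratExtend_ratVec, e]

theorem ratExtend_frobVec (h : IsCoord z l X) (u : Fin 4 → K) (a : ZMod 5) :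
    ratExtend X (frobVec p K u) (p * a) = z (l * a) * ratExtend X u a ^ p := by
  rw [ratExtend_apply, ratExtend_apply, Finset.sum_apply, Finset.sum_apply, sum_pow_char,
    Finset.mul_sum]
  refine Finset.sum_congr rfl fun i _ => ?_
  rw [Pi.smul_apply, Pi.smul_apply, (h.twisted _).2, smul_eq_mul, smul_eq_mul, mul_pow,
    frobVec_apply]
  ring

theorem exists_eq (hp5 : (p : ZMod 5) ≠ 0) (h : IsCoord z l X) {x : ZMod 5 → K}
    (hx : IsTwisted p z l x) : ∃ v, X v = x := by
  obtain ⟨u, hu⟩ := exists_eq_of_injective finrank_fin_four h.ratExtend_injective h.ratExtend_zero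
    hx.1
  have hfix : frobVec p K u = u := by
    apply h.ratExtend_injective
    funext a
    have := h.ratExtend_frobVec u ((p : ZMod 5)⁻¹ * a)
    rwa [mul_inv_cancel_left₀ hp5, hu, ← hx.2, mul_inv_cancel_left₀ hp5, ← hu] at this
  have hrat : ∀ i, ∃ b : ZMod p, algebraMap (ZMod p) K b = u i := fun i =>
    exists_algebraMap_eq (congrFun hfix i)
  choose v hv using hrat
  refine ⟨v, ?_⟩
  rw [← hu, ← ratExtend_ratVec (K := K)]
  exact congrArg _ (funext hv)

omit [IsAlgClosed K] [CharP K p] in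
theorem exists_apply_ne_zero (h : IsCoord z l X) {a : ZMod 5} (ha : a ≠ 0) : ∃ v, X v a ≠ 0 := by
  by_contra! h0
  obtain ⟨u, hu⟩ := exists_eq_of_injective finrank_fin_four h.ratExtend_injective h.ratExtend_zero
    (x := Pi.single a 1) (by simp [Ne.symm ha])
  have := congrFun hu a
  rw [ratExtend_apply, Finset.sum_apply, Finset.sum_eq_zero fun i _ => by
    rw [Pi.smul_apply, h0, smul_zero]] at this
  simp at this

end IsCoord

variable (K) in
/-- The standard product as a bilinear map. -/
def stdMulHom : (ZMod 5 → K) →ₗ[K] (ZMod 5 → K) →ₗ[K] (ZMod 5 → K) :=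
  LinearMap.mk₂ K stdMul
    (fun x y w => by funext a; simp only [stdMul, Pi.add_apply]; ring)
    (fun c x y => by funext a; simp only [stdMul, Pi.smul_apply, smul_eq_mul]; ring)
    (fun x y w => by funext a; simp only [stdMul, Pi.add_apply]; ring)
    (fun c x y => by funext a; simp only [stdMul, Pi.smul_apply, smul_eq_mul]; ring)

namespace IsModel

omit [IsAlgClosed K] [CharP K p] in
theorem isStandard (h : IsModel z l f X) : IsStandard (ratMul f) (ratExtend (K := K) X) := by
  refine ⟨h.ratExtend_injective, h.ratExtend_zero, fun u v => ?_⟩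
  have := ratMul_eq (f := f) (E := ratExtend (K := K) X)
    (B := (stdMulHom K).compl₁₂ (ratExtend X) (ratExtend X)) (fun v w => by
      simp only [LinearMap.compl₁₂_apply, ratExtend_ratVec]
      exact h.mul v w) u v
  rw [LinearMap.compl₁₂_apply] at this
  exact this

omit [IsAlgClosed K] [CharP K p] in
theorem self (h : IsModel z l f X) (x : Fin 4 → ZMod p) : f x x = 0 :=
  h.injective (by rw [h.mul, stdMul_self, map_zero])

omit [IsAlgClosed K] [CharP K p] in
theorem ne_zero (h : IsModel z l f X) : f ≠ 0 := by
  rintro rfl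
  obtain ⟨e, he⟩ := h.isStandard.exists_basis finrank_fin_four
  obtain ⟨h1, -⟩ := h.isStandard.table he
  have h2 := congrArg (ratExtend (K := K) X) h1
  rw [he 1 (by decide), ratMul_apply] at h2
  have := congrFun h2 1
  simp at this

theorem exists_iso (hp5 : (p : ZMod 5) ≠ 0) (h : IsModel z l f X) (h' : IsModel z l f' X') :
    ∃ e : (Fin 4 → ZMod p) ≃ₗ[ZMod p] (Fin 4 → ZMod p), (∀ v, X' (e v) = X v) ∧
      ∀ u v, e (f u v) = f' (e u) (e v) := by
  have hr : LinearMap.range X = LinearMap.range X' := by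
    ext x
    constructor
    · rintro ⟨v, rfl⟩; exact h'.exists_eq hp5 (h.twisted v)
    · rintro ⟨v, rfl⟩; exact h.exists_eq hp5 (h'.twisted v)
  have he : ∃ e : (Fin 4 → ZMod p) ≃ₗ[ZMod p] (Fin 4 → ZMod p), ∀ v, X' (e v) = X v := by
    refine ⟨((LinearEquiv.ofInjective X h.injective).trans (LinearEquiv.ofEq _ _ hr)).trans
      (LinearEquiv.ofInjective X' h'.injective).symm, fun v => ?_⟩
    exact congrArg Subtype.val ((LinearEquiv.ofInjective X' h'.injective).apply_symm_apply
      (LinearEquiv.ofEq _ _ hr (LinearEquiv.ofInjective X h.injective v)))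
  obtain ⟨e, he⟩ := he
  refine ⟨e, he, fun u v => h'.injective ?_⟩
  rw [he, h.mul, h'.mul, he, he]

end IsModel

/-- The monomial maps on functions. -/
def twistMap (z : AddChar (ZMod 5) K) (j k : ZMod 5) : (ZMod 5 → K) →ₗ[K] (ZMod 5 → K) where
  toFun x a := z (j * a) * x (k * a)
  map_add' x y := by funext a; simp only [Pi.add_apply]; ring
  map_smul' c x := by funext a; simp only [Pi.smul_apply, smul_eq_mul, RingHom.id_apply]; ring

omit [IsAlgClosed K] in
theorem twistMap_apply (j k : ZMod 5) (x : ZMod 5 → K) (a : ZMod 5) :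
    twistMap z j k x a = z (j * a) * x (k * a) := rfl

omit [IsAlgClosed K] in
theorem twistMap_injective (j : ZMod 5) {k : ZMod 5} (hk : k ≠ 0) :
    Function.Injective (twistMap z j k) := fun x y h => by
  funext a
  have := congrFun h (k⁻¹ * a)
  rw [twistMap_apply, twistMap_apply, mul_inv_cancel_left₀ hk] at this
  exact mul_left_cancel₀ (addChar_ne_zero z _) this

omit [IsAlgClosed K] in
theorem stdMul_twistMap (j k : ZMod 5) (x y : ZMod 5 → K) :
    stdMul (twistMap z j k x) (twistMap z j k y) = twistMap z j k (stdMul x y) := by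
  have h := stdMul_twist z (fun a => x (k * a)) (fun a => y (k * a)) j
  rw [stdMul_comp_mul] at h
  exact h

omit [CharP K p] in
omit [IsAlgClosed K] in
theorem IsModel.twist (h : IsModel z l f X) (j : ZMod 5) {k : ZMod 5} (hk : k ≠ 0) :
    IsModel z (l * k) f ((twistMap z j k).restrictScalars (ZMod p) ∘ₗ X) := by
  refine ⟨⟨h.li.map' (twistMap z j k) (LinearMap.ker_eq_bot.2 (twistMap_injective j hk)),
    fun v => ⟨?_, fun a => ?_⟩⟩, fun u v => ?_⟩
  · change z (j * 0) * X v (k * 0) = 0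
    rw [mul_zero k, (h.twisted v).1, mul_zero]
  · change z (j * (p * a)) * X v (k * (p * a)) = z (l * k * a) * (z (j * a) * X v (k * a)) ^ p
    rw [mul_left_comm k, (h.twisted v).2, mul_pow, addChar_pow_char, mul_left_comm j, mul_assoc l]
    ring
  · change twistMap z j k (X (f u v)) = stdMul (twistMap z j k (X u)) (twistMap z j k (X v))
    rw [h.mul, stdMul_twistMap]

theorem IsModel.exists_aut (hp5 : (p : ZMod 5) ≠ 0) (h : IsModel z l f X) (j : ZMod 5) {k : ZMod 5}
    (hk : k ≠ 0) (hlk : l * k = l) : ∃ g ∈ algAut f, ∀ v, X (g v) = twistMap z j k (X v) := by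
  have h' := h.twist j hk
  rw [hlk] at h'
  obtain ⟨e, he, hm⟩ := h'.exists_iso hp5 h
  exact ⟨e, hm, he⟩

omit [IsAlgClosed K] [CharP K p] in
theorem IsModel.exists_of_aut (hz : z 1 ≠ 1) (h : IsModel z l f X)
    {g : (Fin 4 → ZMod p) ≃ₗ[ZMod p] (Fin 4 → ZMod p)} (hg : g ∈ algAut f) :
    ∃ j k, k ≠ 0 ∧ l * k = l ∧ ∀ v, X (g v) = twistMap z j k (X v) := by
  obtain ⟨j, k, hk, hgu⟩ := h.isStandard.exists_of_aut finrank_fin_four z hz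
    (ratEquiv_mul (K := K) hg)
  have hgv : ∀ v, X (g v) = twistMap z j k (X v) := fun v => by
    funext a
    have := hgu (ratVec K v) a
    rwa [ratEquiv_ratVec, ratExtend_ratVec, ratExtend_ratVec] at this
  refine ⟨j, k, hk, ?_, hgv⟩
  obtain ⟨v, hv⟩ := h.exists_apply_ne_zero (a := k * 1) (by simpa using hk)
  have h1 := (h.twisted (g v)).2 1
  rw [hgv, twistMap_apply, twistMap_apply, mul_left_comm k, (h.twisted v).2, mul_pow,
    addChar_pow_char, mul_left_comm j] at h1
  have h2 : z (l * (k * 1)) = z (l * 1) := by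
    have h3 : z (p * (j * 1)) * X v (k * 1) ^ p ≠ 0 :=
      mul_ne_zero (addChar_ne_zero z _) (pow_ne_zero _ hv)
    apply mul_right_cancel₀ h3
    linear_combination h1
  simpa using addChar_injective hz h2

theorem card_monomial_zero :
    Nat.card {q : ZMod 5 × ZMod 5 // q.2 ≠ 0 ∧ (0 : ZMod 5) * q.2 = 0} = 20 := by
  rw [Nat.card_eq_fintype_card]; decide

theorem card_monomial_ne_zero (hl : l ≠ 0) :
    Nat.card {q : ZMod 5 × ZMod 5 // q.2 ≠ 0 ∧ l * q.2 = l} = 5 := by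
  rw [Nat.card_eq_fintype_card]; revert hl; revert l; decide

theorem IsModel.card_algAut (hp5 : (p : ZMod 5) ≠ 0) (hz : z 1 ≠ 1) (h : IsModel z l f X) :
    Nat.card (algAut f) = Nat.card {q : ZMod 5 × ZMod 5 // q.2 ≠ 0 ∧ l * q.2 = l} := by
  have hex : ∀ q : {q : ZMod 5 × ZMod 5 // q.2 ≠ 0 ∧ l * q.2 = l},
      ∃ g : algAut f, ∀ v, X (g.1 v) = twistMap z q.1.1 q.1.2 (X v) := fun q => by
    obtain ⟨g, hg, hgv⟩ := h.exists_aut hp5 q.1.1 q.2.1 q.2.2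
    exact ⟨⟨g, hg⟩, hgv⟩
  choose G hG using hex
  refine (Nat.card_congr (Equiv.ofBijective G ⟨?_, ?_⟩)).symm
  · rintro ⟨⟨j, k⟩, hk, hlk⟩ ⟨⟨j', k'⟩, hk', hlk'⟩ e
    have h1 : ∀ v, twistMap z j k (X v) = twistMap z j' k' (X v) := fun v => by
      have h2 := hG ⟨⟨j, k⟩, hk, hlk⟩ v
      rw [e, hG] at h2
      exact h2.symm
    have h2 : twistMap z j k ∘ₗ ratExtend X = twistMap z j' k' ∘ₗ ratExtend X := by
      refine linearMap_ext_rat (p := p) fun v => ?_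
      rw [LinearMap.comp_apply, LinearMap.comp_apply, ratExtend_ratVec, h1]
    obtain ⟨u, hu⟩ := h.isStandard.surj finrank_fin_four (x := Pi.single k 1)
      (by simp [Ne.symm hk])
    have h3 := congrFun (LinearMap.congr_fun h2 u) 1
    rw [LinearMap.comp_apply, LinearMap.comp_apply, hu, twistMap_apply, twistMap_apply] at h3
    have hkk : k' = k := by
      by_contra hne
      simp [hne, addChar_ne_zero] at h3
    subst hkk
    have h4 : z j = z j' := by simpa using h3
    have := addChar_injective hz h4
    subst this
    rfl
  · rintro ⟨g, hg⟩
    obtain ⟨j, k, hk, hlk, hgv⟩ := h.exists_of_aut hz hg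
    refine ⟨⟨⟨j, k⟩, hk, hlk⟩, Subtype.ext (LinearEquiv.ext fun v => h.injective ?_)⟩
    rw [hG, hgv]

end Models

section Classification

variable {p : ℕ} [Fact p.Prime] {K : Type*} [Field K] [IsAlgClosed K] [CharP K p]
  [Algebra (ZMod p) K] {z : AddChar (ZMod 5) K} {l : ZMod 5}
  {f f' : (Fin 4 → ZMod p) →ₗ[ZMod p] (Fin 4 → ZMod p) →ₗ[ZMod p] (Fin 4 → ZMod p)}
  {X X' : (Fin 4 → ZMod p) →ₗ[ZMod p] (ZMod 5 → K)}

theorem exists_pow_mul_eq {q : ZMod 5} (hq : q = 2 ∨ q = 3) {b c : ZMod 5} (hb : b ≠ 0)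
    (hc : c ≠ 0) : ∃ i : Fin 4, q ^ i.val * b = c := by
  revert hq hb hc; revert q b c; decide

omit [IsAlgClosed K] in
theorem sum_addChar_mul (hz : z 1 ≠ 1) (d : ZMod 5) :
    ∑ j, z (j * d) = if d = 0 then (5 : K) else 0 := by
  have hz1 : z ≠ 1 := fun h => hz (by rw [h]; rfl)
  have := AddChar.sum_mulShift d (AddChar.IsPrimitive.of_ne_one hz1)
  rw [this]
  split_ifs <;> simp

theorem IsModel.autIrreducible (hp5 : (p : ZMod 5) ≠ 0) (hz : z 1 ≠ 1)
    (hl : l = 0 ∨ (p : ZMod 5) = 2 ∨ (p : ZMod 5) = 3) (h : IsModel z l f X) :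
    AutIrreducible f := by
  intro W hW
  by_contra! hcon
  obtain ⟨hbot, htop⟩ := hcon
  obtain ⟨w, hw, hw0⟩ := Submodule.exists_mem_ne_zero_of_ne_bot hbot
  obtain ⟨L, hL0, hL⟩ := Submodule.exists_le_ker_of_lt_top W (lt_top_iff_ne_top.2 htop)
  have hE := h.isStandard
  obtain ⟨e, he⟩ := hE.exists_basis finrank_fin_four
  have h5 : (5 : K) ≠ 0 := fun h0 => by
    have : p ∣ 5 := (CharP.cast_eq_zero_iff K p 5).1 (by exact_mod_cast h0)
    have := (Nat.prime_dvd_prime_iff_eq Fact.out Fact.out).1 this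
    subst this
    exact hp5 (by decide)
  set M : (Fin 4 → ZMod p) →ₗ[ZMod p] K := Algebra.linearMap (ZMod p) K ∘ₗ L with hM
  have hMW : ∀ w ∈ W, M w = 0 := fun w hw => by
    have : L w = 0 := hL hw
    rw [hM, LinearMap.comp_apply, this, map_zero]
  have hkill : ∀ b, b ≠ 0 → (∃ w ∈ W, X w b ≠ 0) → ratExtend M (e b) = 0 := by
    rintro b hb ⟨w, hw, hwb⟩
    choose g hg hgX using fun j => h.exists_aut hp5 j (k := 1) one_ne_zero (mul_one l)
    have h1 : ∑ j, z (j * (-b)) • ratVec K (g j w) = (5 * X w b) • e b := by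
      apply hE.inj
      rw [map_sum, map_smul, he b hb]
      funext a
      rw [Finset.sum_apply]
      have h2 : ∀ j, ratExtend X (z (j * (-b)) • ratVec K (g j w)) a = z (j * (a - b)) * X w a :=
        fun j => by
          rw [map_smul, ratExtend_ratVec, hgX, Pi.smul_apply, twistMap_apply, one_mul, smul_eq_mul,
            ← mul_assoc, ← AddChar.map_add_eq_mul]
          congr 2
          ring
      rw [Finset.sum_congr rfl fun j _ => h2 j, ← Finset.sum_mul, sum_addChar_mul hz]
      by_cases hab : a = b
      · subst hab; simp
      · simp [hab, sub_eq_zero]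
    have h2 := congrArg (ratExtend M) h1
    rw [map_sum, map_smul, Finset.sum_eq_zero fun j _ => by
      rw [map_smul, ratExtend_ratVec, hMW _ (hW _ (hg j) _ hw), smul_zero]] at h2
    exact (smul_eq_zero.1 h2.symm).resolve_left (mul_ne_zero h5 hwb)
  have hne : ∃ b, b ≠ 0 ∧ X w b ≠ 0 := by
    by_contra! h0
    refine hw0 (h.injective ?_)
    rw [map_zero]
    funext b
    by_cases hb : b = 0
    · subst hb; exact (h.twisted w).1
    · exact h0 b hb
  obtain ⟨b, hb, hwb⟩ := hne
  have hall : ∀ c, c ≠ 0 → ∃ w ∈ W, X w c ≠ 0 := by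
    intro c hc
    rcases hl with rfl | hq
    · obtain ⟨g, hg, hgX⟩ := h.exists_aut hp5 0 (k := b * c⁻¹) (mul_ne_zero hb (inv_ne_zero hc))
        (zero_mul _)
      refine ⟨g w, hW g hg w hw, ?_⟩
      rw [hgX, twistMap_apply, mul_assoc, inv_mul_cancel₀ hc, mul_one]
      exact mul_ne_zero (addChar_ne_zero z _) hwb
    · obtain ⟨i, rfl⟩ := exists_pow_mul_eq hq hb hc
      refine ⟨w, hw, ?_⟩
      have : ∀ n : ℕ, X w ((p : ZMod 5) ^ n * b) ≠ 0 := fun n => by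
        induction n with
        | zero => simpa using hwb
        | succ n ih =>
          rw [pow_succ', mul_assoc, (h.twisted w).2]
          exact mul_ne_zero (addChar_ne_zero z _) (pow_ne_zero _ ih)
      exact this i
  have hM0 : ∀ u : Fin 4 → K, ratExtend M u = 0 := fun u => by
    rw [hE.eq_sum he u, map_add, map_add, map_add, map_smul, map_smul, map_smul, map_smul,
      hkill 1 (by decide) (hall 1 (by decide)), hkill 2 (by decide) (hall 2 (by decide)),
      hkill 3 (by decide) (hall 3 (by decide)), hkill 4 (by decide) (hall 4 (by decide))]
    simp
  apply hL0
  refine LinearMap.ext fun v => ?_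
  apply (algebraMap (ZMod p) K).injective
  have := hM0 (ratVec K v)
  rw [ratExtend_ratVec] at this
  rw [LinearMap.zero_apply, map_zero]
  exact this

theorem exists_isModel_of_ne_zero (hz : z 1 ≠ 1) (hp5 : (p : ZMod 5) ≠ 0) {θ : ZMod 5 → K}
    (hθ : IsTwisted p z l θ)
    (hθ0 : ∀ a, a ≠ 0 → θ a ≠ 0) :
    ∃ (f : _) (X : (Fin 4 → ZMod p) →ₗ[ZMod p] (ZMod 5 → K)), IsModel z l f X := by
  let X : (Fin 4 → ZMod p) →ₗ[ZMod p] (ZMod 5 → K) :=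
    { toFun := fun v a => θ a * ∑ i : Fin 4, algebraMap (ZMod p) K (v i) * z a ^ i.val
      map_add' := fun v w => by
        funext a
        simp only [Pi.add_apply, map_add, add_mul, Finset.sum_add_distrib, mul_add]
      map_smul' := fun c v => by
        funext a
        simp only [Pi.smul_apply, smul_eq_mul, map_mul, RingHom.id_apply, Algebra.smul_def,
          mul_assoc, ← Finset.mul_sum]
        ring }
  have hX : ∀ v a, X v a = θ a * ∑ i : Fin 4, algebraMap (ZMod p) K (v i) * z a ^ i.val :=
    fun _ _ => rfl
  have hXs : ∀ (i : Fin 4) a, X (Pi.single i 1) a = θ a * z a ^ i.val := fun i a => by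
    rw [hX, Finset.sum_eq_single i]
    · simp
    · intro j _ hj; simp [hj]
    · simp
  have hc : IsCoord z l X := by
    refine ⟨?_, fun v => ⟨by rw [hX, hθ.1, zero_mul], fun a => ?_⟩⟩
    · rw [Fintype.linearIndependent_iff]
      intro c hc
      have h1 : (Matrix.vandermonde fun i : Fin 4 => z (i.val + 1 : ℕ)).mulVec c = 0 := by
        funext i
        have hi : ((i.val + 1 : ℕ) : ZMod 5) ≠ 0 := by revert i; decide
        have h2 := congrFun hc (i.val + 1 : ℕ)
        simp only [Finset.sum_apply, Pi.smul_apply, hXs, smul_eq_mul, Pi.zero_apply] at h2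
        rw [Matrix.mulVec, dotProduct, Pi.zero_apply]
        simp only [Matrix.vandermonde_apply]
        apply mul_left_cancel₀ (hθ0 _ hi)
        rw [mul_zero, ← h2, Finset.mul_sum]
        exact Finset.sum_congr rfl fun j _ => by ring
      have h3 := Matrix.eq_zero_of_mulVec_eq_zero (Matrix.det_vandermonde_ne_zero_iff.2 ?_) h1
      · exact congrFun h3
      · intro i j hij
        have hinj : ∀ i j : Fin 4, ((i.val + 1 : ℕ) : ZMod 5) = ((j.val + 1 : ℕ) : ZMod 5) →
          i = j := by decide
        exact hinj i j (addChar_injective hz hij)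
    · rw [hX, hX, hθ.2, mul_pow, sum_pow_char, ← mul_assoc]
      congr 1
      refine Finset.sum_congr rfl fun i _ => ?_
      rw [mul_pow, algebraMap_pow_char, ← addChar_pow_char, ← pow_mul, ← pow_mul, mul_comm p]
  choose F hF using fun u v => hc.exists_eq hp5 ((hc.twisted u).stdMul (hc.twisted v))
  refine ⟨LinearMap.mk₂ (ZMod p) F (fun u v w => hc.injective ?_) (fun c u v => hc.injective ?_)
    (fun u v w => hc.injective ?_) (fun c u v => hc.injective ?_), X, hc, fun u v => hF u v⟩
  · rw [map_add, hF, hF, hF, map_add]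
    funext a; simp only [stdMul, Pi.add_apply]; ring
  · rw [map_smul, hF, hF, map_smul]
    funext a; simp only [stdMul, Pi.smul_apply, Algebra.smul_def]; ring
  · rw [map_add, hF, hF, hF, map_add]
    funext a; simp only [stdMul, Pi.add_apply]; ring
  · rw [map_smul, hF, hF, map_smul]
    funext a; simp only [stdMul, Pi.smul_apply, Algebra.smul_def]; ring

theorem exists_isModel_zero (hz : z 1 ≠ 1) (hp5 : (p : ZMod 5) ≠ 0) :
    ∃ (f : _) (X : (Fin 4 → ZMod p) →ₗ[ZMod p] (ZMod 5 → K)), IsModel z 0 f X := by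
  refine exists_isModel_of_ne_zero hz hp5 (θ := fun a => if a = 0 then 0 else 1)
    ⟨by simp, fun a => ?_⟩
    fun a ha => by simp [ha]
  by_cases ha : a = 0
  · simp [ha, (Fact.out : p.Prime).ne_zero]
  · simp [ha, hp5]

theorem exists_isModel (hz : z 1 ≠ 1) (hp : (p : ZMod 5) = 2 ∨ (p : ZMod 5) = 3) (l : ZMod 5) :
    ∃ (f : _) (X : (Fin 4 → ZMod p) →ₗ[ZMod p] (ZMod 5 → K)), IsModel z l f X := by
  have hp0 := (Fact.out : p.Prime).ne_zero
  have h1p : 1 < p ^ 4 := Nat.one_lt_pow (by norm_num) (Fact.out : p.Prime).one_lt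
  have hroot : ∀ c : K, c ≠ 0 → ∃ t : K, t ≠ 0 ∧ c * t ^ p ^ 4 = t := fun c hc => by
    obtain ⟨t, ht⟩ := IsAlgClosed.exists_pow_nat_eq c⁻¹ (n := p ^ 4 - 1) (by omega)
    refine ⟨t, ?_, ?_⟩
    · rintro rfl
      rw [zero_pow (by omega)] at ht
      exact inv_ne_zero hc ht.symm
    · rw [← Nat.sub_add_cancel h1p.le, pow_succ, ht, mul_inv_cancel_left₀ hc]
  have hz0 := addChar_ne_zero z
  have hz2 : ∀ a b c : ZMod 5, a + p * b = c → ∀ t : K,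
      z a * (z b * t) ^ p = z c * t ^ p := fun a b c h t => by
    rw [mul_pow, addChar_pow_char, ← mul_assoc, ← AddChar.map_add_eq_mul, h]
  have hp5 : (p : ZMod 5) ≠ 0 := by rcases hp with hp | hp <;> rw [hp] <;> decide
  have h5 : (5 : ZMod 5) = 0 := rfl
  rcases hp with hp | hp
  · obtain ⟨t, ht0, ht⟩ := hroot (z (2 * l)) (hz0 _)
    let θ : Fin 5 → K := ![0, t, z l * t ^ p, z (2 * l) * t ^ p ^ 3, z (4 * l) * t ^ p ^ 2]
    refine exists_isModel_of_ne_zero hz hp5 (θ := θ) ⟨rfl, fun a => ?_⟩ fun a ha => ?_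
    · rw [hp]
      rcases zmod_five_cases a with rfl | rfl | rfl | rfl | rfl
      · change (0 : K) = _ * 0 ^ p
        rw [zero_pow hp0, mul_zero]
      · change z l * t ^ p = z (l * 1) * t ^ p
        rw [mul_one]
      · change z (4 * l) * t ^ p ^ 2 = z (l * 2) * (z l * t ^ p) ^ p
        rw [hz2 _ _ (4 * l) (by rw [hp]; ring), ← pow_mul, ← sq]
      · change t = z (l * 3) * (z (2 * l) * t ^ p ^ 3) ^ p
        rw [hz2 _ _ (2 * l) (by rw [hp]; linear_combination l * h5), ← pow_mul,
          ← pow_succ, ht]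
      · change z (2 * l) * t ^ p ^ 3 = z (l * 4) * (z (4 * l) * t ^ p ^ 2) ^ p
        rw [hz2 _ _ (2 * l) (by rw [hp]; linear_combination 2 * l * h5), ← pow_mul,
          ← pow_succ]
    · rcases zmod_five_cases a with rfl | rfl | rfl | rfl | rfl
      · exact absurd rfl ha
      · exact ht0
      all_goals exact mul_ne_zero (hz0 _) (pow_ne_zero _ ht0)
  · obtain ⟨t, ht0, ht⟩ := hroot (z (3 * l)) (hz0 _)
    let θ : Fin 5 → K := ![0, t, z (2 * l) * t ^ p ^ 3, z l * t ^ p, z l * t ^ p ^ 2]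
    refine exists_isModel_of_ne_zero hz hp5 (θ := θ) ⟨rfl, fun a => ?_⟩ fun a ha => ?_
    · rw [hp]
      rcases zmod_five_cases a with rfl | rfl | rfl | rfl | rfl
      · change (0 : K) = _ * 0 ^ p
        rw [zero_pow hp0, mul_zero]
      · change z l * t ^ p = z (l * 1) * t ^ p
        rw [mul_one]
      · change t = z (l * 2) * (z (2 * l) * t ^ p ^ 3) ^ p
        rw [hz2 _ _ (3 * l) (by rw [hp]; linear_combination l * h5), ← pow_mul, ← pow_succ, ht]
      · change z l * t ^ p ^ 2 = z (l * 3) * (z l * t ^ p) ^ p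
        rw [hz2 _ _ l (by rw [hp]; linear_combination l * h5), ← pow_mul,
          ← sq]
      · change z (2 * l) * t ^ p ^ 3 = z (l * 4) * (z l * t ^ p ^ 2) ^ p
        rw [hz2 _ _ (2 * l) (by rw [hp]; linear_combination l * h5), ← pow_mul,
          ← pow_succ]
    · rcases zmod_five_cases a with rfl | rfl | rfl | rfl | rfl
      · exact absurd rfl ha
      · exact ht0
      all_goals exact mul_ne_zero (hz0 _) (pow_ne_zero _ ht0)

theorem ratEquiv_frobVec (g : (Fin 4 → ZMod p) ≃ₗ[ZMod p] (Fin 4 → ZMod p)) (u : Fin 4 → K) :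
    ratEquiv g (frobVec p K u) = frobVec p K (ratEquiv g u) := by
  have h : ∀ x : Fin 4 → K, ratEquiv g x = ∑ i, x i • ratVec K (g (Pi.single i 1)) := fun x => by
    conv_lhs => rw [← (Pi.basisFun K (Fin 4)).sum_repr x, map_sum]
    refine Finset.sum_congr rfl fun i _ => ?_
    rw [map_smul, Pi.basisFun_apply, Pi.basisFun_repr, ← ratVec_single (p := p), ratEquiv_ratVec]
  rw [h, h, map_sum]
  exact Finset.sum_congr rfl fun i _ => by rw [frobVec_smul, frobVec_ratVec, frobVec_apply]

variable (K) in
theorem AutIrreducible.exists_isStandard (halt : ∀ x, f x x = 0) (hf : f ≠ 0)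
    (hirr : AutIrreducible f) : ∃ c : K, c ^ 5 = 1 ∧ c ≠ 1 ∧
      ∃ E, IsStandard (ratMul f (K := K)) E ∧ ∃ G : (Fin 4 → K) ≃ₗ[K] (Fin 4 → K),
        (∀ u, G (frobVec p K u) = frobVec p K (G u)) ∧ ∀ u a, E (G u) a = c ^ a.val * E u a := by
  have h4 : finrank (ZMod p) (Fin 4 → ZMod p) = 4 := by simp
  have : Finite (algAut f) :=
    have : Finite ((Fin 4 → ZMod p) ≃ₗ[ZMod p] (Fin 4 → ZMod p)) := DFunLike.finite _
    inferInstance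
  obtain ⟨i, j, c, hc, hc1, E, hE, hEg⟩ := (hirr.semiIrreducible (K := K)).exists_isStandard
    finrank_fin_four (ratMul_self halt) (ratMul_ne_zero hf)
    (trace_ratMul fun x => hirr.trace_eq_zero (by rw [h4]; norm_num) x)
    (ι := algAut f) (by have := hirr.finrank_lt_card (by rw [h4]; norm_num); omega)
    (s := fun g => ratEquiv g.1) (fun g h e => Subtype.ext (ratEquiv_injective e))
    (fun g => ratEquiv_mul g.2)
  refine ⟨c, hc, hc1, E, hE, _, fun u => ?_, hEg⟩
  rw [LinearEquiv.trans_apply, LinearEquiv.trans_apply, ratEquiv_frobVec, LinearEquiv.symm_apply_eq,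
    ratEquiv_frobVec, LinearEquiv.apply_symm_apply]

theorem AutIrreducible.char_ne_five (halt : ∀ x, f x x = 0) (hf : f ≠ 0)
    (hirr : AutIrreducible f) : p ≠ 5 := by
  rintro rfl
  obtain ⟨c, hc, hc1, -⟩ := hirr.exists_isStandard (AlgebraicClosure (ZMod 5)) halt hf
  have h2 : (c - 1) ^ 5 = 0 := by rw [sub_pow_char, hc, one_pow, sub_self]
  exact hc1 (sub_eq_zero.1 (pow_eq_zero_iff (by norm_num) |>.1 h2))

theorem AutIrreducible.exists_isModel (hp5 : (p : ZMod 5) ≠ 0) (hz : z 1 ≠ 1)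
    (halt : ∀ x, f x x = 0) (hf : f ≠ 0) (hirr : AutIrreducible f) :
    ∃ l X, IsModel z l f X := by
  obtain ⟨c, hc, hc1, E, hE, G, hGφ, hG⟩ := hirr.exists_isStandard K halt hf
  obtain ⟨e, he⟩ := hE.exists_basis finrank_fin_four
  obtain ⟨d, hd⟩ := exists_addChar_eq_pow z hz hc
  have hd0 : d ≠ 0 := by
    rintro rfl
    apply hc1
    have := hd 1
    rwa [show (1 : ZMod 5).val = 1 from rfl, pow_one, zero_mul, AddChar.map_zero_eq_one] at this
  have hφ : ∀ a, a ≠ 0 → E (frobVec p K (e a)) =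
      Pi.single (p * a) (E (frobVec p K (e a)) (p * a)) := fun a ha => by
    have h1 : G (e a) = z (d * a) • e a := by
      apply hE.inj
      funext b
      rw [hG, hd, map_smul, he a ha, Pi.smul_apply, smul_eq_mul]
      by_cases hb : b = a
      · rw [hb]
      · simp [hb]
    funext b
    by_cases hb : b = p * a
    · subst hb; simp
    · rw [Pi.single_eq_of_ne hb]
      have h2 := hG (frobVec p K (e a)) b
      rw [hGφ, h1, frobVec_smul, map_smul, Pi.smul_apply, smul_eq_mul, hd, addChar_pow_char] at h2
      by_contra hne
      have h3 := addChar_injective hz (mul_right_cancel₀ hne h2)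
      rw [mul_left_comm] at h3
      exact hb (mul_left_cancel₀ hd0 h3).symm
  obtain ⟨t, ht⟩ : ∃ t : ZMod 5 → K, ∀ a, t a = E (frobVec p K (e a)) (p * a) := ⟨_, fun _ => rfl⟩
  have hφ' : ∀ a, a ≠ 0 → E (frobVec p K (e a)) = Pi.single (p * a) (t a) := fun a ha => by
    rw [ht, ← hφ a ha]
  have hfrob : ∀ u a, a ≠ 0 → E (frobVec p K u) (p * a) = t a * E u a ^ p := by
    intro u a ha
    have hs : ∀ b, b ≠ 0 → E (frobVec p K (e b)) (p * a) = if a = b then t b else 0 :=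
      fun b hb => by
        rw [hφ' b hb, Pi.single_apply]
        exact if_congr (mul_right_inj' hp5) rfl rfl
    have hu := congrArg (fun x => E (frobVec p K x) (p * a)) (hE.eq_sum he u)
    simp only [map_add, frobVec_smul, map_smul, Pi.add_apply, Pi.smul_apply, smul_eq_mul,
      hs 1 (by decide), hs 2 (by decide), hs 3 (by decide), hs 4 (by decide)] at hu
    rw [hu]
    rcases zmod_five_cases a with rfl | rfl | rfl | rfl | rfl
    · exact absurd rfl ha
    all_goals simp [zmod_five_ne, mul_comm]
  have ht0 : ∀ a, a ≠ 0 → t a ≠ 0 := fun a ha h0 => by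
    have h1 := hφ' a ha
    rw [h0, Pi.single_zero, ← map_zero E] at h1
    have h2 := (frobVec p K).map_eq_zero_iff.1 (hE.inj h1)
    have h3 := he a ha
    rw [h2, map_zero] at h3
    simpa using congrFun h3 a
  have hrel : ∀ a b c, a ≠ 0 → b ≠ 0 → c ≠ 0 → 2 * a = b → 4 * a = c → ratMul f (e b) (e c) = e a →
      t a = t b * t c := by
    intro a b c ha hb hc hab hac hm
    have h1 := congrArg (fun x => E x (p * a)) ((isSemiAut_frobVec (K := K) (f := f)).2 (e b) (e c))
    simp only [hm, hfrob _ a ha, he a ha, hE.mul, stdMul, mul_left_comm _ (p : ZMod 5), hab, hac,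
      hfrob _ b hb, hfrob _ c hc, he b hb, he c hc] at h1
    have hbc : b ≠ c := by
      rintro rfl
      have h42 : ∀ a : ZMod 5, a ≠ 0 → 2 * a ≠ 4 * a := by decide
      exact h42 a ha (hab.trans hac.symm)
    simpa [hbc, hbc.symm, (Fact.out : p.Prime).ne_zero] using h1
  obtain ⟨h24, h43, h12, h31, -, -⟩ := hE.table he
  have r1 := hrel 1 2 4 (by decide) (by decide) (by decide) (by decide) (by decide) h24
  have r2 := hrel 2 4 3 (by decide) (by decide) (by decide) (by decide) (by decide) h43
  have r3 := hrel 3 1 2 (by decide) (by decide) (by decide) (by decide) (by decide) h12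
  have r4 := hrel 4 3 1 (by decide) (by decide) (by decide) (by decide) (by decide) h31
  have t10 := ht0 1 (by decide)
  have t20 := ht0 2 (by decide)
  have e1 : t 2 * t 3 = 1 := mul_left_cancel₀ t10 (by rw [mul_one]; conv_rhs => rw [r1, r4]
                                                      ring)
  have e2 : t 2 = t 1 ^ 2 := by
    apply mul_left_cancel₀ t20
    calc t 2 * t 2 = t 2 * (t 3 * t 1 * t 3) := by rw [← r4, ← r2]
      _ = (t 2 * t 3) * t 1 * t 3 := by ring
      _ = t 2 * t 1 ^ 2 := by rw [e1, r3]; ring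
  have e3 : t 3 = t 1 ^ 3 := by rw [r3, e2]; ring
  have e4 : t 4 = t 1 ^ 4 := by rw [r4, e3]; ring
  have e5 : t 1 ^ 5 = 1 := by rw [← e1, e2, e3]; ring
  obtain ⟨l, hl⟩ := exists_addChar_eq_pow z hz e5
  have htl : ∀ a, a ≠ 0 → t a = z (l * a) := fun a ha => by
    rw [← hl]
    rcases zmod_five_cases a with rfl | rfl | rfl | rfl | rfl
    · exact absurd rfl ha
    · exact (pow_one _).symm
    · exact e2
    · exact e3
    · exact e4
  refine ⟨l, E.restrictScalars (ZMod p) ∘ₗ ratVec K, ⟨?_, fun v => ⟨hE.zero _, fun a => ?_⟩⟩,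
    fun u v => ?_⟩
  · have h1 : (fun i : Fin 4 => (E.restrictScalars (ZMod p) ∘ₗ ratVec K) (Pi.single i 1)) =
        E ∘ Pi.basisFun K (Fin 4) :=
      funext fun i => congrArg E ((ratVec_single i).trans (Pi.basisFun_apply ..).symm)
    rw [h1]
    exact (Pi.basisFun K (Fin 4)).linearIndependent.map' E (LinearMap.ker_eq_bot.2 hE.inj)
  · change E (ratVec K v) (p * a) = z (l * a) * E (ratVec K v) a ^ p
    by_cases ha : a = 0
    · subst ha
      rw [mul_zero, hE.zero, zero_pow (Fact.out : p.Prime).ne_zero, mul_zero]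
    · rw [← htl a ha, ← hfrob _ a ha, frobVec_ratVec]
  · change E (ratVec K (f u v)) = stdMul (E (ratVec K u)) (E (ratVec K v))
    rw [← ratMul_ratVec, hE.mul]

theorem IsModel.eq_zero_of_autIrreducible (hp : (p : ZMod 5) = 1 ∨ (p : ZMod 5) = 4)
    (hz : z 1 ≠ 1) (h : IsModel z l f X) (hirr : AutIrreducible f) : l = 0 := by
  by_contra hl
  let P : (Fin 4 → ZMod p) →ₗ[ZMod p] (K × K) :=
    (((LinearMap.proj 2 : (ZMod 5 → K) →ₗ[K] K).prod
      (LinearMap.proj 3)).restrictScalars (ZMod p)) ∘ₗ X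
  have hP : ∀ v, v ∈ LinearMap.ker P ↔ X v 2 = 0 ∧ X v 3 = 0 := fun v => by
    rw [LinearMap.mem_ker]
    exact Prod.mk_eq_zero
  rcases hirr (LinearMap.ker P) (fun g hg w hw => by
    obtain ⟨j, k, hk, hlk, hgX⟩ := h.exists_of_aut hz hg
    have hk1 : k = 1 := mul_left_cancel₀ hl (by rw [hlk, mul_one])
    rw [hP] at hw ⊢
    rw [hgX, twistMap_apply, twistMap_apply, hk1, one_mul, one_mul, hw.1, hw.2]
    simp) with hb | ht
  · let N : Submodule K (Fin 4 → K) := LinearMap.ker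
      (((LinearMap.proj 2 : (ZMod 5 → K) →ₗ[K] K).prod
      (LinearMap.proj 3)) ∘ₗ ratExtend X)
    have hN : ∀ u, u ∈ N ↔ ratExtend X u 2 = 0 ∧ ratExtend X u 3 = 0 := fun u => by
      rw [LinearMap.mem_ker]
      exact Prod.mk_eq_zero
    obtain ⟨u, hu⟩ := h.isStandard.surj finrank_fin_four (x := Pi.single 1 1)
      (by simp)
    have hN0 : N ≠ ⊥ := fun h0 => by
      have h1 : u ∈ N := by rw [hN, hu]; simp [zmod_five_ne]
      rw [h0, Submodule.mem_bot] at h1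
      rw [h1, map_zero] at hu
      simpa using congrFun hu 1
    obtain ⟨v, hv0, hv⟩ := exists_ratVec_mem (W := N) (fun w hw => by
      rw [hN] at hw ⊢
      have h2 := h.ratExtend_frobVec w 2
      have h3 := h.ratExtend_frobVec w 3
      rw [hw.1, zero_pow (Fact.out : p.Prime).ne_zero, mul_zero] at h2
      rw [hw.2, zero_pow (Fact.out : p.Prime).ne_zero, mul_zero] at h3
      rcases hp with hp | hp
      · rw [hp, one_mul] at h2 h3
        exact ⟨h2, h3⟩
      · rw [hp] at h2 h3
        exact ⟨h3, h2⟩) hN0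
    rw [hN, ratExtend_ratVec, ← hP, hb] at hv
    exact hv0 hv
  · obtain ⟨v, hv⟩ := h.exists_apply_ne_zero (a := 2) (by decide)
    exact hv ((hP v).1 (by rw [ht]; trivial)).1

end Classification

section Forms

variable {p : ℕ} [Fact p.Prime]

/-- Non-zero alternating products on `F ^ 4` with an irreducible automorphism group. -/
structure IsUCSForm
    (f : (Fin 4 → ZMod p) →ₗ[ZMod p] (Fin 4 → ZMod p) →ₗ[ZMod p] (Fin 4 → ZMod p)) : Prop where
  self : ∀ x, f x x = 0
  ne_zero : f ≠ 0
  irreducible : AutIrreducible f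

variable {f f' : (Fin 4 → ZMod p) →ₗ[ZMod p] (Fin 4 → ZMod p) →ₗ[ZMod p] (Fin 4 → ZMod p)}

theorem exists_addChar {K : Type*} [Field K] [IsAlgClosed K] [CharP K p] (hp5 : p ≠ 5) :
    ∃ z : AddChar (ZMod 5) K, z 1 ≠ 1 := by
  have : NeZero ((5 : ℕ) : K) := ⟨fun h0 => hp5
    ((Nat.prime_dvd_prime_iff_eq Fact.out Fact.out).1 ((CharP.cast_eq_zero_iff K p 5).1 h0))⟩
  obtain ⟨ζ, hζ⟩ := IsAlgClosed.exists_root (Polynomial.cyclotomic 5 K)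
    (Polynomial.degree_cyclotomic_pos 5 K (by norm_num)).ne'
  rw [Polynomial.isRoot_cyclotomic_iff] at hζ
  refine ⟨AddChar.zmodChar 5 hζ.pow_eq_one, ?_⟩
  rw [AddChar.zmodChar_apply, show (1 : ZMod 5).val = 1 from rfl, pow_one]
  exact hζ.ne_one (by norm_num)

omit [Fact p.Prime] in
theorem natCast_zmod_five {r : ℕ} (h : p % 5 = r) : (p : ZMod 5) = (r : ZMod 5) := by
  rw [← h, ZMod.natCast_mod]

theorem IsUCSForm.exists_unique (hp : p % 5 = 1 ∨ p % 5 = 4) :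
    ∃ f : (Fin 4 → ZMod p) →ₗ[ZMod p] (Fin 4 → ZMod p) →ₗ[ZMod p] (Fin 4 → ZMod p),
      IsUCSForm f ∧ Nat.card (algAut f) = 20 ∧ ∀ f', IsUCSForm f' →
        ∃ e : (Fin 4 → ZMod p) ≃ₗ[ZMod p] (Fin 4 → ZMod p),
          ∀ u v, e (f' u v) = f (e u) (e v) := by
  have hp' : (p : ZMod 5) = 1 ∨ (p : ZMod 5) = 4 :=
    hp.imp (fun h => natCast_zmod_five h) (fun h => natCast_zmod_five h)
  have hp5 : (p : ZMod 5) ≠ 0 := by rcases hp' with h | h <;> rw [h] <;> decide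
  obtain ⟨z, hz⟩ := exists_addChar (p := p) (K := AlgebraicClosure (ZMod p)) (by omega)
  obtain ⟨f, X, h⟩ := exists_isModel_zero hz hp5
  refine ⟨f, ⟨h.self, h.ne_zero, h.autIrreducible hp5 hz (.inl rfl)⟩,
    (h.card_algAut hp5 hz).trans card_monomial_zero, fun f' hf' => ?_⟩
  obtain ⟨l, X', h'⟩ := hf'.irreducible.exists_isModel hp5 hz hf'.self hf'.ne_zero
  have hl := h'.eq_zero_of_autIrreducible hp' hz hf'.irreducible
  subst hl
  exact (h'.exists_iso hp5 h).imp fun e he => he.2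

theorem IsUCSForm.exists_pair (hp : p % 5 = 2 ∨ p % 5 = 3) :
    ∃ f₀ f₁ : (Fin 4 → ZMod p) →ₗ[ZMod p] (Fin 4 → ZMod p) →ₗ[ZMod p] (Fin 4 → ZMod p),
      IsUCSForm f₀ ∧ IsUCSForm f₁ ∧ Nat.card (algAut f₀) = 20 ∧ Nat.card (algAut f₁) = 5 ∧
        ∀ f', IsUCSForm f' → ∃ e : (Fin 4 → ZMod p) ≃ₗ[ZMod p] (Fin 4 → ZMod p),
          (∀ u v, e (f' u v) = f₀ (e u) (e v)) ∨ ∀ u v, e (f' u v) = f₁ (e u) (e v) := by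
  have hp' : (p : ZMod 5) = 2 ∨ (p : ZMod 5) = 3 :=
    hp.imp (fun h => natCast_zmod_five h) (fun h => natCast_zmod_five h)
  have hp5 : (p : ZMod 5) ≠ 0 := by rcases hp' with h | h <;> rw [h] <;> decide
  obtain ⟨z, hz⟩ := exists_addChar (p := p) (K := AlgebraicClosure (ZMod p)) (by omega)
  obtain ⟨f₀, X₀, h₀⟩ := exists_isModel hz hp' 0
  obtain ⟨f₁, X₁, h₁⟩ := exists_isModel hz hp' 1
  refine ⟨f₀, f₁, ⟨h₀.self, h₀.ne_zero, h₀.autIrreducible hp5 hz (.inr hp')⟩,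
    ⟨h₁.self, h₁.ne_zero, h₁.autIrreducible hp5 hz (.inr hp')⟩,
    (h₀.card_algAut hp5 hz).trans card_monomial_zero,
    (h₁.card_algAut hp5 hz).trans (card_monomial_ne_zero one_ne_zero), fun f' hf' => ?_⟩
  obtain ⟨l, X', h'⟩ := hf'.irreducible.exists_isModel hp5 hz hf'.self hf'.ne_zero
  by_cases hl : l = 0
  · subst hl
    exact (h'.exists_iso hp5 h₀).imp fun e he => .inl he.2
  · have h2 := h'.twist 0 (inv_ne_zero hl)
    rw [mul_inv_cancel₀ hl] at h2
    exact (h2.exists_iso hp5 h₁).imp fun e he => .inr he.2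

end Forms

section FormGroup

variable {p : ℕ} [Fact p.Prime] {G G' : Type*} [Group G] [Group G']

/-- `G` is an extension of `F ^ 4` by a central `F ^ 4` whose power and commutator maps are the
identity and `f`. -/
structure IsFormGroup
    (f : (Fin 4 → ZMod p) →ₗ[ZMod p] (Fin 4 → ZMod p) →ₗ[ZMod p] (Fin 4 → ZMod p))
    (π : G → (Fin 4 → ZMod p)) (ι : (Fin 4 → ZMod p) → G) : Prop where
  map_mul : ∀ x y, π (x * y) = π x + π y
  surj : Function.Surjective π
  ι_add : ∀ v w, ι (v + w) = ι v * ι w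
  ι_inj : Function.Injective ι
  exists_ι : ∀ x, π x = 0 → ∃ v, ι v = x
  pow : ∀ x, x ^ p = ι (π x)
  comm : ∀ x y, x * y = y * x * ι (f (π x) (π y))

variable {f f' : (Fin 4 → ZMod p) →ₗ[ZMod p] (Fin 4 → ZMod p) →ₗ[ZMod p] (Fin 4 → ZMod p)}
  {π : G → (Fin 4 → ZMod p)} {ι : (Fin 4 → ZMod p) → G}
  {π' : G' → (Fin 4 → ZMod p)} {ι' : (Fin 4 → ZMod p) → G'}

theorem prime_nsmul_eq_zero (v : Fin 4 → ZMod p) : p • v = 0 := by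
  rw [← Nat.cast_smul_eq_nsmul (ZMod p), CharP.cast_eq_zero, zero_smul]

namespace IsFormGroup

theorem ι_zero (h : IsFormGroup f π ι) : ι 0 = 1 := by
  have := h.ι_add 0 0
  rwa [add_zero, left_eq_mul] at this

theorem π_one (h : IsFormGroup f π ι) : π 1 = 0 := by
  have := h.map_mul 1 1
  rwa [one_mul, left_eq_add] at this

/-- The projection as a group homomorphism. -/
def πHom (h : IsFormGroup f π ι) : G →* Multiplicative (Fin 4 → ZMod p) where
  toFun x := Multiplicative.ofAdd (π x)
  map_one' := congrArg _ h.π_one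
  map_mul' x y := congrArg _ (h.map_mul x y)

/-- The inclusion as a group homomorphism. -/
def ιHom (h : IsFormGroup f π ι) : Multiplicative (Fin 4 → ZMod p) →* G where
  toFun v := ι v.toAdd
  map_one' := h.ι_zero
  map_mul' v w := h.ι_add v.toAdd w.toAdd

theorem π_pow (h : IsFormGroup f π ι) (x : G) (n : ℕ) : π (x ^ n) = n • π x :=
  map_pow h.πHom x n

theorem π_inv (h : IsFormGroup f π ι) (x : G) : π x⁻¹ = -π x := map_inv h.πHom x

theorem ι_neg (h : IsFormGroup f π ι) (v : Fin 4 → ZMod p) : ι (-v) = (ι v)⁻¹ :=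
  map_inv h.ιHom (Multiplicative.ofAdd v)

theorem π_ι (h : IsFormGroup f π ι) (v : Fin 4 → ZMod p) : π (ι v) = 0 := by
  obtain ⟨x, rfl⟩ := h.surj v
  rw [← h.pow, h.π_pow, prime_nsmul_eq_zero]

theorem π_eq_zero_iff (h : IsFormGroup f π ι) (x : G) : π x = 0 ↔ x ^ p = 1 := by
  rw [h.pow, ← h.ι_zero, h.ι_inj.eq_iff]

theorem ι_comm (h : IsFormGroup f π ι) (v : Fin 4 → ZMod p) (x : G) : ι v * x = x * ι v := by
  rw [h.comm, h.π_ι, map_zero, LinearMap.zero_apply, h.ι_zero, mul_one]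

theorem self (h : IsFormGroup f π ι) (v : Fin 4 → ZMod p) : f v v = 0 := by
  obtain ⟨x, rfl⟩ := h.surj v
  have := h.comm x x
  rw [left_eq_mul, ← h.ι_zero] at this
  exact h.ι_inj this

theorem pow_sq (h : IsFormGroup f π ι) (x : G) : x ^ p ^ 2 = 1 := by
  rw [sq, pow_mul, ← h.π_eq_zero_iff, h.pow, h.π_ι]

theorem of_iso (h : IsFormGroup f π ι) (e : (Fin 4 → ZMod p) ≃ₗ[ZMod p] (Fin 4 → ZMod p))
    (he : ∀ u v, e (f u v) = f' (e u) (e v)) :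
    IsFormGroup f' (fun x => e (π x)) (fun v => ι (e.symm v)) where
  map_mul x y := by rw [h.map_mul, map_add]
  surj := e.surjective.comp h.surj
  ι_add v w := by rw [map_add, h.ι_add]
  ι_inj := h.ι_inj.comp e.symm.injective
  exists_ι x hx := by
    obtain ⟨v, hv⟩ := h.exists_ι x (e.map_eq_zero_iff.1 hx)
    exact ⟨e v, by rw [e.symm_apply_apply, hv]⟩
  pow x := by rw [e.symm_apply_apply, h.pow]
  comm x y := by rw [← he, e.symm_apply_apply, h.comm]

theorem of_mulEquiv (h : IsFormGroup f π ι) (φ : G ≃* G') :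
    IsFormGroup f (fun x => π (φ.symm x)) (fun v => φ (ι v)) where
  map_mul x y := by rw [_root_.map_mul, h.map_mul]
  surj := h.surj.comp φ.symm.surjective
  ι_add v w := by rw [h.ι_add, _root_.map_mul]
  ι_inj := φ.injective.comp h.ι_inj
  exists_ι x hx := by
    obtain ⟨v, hv⟩ := h.exists_ι _ hx
    exact ⟨v, by rw [hv, φ.apply_symm_apply]⟩
  pow x := by rw [← h.pow, map_pow, φ.apply_symm_apply]
  comm x y := by
    apply φ.symm.injective
    rw [_root_.map_mul, h.comm]
    simp

/-- The group obtained by multiplying the product with the values of a bilinear map. -/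
def Twist (_ : IsFormGroup f π ι)
    (_ : (Fin 4 → ZMod p) →ₗ[ZMod p] (Fin 4 → ZMod p) →ₗ[ZMod p] (Fin 4 → ZMod p)) : Type _ := G

variable (h : IsFormGroup f π ι)
  (b : (Fin 4 → ZMod p) →ₗ[ZMod p] (Fin 4 → ZMod p) →ₗ[ZMod p] (Fin 4 → ZMod p))

/-- The identity map to the twisted group. -/
def toTwist : G ≃ h.Twist b := Equiv.refl G

noncomputable instance : Group (h.Twist b) :=
  letI : Mul (h.Twist b) := ⟨fun x y => h.toTwist b ((h.toTwist b).symm x * (h.toTwist b).symm y *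
    ι (b (π ((h.toTwist b).symm x)) (π ((h.toTwist b).symm y))))⟩
  letI : One (h.Twist b) := ⟨h.toTwist b 1⟩
  letI : Inv (h.Twist b) := ⟨fun x => h.toTwist b (((h.toTwist b).symm x)⁻¹ *
    ι (b (π ((h.toTwist b).symm x)) (π ((h.toTwist b).symm x))))⟩
  Group.ofLeftAxioms
    (fun (x y z : G) => by
      change x * y * ι (b (π x) (π y)) * z * ι (b (π (x * y * ι (b (π x) (π y)))) (π z)) =
        x * (y * z * ι (b (π y) (π z))) * ι (b (π x) (π (y * z * ι (b (π y) (π z)))))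
      have h1 : ι (b (π x) (π y)) * z = z * ι (b (π x) (π y)) := h.ι_comm _ _
      rw [mul_assoc (x * y), h1]
      simp only [h.map_mul, h.π_ι, add_zero, map_add, LinearMap.add_apply, mul_assoc, ← h.ι_add]
      congr 4
      abel)
    (fun (x : G) => by
      change 1 * x * ι (b (π 1) (π x)) = x
      rw [h.π_one, map_zero, LinearMap.zero_apply, h.ι_zero, one_mul, mul_one])
    (fun (x : G) => by
      change x⁻¹ * ι (b (π x) (π x)) * x * ι (b (π (x⁻¹ * ι (b (π x) (π x)))) (π x)) = 1
      rw [mul_assoc x⁻¹, h.ι_comm, h.map_mul, h.π_ι, add_zero, h.π_inv, map_neg,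
        LinearMap.neg_apply, h.ι_neg, inv_mul_cancel_left, mul_inv_cancel])

theorem toTwist_mul (x y : G) :
    h.toTwist b x * h.toTwist b y = h.toTwist b (x * y * ι (b (π x) (π y))) := rfl

theorem toTwist_pow (hb : ∀ v, b v v = 0) (x : G) (n : ℕ) :
    h.toTwist b x ^ n = h.toTwist b (x ^ n) := by
  induction n with
  | zero => rw [pow_zero, pow_zero]; rfl
  | succ n ih =>
    rw [pow_succ, ih, toTwist_mul, h.π_pow, ← Nat.cast_smul_eq_nsmul (ZMod p), map_smul,
      LinearMap.smul_apply, hb, smul_zero, h.ι_zero, mul_one, pow_succ]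

theorem twist (hb : ∀ v, b v v = 0) :
    IsFormGroup (f + (2 : ZMod p) • b) (fun x => π ((h.toTwist b).symm x))
      (fun v => h.toTwist b (ι v)) where
  map_mul (x y : G) := by
    change π (x * y * ι (b (π x) (π y))) = π x + π y
    rw [h.map_mul, h.map_mul, h.π_ι, add_zero]
  surj := h.surj
  ι_add v w := by
    rw [toTwist_mul, h.π_ι, map_zero, LinearMap.zero_apply, h.ι_zero, mul_one, h.ι_add]
  ι_inj := h.ι_inj
  exists_ι := h.exists_ι
  pow (x : G) := (h.toTwist_pow b hb x p).trans (congrArg _ (h.pow x))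
  comm (x y : G) := by
    have hanti : b (π x) (π y) = -b (π y) (π x) := by
      have := hb (π x + π y)
      simp only [map_add, LinearMap.add_apply, hb, zero_add, add_zero] at this
      exact eq_neg_of_add_eq_zero_left (by rwa [add_comm])
    change x * y * ι (b (π x) (π y)) = y * x * ι (b (π y) (π x)) * ι (f (π x) (π y) +
      (2 : ZMod p) • b (π x) (π y)) * ι (b _ (π (ι _)))
    rw [h.π_ι, map_zero, h.ι_zero, mul_one, h.comm x y, mul_assoc (y * x), mul_assoc (y * x),
      ← h.ι_add, ← h.ι_add, hanti]
    congr 2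
    module

end IsFormGroup

theorem exists_pow_equiv {A : Type*} [CommGroup A] {π : A → (Fin 4 → ZMod p)}
    {ι : (Fin 4 → ZMod p) → A} (h : IsFormGroup 0 π ι) :
    ∃ ψ : (Fin 4 → ZMod (p ^ 2)) ≃ A, (∀ x y, ψ (x + y) = ψ x * ψ y) ∧
      (∀ x i, π (ψ x) i = ((x i).val : ZMod p)) ∧
      ∀ x v, ψ (x + p • fun i => ((v i).val : ZMod (p ^ 2))) = ψ x * ι v := by
  have hp0 := (Fact.out : p.Prime).ne_zero
  have : NeZero (p ^ 2) := ⟨pow_ne_zero 2 hp0⟩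
  choose g hg using fun i : Fin 4 => h.surj (Pi.single i 1)
  let ψ : (Fin 4 → ZMod (p ^ 2)) → A := fun x => ∏ i, g i ^ (x i).val
  have hψ : ∀ x y, ψ (x + y) = ψ x * ψ y := fun x y => by
    simp only [ψ]
    rw [← Finset.prod_mul_distrib]
    refine Finset.prod_congr rfl fun i _ => ?_
    rw [Pi.add_apply, ZMod.val_add, ← pow_add]
    conv_rhs => rw [← Nat.mod_add_div ((x i).val + (y i).val) (p ^ 2), pow_add, pow_mul, h.pow_sq,
      one_pow, mul_one]
  have hπψ : ∀ x i, π (ψ x) i = ((x i).val : ZMod p) := fun x i => by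
    have : π (ψ x) = ∑ j, (x j).val • (Pi.single j 1 : Fin 4 → ZMod p) := by
      have h1 : ∀ s : Finset (Fin 4), π (∏ j ∈ s, g j ^ (x j).val) =
          ∑ j ∈ s, (x j).val • (Pi.single j 1 : Fin 4 → ZMod p) := fun s => by
        induction s using Finset.induction_on with
        | empty => simpa using h.π_one
        | insert j s hj ih => rw [Finset.prod_insert hj, Finset.sum_insert hj, h.map_mul, ih,
            h.π_pow, hg]
      exact h1 _
    rw [this, Finset.sum_apply, Finset.sum_eq_single i]
    · simp
    · intro j _ hj; simp [hj.symm]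
    · simp
  have hcast : ∀ n : ℕ, ((n : ZMod (p ^ 2)).val : ZMod p) = n := fun n => by
    rw [ZMod.val_natCast, ZMod.natCast_eq_natCast_iff',
      Nat.mod_mod_of_dvd _ (dvd_pow_self p two_ne_zero)]
  have hmul : ∀ (n : ℕ) x, ψ (n • x) = ψ x ^ n := fun n x => by
    induction n with
    | zero => simp [ψ]
    | succ n ih => rw [succ_nsmul, hψ, ih, pow_succ]
  have hψ0 : ∀ x, ψ x = 1 → x = 0 := fun x hx => by
    have h1 : ∀ i, p ∣ (x i).val := fun i => by
      rw [← ZMod.natCast_eq_zero_iff, ← hπψ, hx, h.π_one, Pi.zero_apply]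
    choose y hy using h1
    have h2 : x = p • fun i => ((y i : ℕ) : ZMod (p ^ 2)) := by
      funext i
      rw [Pi.smul_apply, nsmul_eq_mul, ← Nat.cast_mul, ← hy, ZMod.natCast_zmod_val]
    rw [h2, hmul, ← h.π_eq_zero_iff] at hx
    have h3 : ∀ i, p ∣ y i := fun i => by
      rw [← ZMod.natCast_eq_zero_iff, ← hcast, ← Pi.zero_apply (M := fun _ => ZMod p) i, ← hx, hπψ]
    funext i
    rw [← ZMod.natCast_zmod_val (x i), hy, Pi.zero_apply, ZMod.natCast_eq_zero_iff, sq]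
    exact mul_dvd_mul_left p (h3 i)
  have hlift : ∀ v : Fin 4 → ZMod p, π (ψ fun i => ((v i).val : ZMod (p ^ 2))) = v := fun v => by
    funext i
    rw [hπψ, hcast, ZMod.natCast_zmod_val]
  have hι : ∀ x v, ψ (x + p • fun i => ((v i).val : ZMod (p ^ 2))) = ψ x * ι v := fun x v => by
    rw [hψ, hmul, h.pow, hlift]
  refine ⟨Equiv.ofBijective ψ ⟨fun x y e => ?_, fun a => ?_⟩, hψ, hπψ, hι⟩
  · have h1 := hψ (x - y) y
    rw [sub_add_cancel, e, right_eq_mul] at h1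
    exact sub_eq_zero.1 (hψ0 _ h1)
  · obtain ⟨v, hv⟩ := h.exists_ι (a / ψ fun i => ((π a i).val : ZMod (p ^ 2))) (by
      rw [div_eq_mul_inv, h.map_mul, h.π_inv, hlift, add_neg_cancel])
    exact ⟨_, by rw [hι, hv, mul_div_cancel]⟩

namespace IsFormGroup

theorem exists_equiv (hp2 : p ≠ 2) (h : IsFormGroup f π ι) :
    ∃ ψ : (Fin 4 → ZMod (p ^ 2)) ≃ G,
      (∀ x y, ψ x * ψ y = ψ (x + y) * ι ((2 : ZMod p)⁻¹ • f (π (ψ x)) (π (ψ y)))) ∧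
      (∀ x i, π (ψ x) i = ((x i).val : ZMod p)) ∧
      ∀ x v, ψ (x + p • fun i => ((v i).val : ZMod (p ^ 2))) = ψ x * ι v := by
  have h2 : (2 : ZMod p) ≠ 0 := fun h0 => hp2 <| by
    have : p ∣ 2 := (ZMod.natCast_eq_zero_iff 2 p).1 (by exact_mod_cast h0)
    exact (Nat.prime_dvd_prime_iff_eq Fact.out Nat.prime_two).1 this
  have ht := h.twist (-(2 : ZMod p)⁻¹ • f) fun v => by
    rw [LinearMap.smul_apply, LinearMap.smul_apply, h.self, smul_zero]
  have hzero : f + (2 : ZMod p) • (-(2 : ZMod p)⁻¹ • f) = 0 := LinearMap.ext₂ fun u v => by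
    simp only [LinearMap.add_apply, LinearMap.smul_apply]
    rw [smul_smul, mul_neg, mul_inv_cancel₀ h2, neg_smul, one_smul, add_neg_cancel]
    rfl
  rw [hzero] at ht
  let _ : CommGroup (h.Twist (-(2 : ZMod p)⁻¹ • f)) :=
    { (inferInstance : Group (h.Twist (-(2 : ZMod p)⁻¹ • f))) with
      mul_comm := fun x y => by
        have := ht.comm x y
        rwa [LinearMap.zero_apply, LinearMap.zero_apply, ht.ι_zero, mul_one] at this }
  obtain ⟨ψ, h1, h2, h3⟩ := exists_pow_equiv ht
  refine ⟨ψ.trans (h.toTwist _).symm, fun x y => ?_, h2, fun x v => ?_⟩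
  · have h4 : ∀ x y, (h.toTwist _).symm (ψ (x + y)) = (h.toTwist _).symm (ψ x) *
      (h.toTwist _).symm (ψ y) * ι ((-(2 : ZMod p)⁻¹ • f) (π ((h.toTwist _).symm (ψ x)))
        (π ((h.toTwist _).symm (ψ y)))) := fun x y => by
      rw [h1]; rfl
    rw [Equiv.trans_apply, Equiv.trans_apply, Equiv.trans_apply, h4, mul_assoc _ (ι _), ← h.ι_add,
      LinearMap.smul_apply, LinearMap.smul_apply, neg_smul, neg_add_cancel, h.ι_zero, mul_one]
  · have h4 : ∀ x : G, x * ι v * ι ((-(2 : ZMod p)⁻¹ • f) (π x) (π (ι v))) = x * ι v := fun x => by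
      rw [h.π_ι, map_zero, h.ι_zero, mul_one]
    exact (h3 x v).trans (h4 _)

theorem exists_mulEquiv (hp2 : p ≠ 2) (h : IsFormGroup f π ι) (h' : IsFormGroup f π' ι') :
    ∃ φ : G ≃* G', ∀ x, π' (φ x) = π x := by
  obtain ⟨ψ, h1, h2, h3⟩ := h.exists_equiv hp2
  obtain ⟨ψ', h1', h2', h3'⟩ := h'.exists_equiv hp2
  have hπ : ∀ x, π' (ψ' x) = π (ψ x) := fun x => funext fun i => by rw [h2, h2']
  refine ⟨{ ψ.symm.trans ψ' with map_mul' := fun x y => ?_ }, fun x => ?_⟩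
  · obtain ⟨x, rfl⟩ := ψ.surjective x
    obtain ⟨y, rfl⟩ := ψ.surjective y
    change ψ' (ψ.symm (ψ x * ψ y)) = ψ' (ψ.symm (ψ x)) * ψ' (ψ.symm (ψ y))
    rw [h1, ← h3, ψ.symm_apply_apply, ψ.symm_apply_apply, ψ.symm_apply_apply, h1', h3', hπ, hπ]
  · change π' (ψ' (ψ.symm x)) = π x
    rw [hπ, ψ.apply_symm_apply]

end IsFormGroup

theorem isFormGroup_zero : IsFormGroup (G := Multiplicative (Fin 4 → ZMod (p ^ 2))) (p := p) 0
    (fun x i => ((x.toAdd i).val : ZMod p))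
    (fun v => Multiplicative.ofAdd (p • fun i => ((v i).val : ZMod (p ^ 2)))) := by
  have hp0 := (Fact.out : p.Prime).ne_zero
  have : NeZero (p ^ 2) := ⟨pow_ne_zero 2 hp0⟩
  have hadd : ∀ a b : ZMod (p ^ 2), ((a + b).val : ZMod p) = a.val + b.val := fun a b => by
    rw [ZMod.natCast_val, ZMod.natCast_val, ZMod.natCast_val,
      ZMod.cast_add (dvd_pow_self p two_ne_zero)]
  have hmul : ∀ n m : ℕ, p • (n : ZMod (p ^ 2)) = p • (m : ZMod (p ^ 2)) ↔
      (n : ZMod p) = m := fun n m => by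
    rw [nsmul_eq_mul, nsmul_eq_mul, ← Nat.cast_mul, ← Nat.cast_mul, ZMod.natCast_eq_natCast_iff,
      ZMod.natCast_eq_natCast_iff, sq]
    exact Nat.ModEq.mul_left_cancel_iff' hp0
  refine ⟨fun x y => funext fun i => hadd _ _, fun v => ⟨Multiplicative.ofAdd fun i =>
    ((v i).val : ZMod (p ^ 2)), funext fun i => ?_⟩, fun v w => congrArg Multiplicative.ofAdd
    (funext fun i => ?_), fun v w e => funext fun i => ?_, fun x hx => ?_, fun x =>
    congrArg Multiplicative.ofAdd (funext fun i => ?_), fun x y => ?_⟩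
  · change (((v i).val : ZMod (p ^ 2)).val : ZMod p) = v i
    rw [ZMod.val_natCast_of_lt ((ZMod.val_lt _).trans_le (Nat.le_self_pow two_ne_zero p)),
      ZMod.natCast_zmod_val]
  · change p • (((v i + w i).val : ℕ) : ZMod (p ^ 2)) =
      p • (((v i).val : ℕ) : ZMod (p ^ 2)) + p • (((w i).val : ℕ) : ZMod (p ^ 2))
    rw [← smul_add, ← Nat.cast_add, hmul, Nat.cast_add, ZMod.natCast_zmod_val,
      ZMod.natCast_zmod_val, ZMod.natCast_zmod_val]
  · have h1 := (hmul _ _).1 (congrFun (congrArg Multiplicative.toAdd e) i)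
    rwa [ZMod.natCast_zmod_val, ZMod.natCast_zmod_val] at h1
  · have h1 : ∀ i, p ∣ (x.toAdd i).val := fun i =>
      (ZMod.natCast_eq_zero_iff _ _).1 (congrFun hx i)
    choose y hy using h1
    refine ⟨fun i => y i, congrArg Multiplicative.ofAdd (funext fun i => ?_)⟩
    change p • (((y i : ZMod p).val : ℕ) : ZMod (p ^ 2)) = x.toAdd i
    rw [(hmul _ (y i)).2 (by rw [ZMod.natCast_zmod_val]), nsmul_eq_mul, ← Nat.cast_mul, ← hy,
      ZMod.natCast_zmod_val]
  · change p • x.toAdd i = p • ((((x.toAdd i).val : ZMod p).val : ℕ) : ZMod (p ^ 2))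
    rw [(hmul _ (x.toAdd i).val).2 (by rw [ZMod.natCast_zmod_val]), ZMod.natCast_zmod_val]
  · rw [mul_comm x y]
    refine (mul_one _).symm.trans (congrArg _ (congrArg Multiplicative.ofAdd (funext fun i => ?_)))
    change 0 = p • (((0 : ZMod p).val : ℕ) : ZMod (p ^ 2))
    simp

theorem exists_isFormGroup (hp2 : p ≠ 2) (hf : ∀ v, f v v = 0) :
    ∃ (G : Type) (_ : Group G) (_ : Finite G) (π : G → (Fin 4 → ZMod p))
      (ι : (Fin 4 → ZMod p) → G), IsFormGroup f π ι := by
  have h2 : (2 : ZMod p) ≠ 0 := fun h0 => hp2 <| by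
    have : p ∣ 2 := (ZMod.natCast_eq_zero_iff 2 p).1 (by exact_mod_cast h0)
    exact (Nat.prime_dvd_prime_iff_eq Fact.out Nat.prime_two).1 this
  have ht := isFormGroup_zero.twist ((2 : ZMod p)⁻¹ • f) fun v => by
    rw [LinearMap.smul_apply, LinearMap.smul_apply, hf, smul_zero]
  rw [smul_smul, mul_inv_cancel₀ h2, one_smul, zero_add] at ht
  have : NeZero (p ^ 2) := ⟨pow_ne_zero 2 (Fact.out : p.Prime).ne_zero⟩
  have hfin : Finite (Multiplicative (Fin 4 → ZMod (p ^ 2))) := inferInstance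
  exact ⟨_, _, hfin, _, _, ht⟩

end FormGroup

section FormGroup

variable {p : ℕ} [Fact p.Prime] {G : Type*} [Group G]
  {f : (Fin 4 → ZMod p) →ₗ[ZMod p] (Fin 4 → ZMod p) →ₗ[ZMod p] (Fin 4 → ZMod p)}
  {π : G → (Fin 4 → ZMod p)} {ι : (Fin 4 → ZMod p) → G}

theorem le_frattini_of_pow (H : Subgroup G) [H.Normal] (n : ℕ)
    (hmul : ∀ x, ∀ y ∈ H, (x * y) ^ n = x ^ n) (hpow : ∀ y ∈ H, ∃ x : G, x ^ n = y) :
    H ≤ frattini G := by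
  unfold frattini Order.radical
  refine le_iInf₂ fun M hM => ?_
  by_contra hHM
  have hsup : M ⊔ H = ⊤ := hM.2 _ (left_lt_sup.2 hHM)
  refine hHM fun y hy => ?_
  obtain ⟨x, rfl⟩ := hpow y hy
  obtain ⟨m, hm, z, hz, rfl⟩ := Subgroup.mem_sup_of_normal_right.1 (hsup ▸ Subgroup.mem_top x)
  rw [hmul m z hz]
  exact M.pow_mem hm n

theorem frattini_ne_top [Finite G] [Nontrivial G] : frattini G ≠ ⊤ := fun h =>
  bot_ne_top (frattini_nongenerating (K := (⊥ : Subgroup G)) (by rw [h, sup_top_eq]))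

namespace IsFormGroup

theorem exists_algAut_of_mulEquiv (h : IsFormGroup f π ι) (φ : G ≃* G) :
    ∃ g ∈ algAut f, (∀ x, π (φ x) = g (π x)) ∧ ∀ v, φ (ι v) = ι (g v) := by
  have hwd : ∀ x y, π x = π y ↔ π (φ x) = π (φ y) := fun x y => by
    rw [← sub_eq_zero, ← sub_eq_zero (a := π (φ x)), sub_eq_add_neg, sub_eq_add_neg, ← h.π_inv,
      ← h.π_inv, ← h.map_mul, ← h.map_mul, ← map_inv, ← _root_.map_mul, h.π_eq_zero_iff,
      h.π_eq_zero_iff, ← map_pow, map_eq_one_iff φ φ.injective]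
  let s := Function.surjInv h.surj
  have hs : ∀ v, π (s v) = v := Function.surjInv_eq h.surj
  let a : (Fin 4 → ZMod p) →+ (Fin 4 → ZMod p) := AddMonoidHom.mk' (fun v => π (φ (s v)))
    fun v w => by
      rw [← h.map_mul, ← _root_.map_mul, ← hwd, hs, h.map_mul, hs, hs]
  have ha : ∀ x, a (π x) = π (φ x) := fun x => (hwd _ _).1 (hs _)
  have hbij : Function.Bijective (a.toZModLinearMap p) := by
    refine ⟨fun v w hvw => ?_, fun v => ?_⟩
    · rw [← hs v, ← hs w]
      exact (hwd _ _).2 hvw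
    · obtain ⟨x, rfl⟩ := h.surj v
      exact ⟨π (φ.symm x), (ha _).trans (by rw [φ.apply_symm_apply])⟩
  let g := LinearEquiv.ofBijective (a.toZModLinearMap p) hbij
  have hg : ∀ x, π (φ x) = g (π x) := fun x => (ha x).symm
  have hι : ∀ v, φ (ι v) = ι (g v) := fun v => by
    obtain ⟨x, rfl⟩ := h.surj v
    rw [← h.pow, map_pow, h.pow, hg]
  refine ⟨g, fun v w => ?_, hg, hι⟩
  obtain ⟨x, rfl⟩ := h.surj v
  obtain ⟨y, rfl⟩ := h.surj w
  have := congrArg φ (h.comm x y)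
  rw [_root_.map_mul, _root_.map_mul, _root_.map_mul, h.comm, hι, hg, hg] at this
  exact h.ι_inj (mul_left_cancel this).symm

theorem exists_mulEquiv_of_algAut (hp2 : p ≠ 2) (h : IsFormGroup f π ι)
    {g : (Fin 4 → ZMod p) ≃ₗ[ZMod p] (Fin 4 → ZMod p)} (hg : g ∈ algAut f) :
    ∃ φ : G ≃* G, (∀ x, π (φ x) = g (π x)) ∧ ∀ v, φ (ι v) = ι (g v) := by
  obtain ⟨φ, hφ⟩ := exists_mulEquiv hp2 (h.of_iso g hg) h
  refine ⟨φ, hφ, fun v => ?_⟩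
  obtain ⟨x, rfl⟩ := h.surj v
  rw [← h.pow, map_pow, h.pow, hφ]

theorem mem_ker (h : IsFormGroup f π ι) {x : G} : x ∈ h.πHom.ker ↔ π x = 0 := Iff.rfl

theorem mem_ker_iff_pow (h : IsFormGroup f π ι) {x : G} : x ∈ h.πHom.ker ↔ x ^ p = 1 :=
  h.π_eq_zero_iff x

theorem characteristic_ker (h : IsFormGroup f π ι) : h.πHom.ker.Characteristic := by
  refine Subgroup.characteristic_iff_le_comap.2 fun φ x hx => ?_
  rw [Subgroup.mem_comap, h.mem_ker_iff_pow]
  change φ x ^ p = 1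
  rw [← map_pow, h.mem_ker_iff_pow.1 hx, map_one]

theorem ker_ne_bot (h : IsFormGroup f π ι) : h.πHom.ker ≠ ⊥ := fun h0 => by
  have : ι 1 ∈ h.πHom.ker := h.π_ι 1
  rw [h0, Subgroup.mem_bot, ← h.ι_zero] at this
  exact one_ne_zero (h.ι_inj this)

theorem ker_ne_top (h : IsFormGroup f π ι) : h.πHom.ker ≠ ⊤ := fun h0 => by
  obtain ⟨x, hx⟩ := h.surj 1
  have : x ∈ h.πHom.ker := h0 ▸ Subgroup.mem_top x
  exact one_ne_zero (hx.symm.trans this)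

theorem eq_of_characteristic (hp2 : p ≠ 2) (h : IsFormGroup f π ι) (hf : AutIrreducible f)
    {K : Subgroup G} (hK : K.Characteristic) : K = ⊥ ∨ K = h.πHom.ker ∨ K = ⊤ := by
  have hφ : ∀ φ : G ≃* G, ∀ x ∈ K, φ x ∈ K := fun φ x hx =>
    Subgroup.characteristic_iff_le_comap.1 hK φ hx
  let W₁ : Submodule (ZMod p) (Fin 4 → ZMod p) := AddSubgroup.toZModSubmodule p
    { carrier := {v | ∃ x ∈ K, π x = v}
      zero_mem' := ⟨1, K.one_mem, h.π_one⟩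
      add_mem' := by
        rintro _ _ ⟨x, hx, rfl⟩ ⟨y, hy, rfl⟩
        exact ⟨x * y, K.mul_mem hx hy, h.map_mul x y⟩
      neg_mem' := by
        rintro _ ⟨x, hx, rfl⟩
        exact ⟨x⁻¹, K.inv_mem hx, h.π_inv x⟩ }
  have hW₁ : ∀ v, v ∈ W₁ ↔ ∃ x ∈ K, π x = v := fun _ => Iff.rfl
  let W₂ : Submodule (ZMod p) (Fin 4 → ZMod p) := AddSubgroup.toZModSubmodule p
    { carrier := {v | ι v ∈ K}
      zero_mem' := by
        rw [Set.mem_ofPred_eq, h.ι_zero]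
        exact K.one_mem
      add_mem' := fun {v w} hv hw => by
        rw [Set.mem_ofPred_eq, h.ι_add]
        exact K.mul_mem hv hw
      neg_mem' := fun {v} hv => by
        rw [Set.mem_ofPred_eq, h.ι_neg]
        exact K.inv_mem hv }
  have hW₂ : ∀ v, v ∈ W₂ ↔ ι v ∈ K := fun _ => Iff.rfl
  rcases hf W₁ (fun g hg w hw => by
    obtain ⟨φ, hφg, -⟩ := h.exists_mulEquiv_of_algAut hp2 hg
    obtain ⟨x, hx, rfl⟩ := hw
    exact ⟨φ x, hφ φ x hx, hφg x⟩) with h1 | h1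
  · have hle : K ≤ h.πHom.ker := fun x hx => by
      have : π x ∈ W₁ := ⟨x, hx, rfl⟩
      rwa [h1, Submodule.mem_bot] at this
    rcases hf W₂ (fun g hg w hw => by
      obtain ⟨φ, -, hφg⟩ := h.exists_mulEquiv_of_algAut hp2 hg
      rw [hW₂, ← hφg]
      exact hφ φ _ hw) with h2 | h2
    · refine Or.inl ((Subgroup.eq_bot_iff_forall K).2 fun x hx => ?_)
      obtain ⟨v, rfl⟩ := h.exists_ι x (hle hx)
      have : v ∈ W₂ := hx
      rw [h2, Submodule.mem_bot] at this
      rw [this, h.ι_zero]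
    · refine Or.inr (Or.inl (le_antisymm hle fun x hx => ?_))
      obtain ⟨v, rfl⟩ := h.exists_ι x hx
      exact (hW₂ v).1 (h2 ▸ Submodule.mem_top)
  · refine Or.inr (Or.inr ((Subgroup.eq_top_iff' K).2 fun x => ?_))
    have hmem : ∀ v, ∃ x ∈ K, π x = v := fun v => (hW₁ v).1 (h1 ▸ Submodule.mem_top)
    obtain ⟨y, hy, hyx⟩ := hmem (π x)
    obtain ⟨v, hv⟩ := h.exists_ι (y⁻¹ * x) (by rw [h.map_mul, h.π_inv, hyx, neg_add_cancel])
    obtain ⟨z, hz, rfl⟩ := hmem v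
    rw [← h.pow] at hv
    rw [← mul_inv_cancel_left y x, ← hv]
    exact K.mul_mem hy (K.pow_mem hz p)

theorem card_characteristic (hp2 : p ≠ 2) (h : IsFormGroup f π ι) (hf : AutIrreducible f) :
    Nat.card {K : Subgroup G // K.Characteristic} = 3 := by
  have hbt : (⊥ : Subgroup G) ≠ ⊤ := fun h0 =>
    h.ker_ne_top (top_le_iff.1 (h0 ▸ bot_le))
  have hset : {K : Subgroup G | K.Characteristic} = {⊥, h.πHom.ker, ⊤} := by
    ext K
    refine ⟨fun hK => h.eq_of_characteristic hp2 hf hK, ?_⟩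
    rintro (rfl | rfl | rfl)
    · exact Subgroup.botCharacteristic
    · exact h.characteristic_ker
    · exact Subgroup.topCharacteristic
  exact (Nat.card_coe_set_eq _).trans (Set.ncard_eq_three.2
    ⟨_, _, _, h.ker_ne_bot.symm, hbt, h.ker_ne_top, hset⟩)

theorem frattini_eq [Finite G] (hp2 : p ≠ 2) (h : IsFormGroup f π ι) (hf : AutIrreducible f) :
    frattini G = h.πHom.ker := by
  have hle : h.πHom.ker ≤ frattini G := by
    refine le_frattini_of_pow _ p (fun x y hy => ?_) fun y hy => ?_
    · rw [h.pow, h.pow, h.map_mul, h.mem_ker.1 hy, add_zero]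
    · obtain ⟨v, rfl⟩ := h.exists_ι y hy
      obtain ⟨x, rfl⟩ := h.surj v
      exact ⟨x, h.pow x⟩
  have : Nontrivial G := h.ι_inj.nontrivial
  rcases h.eq_of_characteristic hp2 hf frattini_characteristic with h0 | h0 | h0
  · exact absurd (le_bot_iff.1 (h0 ▸ hle)) h.ker_ne_bot
  · exact h0
  · exact absurd h0 frattini_ne_top

theorem isUCS4GenExpP2 [Finite G] (hp2 : p ≠ 2) (h : IsFormGroup f π ι) (hf : IsUCSForm f) :
    IsUCS4GenExpP2 p G := by
  have hp : p.Prime := Fact.out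
  refine ⟨⟨fun x => ⟨2, h.pow_sq x⟩, h.card_characteristic hp2 hf.irreducible⟩,
    fun hab => hf.ne_zero (LinearMap.ext₂ fun v w => ?_), ?_, ?_⟩
  · obtain ⟨x, rfl⟩ := h.surj v
    obtain ⟨y, rfl⟩ := h.surj w
    have := h.comm x y
    rw [hab, left_eq_mul, ← h.ι_zero] at this
    exact h.ι_inj this
  · obtain ⟨k, hk, hk'⟩ := (Nat.dvd_prime_pow hp).1
      (Monoid.exponent_dvd_of_forall_pow_eq_one h.pow_sq)
    rw [hk']
    congr 1
    by_contra hne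
    refine h.ker_ne_top ((Subgroup.eq_top_iff' _).2 fun x => h.mem_ker_iff_pow.2 ?_)
    rw [← pow_one p, ← orderOf_dvd_iff_pow_eq_one]
    exact (Monoid.order_dvd_exponent x).trans (hk' ▸ pow_dvd_pow p (by omega))
  · rw [h.frattini_eq hp2 hf.irreducible]
    rw [Nat.card_congr (QuotientGroup.quotientKerEquivOfSurjective h.πHom h.surj).toEquiv]
    rw [Nat.card_congr Multiplicative.toAdd]
    simp

theorem inducedAutCard_eq [Finite G] (hp2 : p ≠ 2) (h : IsFormGroup f π ι)
    (hf : AutIrreducible f) : inducedAutCard G = Nat.card (algAut f) := by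
  have hfr := h.frattini_eq hp2 hf
  have hmk : ∀ x y : G, (QuotientGroup.mk x : G ⧸ frattini G) = QuotientGroup.mk y ↔ π x = π y :=
    fun x y => by
      rw [QuotientGroup.eq, hfr, h.mem_ker, h.map_mul, h.π_inv, neg_add_eq_zero]
  have hex : ∀ ψ : {ψ : MulAut (G ⧸ frattini G) // ∃ φ : MulAut G, ∀ x : G,
      ψ (QuotientGroup.mk x) = QuotientGroup.mk (φ x)}, ∃ g : algAut f,
      ∀ x y : G, ψ.1 (QuotientGroup.mk x) = QuotientGroup.mk y ↔ g.1 (π x) = π y := by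
    rintro ⟨ψ, φ, hφ⟩
    obtain ⟨g, hg, hφg, -⟩ := h.exists_algAut_of_mulEquiv φ
    exact ⟨⟨g, hg⟩, fun x y => by rw [hφ, hmk, hφg]⟩
  choose g hg using hex
  refine Nat.card_congr (Equiv.ofBijective g ⟨fun ψ ψ' hψ => ?_, fun g' => ?_⟩)
  · refine Subtype.ext (MulEquiv.ext fun q => ?_)
    obtain ⟨x, rfl⟩ := QuotientGroup.mk_surjective q
    obtain ⟨y, hy⟩ := QuotientGroup.mk_surjective (ψ.1 (QuotientGroup.mk x))
    rw [← hy]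
    exact ((hg ψ' x y).2 (hψ ▸ (hg ψ x y).1 hy.symm)).symm
  · obtain ⟨φ, hφ, -⟩ := h.exists_mulEquiv_of_algAut hp2 g'.2
    let ψ : MulAut (G ⧸ frattini G) := QuotientGroup.congr _ _ φ
      (Subgroup.characteristic_iff_map_eq.1 frattini_characteristic φ)
    have hψ : ∀ x : G, ψ (QuotientGroup.mk x) = QuotientGroup.mk (φ x) := fun _ => rfl
    refine ⟨⟨ψ, φ, hψ⟩, Subtype.ext (LinearEquiv.ext fun v => ?_)⟩
    obtain ⟨x, rfl⟩ := h.surj v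
    rw [(hg ⟨ψ, φ, hψ⟩ x (φ x)).1 (hψ x), hφ]

end IsFormGroup

omit [Fact p.Prime] in
theorem pow_mul_of_central {x y c : G} (hc : ∀ z, c * z = z * c) (hxy : x * y = y * x * c)
    (n : ℕ) : x ^ n * y = y * x ^ n * c ^ n := by
  have hc' : ∀ (k : ℕ) z, c ^ k * z = z * c ^ k := fun k z =>
    ((show Commute c z from hc z).pow_left k).eq
  induction n with
  | zero => simp
  | succ n ih =>
    rw [pow_succ, mul_assoc, hxy, mul_assoc y, ← mul_assoc, ih, pow_succ c, mul_assoc _ (c ^ n),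
      ← mul_assoc (c ^ n), hc']
    simp only [mul_assoc]

omit [Fact p.Prime] in
theorem mul_pow_of_central {x y c : G} (hc : ∀ z, c * z = z * c) (hxy : x * y = y * x * c)
    (n : ℕ) : (y * x) ^ n = y ^ n * x ^ n * c ^ n.choose 2 := by
  have hc' : ∀ (k : ℕ) z, c ^ k * z = z * c ^ k := fun k z =>
    ((show Commute c z from hc z).pow_left k).eq
  induction n with
  | zero => simp
  | succ n ih =>
    rw [pow_succ, ih, mul_assoc _ (c ^ _), hc', ← mul_assoc, ← mul_assoc, mul_assoc (y ^ n),
      pow_mul_of_central hc hxy, Nat.choose_succ_succ' n 1, Nat.choose_one_right, pow_add c,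
      pow_succ y, pow_succ x, ← mul_assoc, ← mul_assoc, mul_assoc _ (c ^ n) x, hc']
    simp only [mul_assoc]

theorem nonempty_mulEquiv_of_pow {A : Type*} [Group A] [IsMulCommutative A]
    (hA : ∀ a : A, a ^ p = 1)
    (hcard : Nat.card A = p ^ 4) : Nonempty (A ≃* Multiplicative (Fin 4 → ZMod p)) := by
  have hp : p.Prime := Fact.out
  have : Finite A := Nat.finite_of_card_ne_zero (hcard ▸ pow_ne_zero 4 hp.ne_zero)
  let _ : CommGroup A := { mul_comm := mul_comm' }
  let _ : Module (ZMod p) (Additive A) := AddCommGroup.zmodModule (n := p) hA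
  have hfin : Module.finrank (ZMod p) (Additive A) = 4 := by
    have h1 := Module.natCard_eq_pow_finrank (K := ZMod p) (V := Additive A)
    rw [Nat.card_congr Additive.toMul, hcard, Nat.card_zmod] at h1
    exact (Nat.pow_right_injective hp.two_le h1).symm
  obtain ⟨e⟩ := FiniteDimensional.nonempty_linearEquiv_of_finrank_eq
    (R := ZMod p) (M := Additive A) (M' := Fin 4 → ZMod p) (by rw [hfin]; simp)
  exact ⟨AddEquiv.toMultiplicativeRight e.toAddEquiv⟩

/-- A group whose centre is elementary abelian, consists of the `p`-th powers and contains the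
commutators is given by an alternating form. -/
theorem exists_isFormGroup_of_pow (θ : Subgroup.center G ≃* Multiplicative (Fin 4 → ZMod p))
    (hcomm : ∀ x y : G, (y * x)⁻¹ * (x * y) ∈ Subgroup.center G)
    (hmul : ∀ x y : G, (x * y) ^ p = x ^ p * y ^ p)
    (hpow : ∀ x : G, x ^ p ∈ Subgroup.center G)
    (hker : ∀ x : G, x ^ p = 1 ↔ x ∈ Subgroup.center G)
    (hsurj : ∀ y ∈ Subgroup.center G, ∃ x : G, x ^ p = y) :
    ∃ f π ι, IsFormGroup (G := G) (p := p) f π ι := by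
  let π : G → (Fin 4 → ZMod p) := fun x => (θ ⟨x ^ p, hpow x⟩).toAdd
  let ι : (Fin 4 → ZMod p) → G := fun v => θ.symm (Multiplicative.ofAdd v)
  have hπ : ∀ x y, π (x * y) = π x + π y := fun x y => by
    rw [← toAdd_mul, ← map_mul]
    exact congrArg (fun z => (θ z).toAdd) (Subtype.ext (hmul x y))
  have hι : ∀ x, x ^ p = ι (π x) := fun x => by
    change _ = ((θ.symm (θ _) : Subgroup.center G) : G)
    rw [θ.symm_apply_apply]
  have hιadd : ∀ v w, ι (v + w) = ι v * ι w := fun v w => by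
    change ((θ.symm (Multiplicative.ofAdd v * Multiplicative.ofAdd w) : Subgroup.center G) : G) = _
    rw [map_mul]
    rfl
  have hιinj : Function.Injective ι := fun v w h => θ.symm.injective (Subtype.ext h)
  have hπsurj : Function.Surjective π := fun v => by
    obtain ⟨x, hx⟩ := hsurj (ι v) (θ.symm (Multiplicative.ofAdd v)).2
    exact ⟨x, hιinj ((hι x).symm.trans hx)⟩
  have hι0 : ι 0 = 1 := by
    have := hιadd 0 0
    rwa [add_zero, left_eq_mul] at this
  have hex : ∀ x ∈ Subgroup.center G, ∃ v, ι v = x := fun x hx =>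
    ⟨(θ ⟨x, hx⟩).toAdd, by
      change ((θ.symm (θ _) : Subgroup.center G) : G) = _
      rw [θ.symm_apply_apply]⟩
  have hιc : ∀ v x, ι v * x = x * ι v := fun v x =>
    ((Subgroup.mem_center_iff.1 (θ.symm (Multiplicative.ofAdd v)).2) x).symm
  have hπ0 : ∀ x, π x = 0 → x ∈ Subgroup.center G := fun x hx => by
    rw [← hker, hι, hx, hι0]
  choose c hc using fun x y => hex _ (hcomm x y)
  have hc' : ∀ x y, x * y = y * x * ι (c x y) := fun x y => by rw [hc, mul_inv_cancel_left]
  have hceq : ∀ x y v, x * y = y * x * ι v → c x y = v := fun x y v h =>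
    hιinj (by rw [hc, h, inv_mul_cancel_left])
  have hcl : ∀ x x' y, c (x * x') y = c x y + c x' y := fun x x' y => hceq _ _ _ (by
    rw [hιadd, mul_assoc, hc' x', ← mul_assoc, ← mul_assoc, hc' x]
    simp only [mul_assoc]
    rw [← mul_assoc (ι (c x y)), hιc (c x y), mul_assoc])
  have hcr : ∀ x y y', c x (y * y') = c x y + c x y' := fun x y y' => hceq _ _ _ (by
    rw [hιadd, ← mul_assoc, hc' x, mul_assoc, hιc (c x y), ← mul_assoc, mul_assoc y, hc' x]
    simp only [mul_assoc]
    rw [hιc (c x y')])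
  have hcl0 : ∀ x ∈ Subgroup.center G, ∀ y, c x y = 0 := fun x hx y => hceq _ _ _ (by
    rw [hι0, mul_one, (Subgroup.mem_center_iff.1 hx) y])
  have hcr0 : ∀ y ∈ Subgroup.center G, ∀ x, c x y = 0 := fun y hy x => hceq _ _ _ (by
    rw [hι0, mul_one, (Subgroup.mem_center_iff.1 hy) x])
  have hπdiv : ∀ x x', π x = π x' → ∃ z ∈ Subgroup.center G, x' = x * z := fun x x' h =>
    ⟨x⁻¹ * x', hπ0 _ (by
      have h2 := hπ x (x⁻¹ * x')
      rw [mul_inv_cancel_left, h] at h2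
      simpa using h2), by rw [mul_inv_cancel_left]⟩
  have hcwd : ∀ x x' y y', π x = π x' → π y = π y' → c x y = c x' y' := fun x x' y y' h h' => by
    obtain ⟨z, hz, rfl⟩ := hπdiv x x' h
    obtain ⟨w, hw, rfl⟩ := hπdiv y y' h'
    rw [hcl, hcl0 z hz, add_zero, hcr, hcr0 w hw, add_zero]
  let s := Function.surjInv hπsurj
  have hs : ∀ v, π (s v) = v := Function.surjInv_eq hπsurj
  let f : (Fin 4 → ZMod p) →ₗ[ZMod p] (Fin 4 → ZMod p) →ₗ[ZMod p] (Fin 4 → ZMod p) :=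
    (AddMonoidHom.mk' (fun v => (AddMonoidHom.mk' (fun w => c (s v) (s w)) fun w w' => by
      rw [← hcr]
      exact hcwd _ _ _ _ rfl (by rw [hπ, hs, hs, hs])).toZModLinearMap p) fun v v' =>
      LinearMap.ext fun w => by
        change c (s (v + v')) (s w) = c (s v) (s w) + c (s v') (s w)
        rw [← hcl]
        exact hcwd _ _ _ _ (by rw [hπ, hs, hs, hs]) rfl).toZModLinearMap p
  have hf : ∀ x y, f (π x) (π y) = c x y := fun x y => hcwd _ _ _ _ (hs _) (hs _)
  exact ⟨f, π, ι, hπ, hπsurj, hιadd, hιinj, fun x hx => hex x (hπ0 x hx), hι,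
    fun x y => by rw [hf, hc']⟩

omit [Fact p.Prime] in
theorem eq_of_isUCS (h : IsUCS p G) {H K : Subgroup G} (hH : H.Characteristic)
    (hK : K.Characteristic) (hH₀ : H ≠ ⊥) (hH₁ : H ≠ ⊤) (hK₀ : K ≠ ⊥) (hK₁ : K ≠ ⊤) : H = K := by
  obtain ⟨A, B, C, -, -, -, hABC⟩ := Set.ncard_eq_three.1
    ((Nat.card_coe_set_eq {H : Subgroup G | H.Characteristic}).symm.trans h.2)
  have hmem : ∀ L : Subgroup G, L.Characteristic → L = A ∨ L = B ∨ L = C := fun L hL =>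
    hABC.le hL
  have h1 := hmem H hH
  have h2 := hmem K hK
  have h3 := hmem ⊥ Subgroup.botCharacteristic
  have h4 := hmem ⊤ Subgroup.topCharacteristic
  have h5 : (⊥ : Subgroup G) ≠ ⊤ := fun h0 => hH₁ (top_le_iff.1 (h0 ▸ bot_le))
  grind

theorem IsUCS4GenExpP2.exists_isFormGroup [Finite G] (hp2 : p ≠ 2) (h : IsUCS4GenExpP2 p G) :
    ∃ f π ι, IsFormGroup (G := G) (p := p) f π ι ∧ IsUCSForm f := by
  have hp : p.Prime := Fact.out
  obtain ⟨hU, hnc, hexp, hcard⟩ := h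
  have hnt : Nontrivial G := by
    by_contra h0
    rw [not_nontrivial_iff_subsingleton] at h0
    exact hnc fun a b => Subsingleton.elim _ _
  have hZ₀ : Subgroup.center G ≠ ⊥ := by
    have := hU.1.center_nontrivial
    exact (Subgroup.nontrivial_iff_ne_bot _).1 this
  have hZ₁ : Subgroup.center G ≠ ⊤ := fun h0 => hnc fun a b =>
    Subgroup.mem_center_iff.1 (h0 ▸ Subgroup.mem_top b) a
  have hnil : Group.IsNilpotent G := hU.1.isNilpotent
  have hC₁ : commutator G ≠ ⊤ := (Group.IsSolvable.commutator_lt_top_of_nontrivial G).ne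
  have hC₀ : commutator G ≠ ⊥ := fun h0 => hnc fun a b => by
    rw [← commutatorElement_eq_one_iff_mul_comm, ← Subgroup.mem_bot, ← h0, commutator_def]
    exact Subgroup.commutator_mem_commutator (Subgroup.mem_top a) (Subgroup.mem_top b)
  have hCZ : commutator G = Subgroup.center G :=
    eq_of_isUCS hU inferInstance inferInstance hC₀ hC₁ hZ₀ hZ₁
  have hcomm : ∀ x y : G, (y * x)⁻¹ * (x * y) ∈ Subgroup.center G := fun x y => by
    rw [← hCZ, commutator_def]
    convert Subgroup.commutator_mem_commutator (Subgroup.mem_top x⁻¹) (Subgroup.mem_top y⁻¹)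
      using 1
    rw [commutatorElement_def]
    group
  let Ω : Subgroup G :=
    { carrier := {x | x ∈ Subgroup.center G ∧ x ^ p = 1}
      one_mem' := ⟨Subgroup.one_mem _, one_pow p⟩
      mul_mem' := fun {x y} hx hy => ⟨Subgroup.mul_mem _ hx.1 hy.1, by
        rw [(show Commute x y from Subgroup.mem_center_iff.1 hy.1 x).mul_pow, hx.2, hy.2, one_mul]⟩
      inv_mem' := fun {x} hx => ⟨Subgroup.inv_mem _ hx.1, by rw [inv_pow, hx.2, inv_one]⟩ }
  have hΩZ : Ω ≤ Subgroup.center G := fun x hx => hx.1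
  have hΩchar : Ω.Characteristic := Subgroup.characteristic_iff_le_comap.2 fun φ x hx =>
    ⟨Subgroup.characteristic_iff_le_comap.1 Subgroup.centerCharacteristic φ hx.1, by
      change φ x ^ p = 1
      rw [← map_pow, hx.2, map_one]⟩
  have hΩ₀ : Ω ≠ ⊥ := fun h0 => by
    have hdvd : p ∣ Nat.card (Subgroup.center G) := by
      obtain ⟨n, hn⟩ := IsPGroup.iff_card.1 (hU.1.to_subgroup (Subgroup.center G))
      rw [hn]
      refine dvd_pow_self p fun hn0 => hZ₀ (Subgroup.eq_bot_of_card_eq _ ?_)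
      rw [hn, hn0, pow_zero]
    obtain ⟨z, hz⟩ := exists_prime_orderOf_dvd_card' p hdvd
    have hzΩ : (z : G) ∈ Ω := ⟨z.2, by
      rw [← Subgroup.coe_pow, ← hz, pow_orderOf_eq_one, Subgroup.coe_one]⟩
    rw [h0, Subgroup.mem_bot, OneMemClass.coe_eq_one] at hzΩ
    rw [hzΩ, orderOf_one] at hz
    exact hp.one_lt.ne hz
  have hΩ : Ω = Subgroup.center G := eq_of_isUCS hU hΩchar inferInstance hΩ₀
    (fun h0 => hZ₁ (top_le_iff.1 (h0 ▸ hΩZ))) hZ₀ hZ₁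
  have hZp : ∀ z ∈ Subgroup.center G, z ^ p = 1 := fun z hz => (hΩ ▸ hz : z ∈ Ω).2
  have hmul : ∀ x y : G, (x * y) ^ p = x ^ p * y ^ p := fun x y => by
    have hc := Subgroup.mem_center_iff.1 (hcomm y x)
    obtain ⟨k, hk⟩ : p ∣ p.choose 2 := hp.dvd_choose_self two_ne_zero
      (lt_of_le_of_ne hp.two_le hp2.symm)
    rw [mul_pow_of_central (fun z => (hc z).symm) (mul_inv_cancel_left (x * y) (y * x)).symm p, hk,
      pow_mul, hZp _ (hcomm y x), one_pow, mul_one]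
  have hpow : ∀ x : G, x ^ p ∈ Subgroup.center G := fun x => Subgroup.mem_center_iff.2 fun y => by
    have hc := Subgroup.mem_center_iff.1 (hcomm x y)
    rw [pow_mul_of_central (fun z => (hc z).symm) (mul_inv_cancel_left (y * x) (x * y)).symm p,
      hZp _ (hcomm x y), mul_one]
  let P : G →* G := MonoidHom.mk' (fun x => x ^ p) hmul
  have hP : ∀ x, P x = x ^ p := fun _ => rfl
  have hPne : ¬ ∀ x : G, x ^ p = 1 := fun h0 => by
    have := Monoid.exponent_dvd_of_forall_pow_eq_one h0
    rw [hexp] at this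
    have h2 := Nat.le_of_dvd hp.pos this
    nlinarith [hp.two_le]
  have hkerchar : P.ker.Characteristic := Subgroup.characteristic_iff_le_comap.2 fun φ x hx => by
    rw [MonoidHom.mem_ker, hP] at hx
    change φ x ^ p = 1
    rw [← map_pow, hx, map_one]
  have hrangechar : P.range.Characteristic := Subgroup.characteristic_iff_le_comap.2
    fun φ x hx => by
    obtain ⟨y, rfl⟩ := hx
    exact ⟨φ y, (map_pow φ y p).symm⟩
  have hZker : Subgroup.center G ≤ P.ker := hZp
  have hkerZ : P.ker = Subgroup.center G := eq_of_isUCS hU hkerchar inferInstance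
    (fun h0 => hZ₀ (le_bot_iff.1 (h0 ▸ hZker)))
    (fun h0 => hPne fun x => (h0 ▸ Subgroup.mem_top x : x ∈ P.ker)) hZ₀ hZ₁
  have hrangeZ' : P.range ≤ Subgroup.center G := by
    rintro _ ⟨x, rfl⟩
    exact hpow x
  have hrangeZ : P.range = Subgroup.center G := eq_of_isUCS hU hrangechar inferInstance
    (fun h0 => hPne fun x => (Subgroup.mem_bot.1 (h0 ▸ ⟨x, rfl⟩ : P x ∈ (⊥ : Subgroup G))))
    (fun h0 => hZ₁ (top_le_iff.1 (h0 ▸ hrangeZ'))) hZ₀ hZ₁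
  have hsurj : ∀ y ∈ Subgroup.center G, ∃ x : G, x ^ p = y := fun y hy =>
    (hrangeZ ▸ hy : y ∈ P.range)
  have hZΦ : Subgroup.center G ≤ frattini G :=
    le_frattini_of_pow _ p (fun x y hy => by rw [hmul, hZp y hy, mul_one]) hsurj
  have hΦ : frattini G = Subgroup.center G := eq_of_isUCS hU inferInstance inferInstance
    (fun h0 => hZ₀ (le_bot_iff.1 (h0 ▸ hZΦ))) frattini_ne_top hZ₀ hZ₁
  have hZcard : Nat.card (Subgroup.center G) = p ^ 4 := by
    rw [← hcard, hΦ, ← hkerZ, Nat.card_congr (QuotientGroup.quotientKerEquivRange P).toEquiv,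
      hrangeZ, hkerZ]
  obtain ⟨θ⟩ := nonempty_mulEquiv_of_pow (A := Subgroup.center G)
    (fun a => Subtype.ext (hZp a a.2)) hZcard
  obtain ⟨f, π, ι, hF⟩ := exists_isFormGroup_of_pow θ hcomm hmul hpow
    (fun x => by rw [← hkerZ, MonoidHom.mem_ker, hP]) hsurj
  refine ⟨f, π, ι, hF, hF.self, ?_, fun W hW => ?_⟩
  · rintro rfl
    refine hnc fun a b => ?_
    rw [hF.comm a b, LinearMap.zero_apply, LinearMap.zero_apply, hF.ι_zero, mul_one]
  · let K : Subgroup G :=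
      { carrier := ι '' W
        one_mem' := ⟨0, W.zero_mem, hF.ι_zero⟩
        mul_mem' := by
          rintro _ _ ⟨v, hv, rfl⟩ ⟨w, hw, rfl⟩
          exact ⟨v + w, W.add_mem hv hw, hF.ι_add v w⟩
        inv_mem' := by
          rintro _ ⟨v, hv, rfl⟩
          exact ⟨-v, W.neg_mem hv, hF.ι_neg v⟩ }
    have hK : ∀ x, x ∈ K ↔ ∃ v ∈ W, ι v = x := fun _ => Iff.rfl
    have hKchar : K.Characteristic := Subgroup.characteristic_iff_le_comap.2 fun φ x hx => by
      obtain ⟨v, hv, rfl⟩ := hx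
      obtain ⟨g, hg, -, hgι⟩ := hF.exists_algAut_of_mulEquiv φ
      exact ⟨g v, hW g hg v hv, (hgι v).symm⟩
    have hKker : K ≤ hF.πHom.ker := by
      rintro _ ⟨v, -, rfl⟩
      exact hF.π_ι v
    by_cases hK0 : K = ⊥
    · refine Or.inl ((Submodule.eq_bot_iff W).2 fun v hv => hF.ι_inj ?_)
      have : ι v ∈ K := ⟨v, hv, rfl⟩
      rw [hK0, Subgroup.mem_bot] at this
      rw [this, hF.ι_zero]
    · have hKeq := eq_of_isUCS hU hKchar hF.characteristic_ker hK0
        (fun h0 => hF.ker_ne_top (top_le_iff.1 (h0 ▸ hKker))) hF.ker_ne_bot hF.ker_ne_top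
      refine Or.inr (Submodule.eq_top_iff'.2 fun v => ?_)
      have hv : ι v ∈ K := hKeq ▸ hF.π_ι v
      obtain ⟨w, hw, hwv⟩ := hv
      rwa [← hF.ι_inj hwv]

end FormGroup

theorem stmt17 (p : ℕ) (hp : p.Prime) (hodd : Odd p) :
    -- (a) for `p = 5` there is no such group
    (p = 5 → ∀ (G : Type) [Group G] [Finite G], ¬ IsUCS4GenExpP2 p G) ∧
    -- (b) for `p ≡ ±1 (mod 5)` there is exactly one isomorphism class,
    -- with induced automorphism group of order `20` on the Frattini quotient
    ((p % 5 = 1 ∨ p % 5 = 4) →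
      (∃ (G : Type) (_ : Group G) (_ : Finite G), IsUCS4GenExpP2 p G) ∧
      (∀ (G H : Type) (_ : Group G) (_ : Finite G) (_ : Group H) (_ : Finite H),
        IsUCS4GenExpP2 p G → IsUCS4GenExpP2 p H → Nonempty (G ≃* H)) ∧
      (∀ (G : Type) (_ : Group G) (_ : Finite G),
        IsUCS4GenExpP2 p G → inducedAutCard G = 20)) ∧
    -- (c) for `p ≡ ±2 (mod 5)` there are exactly two isomorphism classes,
    -- with induced automorphism groups of orders `20` and `5`
    ((p % 5 = 2 ∨ p % 5 = 3) →
      ∃ (G₁ G₂ : Type) (_ : Group G₁) (_ : Finite G₁) (_ : Group G₂) (_ : Finite G₂),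
        IsUCS4GenExpP2 p G₁ ∧ IsUCS4GenExpP2 p G₂ ∧
        IsEmpty (G₁ ≃* G₂) ∧
        (∀ (H : Type) (_ : Group H) (_ : Finite H), IsUCS4GenExpP2 p H →
          Nonempty (H ≃* G₁) ∨ Nonempty (H ≃* G₂)) ∧
        inducedAutCard G₁ = 20 ∧ inducedAutCard G₂ = 5) := by
  have : Fact p.Prime := ⟨hp⟩
  have hp2 : p ≠ 2 := by
    rintro rfl
    exact absurd hodd (by decide)
  refine ⟨fun h5 G _ _ hG => ?_, fun h => ?_, fun h => ?_⟩
  · obtain ⟨f, π, ι, -, hf⟩ := hG.exists_isFormGroup hp2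
    exact hf.irreducible.char_ne_five hf.self hf.ne_zero h5
  · obtain ⟨f, hf, hcard, huniq⟩ := IsUCSForm.exists_unique h
    have hform : ∀ (G : Type) (_ : Group G) (_ : Finite G), IsUCS4GenExpP2 p G →
        ∃ π ι, IsFormGroup (G := G) f π ι := fun G _ _ hG => by
      obtain ⟨f', π, ι, hF, hf'⟩ := hG.exists_isFormGroup hp2
      obtain ⟨e, he⟩ := huniq f' hf'
      exact ⟨_, _, hF.of_iso e he⟩
    refine ⟨?_, fun G H _ _ _ _ hG hH => ?_, fun G _ _ hG => ?_⟩
    · obtain ⟨G, hG, hG', π, ι, hF⟩ := exists_isFormGroup hp2 hf.self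
      exact ⟨G, hG, hG', hF.isUCS4GenExpP2 hp2 hf⟩
    · obtain ⟨π, ι, hF⟩ := hform G _ inferInstance hG
      obtain ⟨π', ι', hF'⟩ := hform H _ inferInstance hH
      obtain ⟨φ, -⟩ := hF.exists_mulEquiv hp2 hF'
      exact ⟨φ⟩
    · obtain ⟨π, ι, hF⟩ := hform G _ inferInstance hG
      rw [hF.inducedAutCard_eq hp2 hf.irreducible, hcard]
  · obtain ⟨f₀, f₁, hf₀, hf₁, hcard₀, hcard₁, hclass⟩ := IsUCSForm.exists_pair h
    obtain ⟨G₁, hG₁, hG₁', π₁, ι₁, hF₁⟩ := exists_isFormGroup hp2 hf₀.self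
    obtain ⟨G₂, hG₂, hG₂', π₂, ι₂, hF₂⟩ := exists_isFormGroup hp2 hf₁.self
    have h20 : inducedAutCard G₁ = 20 := by
      rw [hF₁.inducedAutCard_eq hp2 hf₀.irreducible, hcard₀]
    have h5 : inducedAutCard G₂ = 5 := by
      rw [hF₂.inducedAutCard_eq hp2 hf₁.irreducible, hcard₁]
    refine ⟨G₁, G₂, hG₁, hG₁', hG₂, hG₂', hF₁.isUCS4GenExpP2 hp2 hf₀,
      hF₂.isUCS4GenExpP2 hp2 hf₁, ⟨fun φ => ?_⟩, fun H _ _ hH => ?_, h20, h5⟩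
    · rw [(hF₁.of_mulEquiv φ).inducedAutCard_eq hp2 hf₀.irreducible, hcard₀] at h5
      omega
    · obtain ⟨f', π, ι, hF, hf'⟩ := hH.exists_isFormGroup hp2
      obtain ⟨e, he | he⟩ := hclass f' hf'
      · obtain ⟨φ, -⟩ := (hF.of_iso e he).exists_mulEquiv hp2 hF₁
        exact Or.inl ⟨φ⟩
      · obtain ⟨φ, -⟩ := (hF.of_iso e he).exists_mulEquiv hp2 hF₂
        exact Or.inr ⟨φ⟩
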